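/- arXiv:1802.02723 — 2 statements merged into one kernel-verified Lean document; each statement's English description precedes it below -/
import Mathlib

section
/- There exists a constant C > 0 such that for every integer n ≥ 1 and every C² real-valued function φ on the Riemann sphere ℙ¹, |(d−1)·Σ_{λ∈ℂ : F_n(λ)=0} φ(λ) − d^n·⟨T_f, φ⟩| ≤ (sup_{ℙ¹} |ddᶜφ/ω|)·((2 log d)·n + C), where the sum is over the d^{n−1} zeros of F_n (all of which are simple). -/
open MeasureTheory Real

/- STATEMENT 11:
There exists a constant C > 0 such that for every n ≥ 1 and every C² real-valued
function φ on the Riemann sphere ℙ¹,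
|(d−1)·Σ_{λ∈ℂ : F_n(λ)=0} φ(λ) − d^n·⟨T_f, φ⟩|
  ≤ (sup_{ℙ¹}|ddᶜφ/ω|)·((2 log d)·n + C),
where ⟨T_f, φ⟩ := ((d−1)/d)·(φ(∞) + ∫_ℂ g_I(λ)·(2π)^{−1}·Δφ(λ) dA(λ)) and
ddᶜφ/ω equals (1+|λ|²)²·Δφ(λ)/2 on ℂ.
A C² function φ on ℙ¹ is encoded by its restriction φ : ℂ → ℝ (C² on ℂ), its value
φ∞ at ∞, and the requirement that w ↦ φ(1/w) (extended by φ∞ at 0) is C² at 0;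
the sup of |ddᶜφ/ω| over ℙ¹ is encoded by an arbitrary pointwise bound K on ℂ. -/

noncomputable def fc (d : ℕ) (lam z : ℂ) : ℂ := z ^ d + lam

/-- The Laplacian Δφ = ∂²φ/∂x² + ∂²φ/∂y² of a function `φ : ℂ → ℝ`. -/
noncomputable def lap (φ : ℂ → ℝ) (z : ℂ) : ℝ :=
  iteratedFDeriv ℝ 2 φ z ![1, 1] + iteratedFDeriv ℝ 2 φ z ![Complex.I, Complex.I]


lemma aux_theta (d : ℕ) (hd : 1 < d) (G : ℂ → ENNReal) (hG : Measurable G) (s : ℝ) :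
    ∫⁻ θ in Set.Ioo (-π) π, G (s * Complex.exp ((d * θ : ℝ) * Complex.I)) =
    ∫⁻ θ in Set.Ioo (-π) π, G (s * Complex.exp ((θ : ℝ) * Complex.I)) := by
  have hF : Fact (0 < 2 * π) := ⟨by positivity⟩
  let f : AddCircle (2 * π) → ENNReal := fun x => G (s * (AddCircle.toCircle x : ℂ))
  have hf : Measurable f := by
    apply hG.comp
    apply Measurable.const_mul
    exact (continuous_subtype_val.comp AddCircle.continuous_toCircle).measurable
  have h1 := (AddCircle.ergodic_nsmul (T := 2 * π) hd).toMeasurePreserving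
  have h2 := h1.lintegral_comp hf
  have e : (-π) + 2 * π = π := by ring
  have key : ∀ θ : ℝ, (AddCircle.toCircle (θ : AddCircle (2 * π)) : ℂ) = Complex.exp (θ * Complex.I) := by
    intro θ
    rw [AddCircle.toCircle_apply_mk, Circle.coe_exp]
    congr 2
    field_simp
  rw [← AddCircle.lintegral_preimage (2 * π) (-π), ← AddCircle.lintegral_preimage (2 * π) (-π), e,
    setLIntegral_congr Ioo_ae_eq_Ioc.symm, setLIntegral_congr Ioo_ae_eq_Ioc.symm] at h2
  rw [← show (fun x : AddCircle (2 * π) => f x) = f from rfl] at h2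
  convert h2 using 3 with θ θ
  · simp only [f]
    rw [← key, ← AddCircle.coe_nsmul]
    simp
  · simp only [f]
    rw [← key]

lemma aux_r (d : ℕ) (hd : 1 < d) (g : ℝ → ENNReal) :
    ∫⁻ r in Set.Ioi (0:ℝ), ENNReal.ofReal (r * (d ^ 2 * r ^ (2 * d - 2))) * g (r ^ d) =
      d * ∫⁻ s in Set.Ioi (0:ℝ), ENNReal.ofReal s * g s := by
  have him : (fun r : ℝ => r ^ d) '' Set.Ioi 0 = Set.Ioi 0 := by
    ext x
    constructor
    · rintro ⟨r, hr, rfl⟩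
      exact pow_pos (Set.mem_Ioi.1 hr) d
    · intro hx
      refine ⟨x ^ (1 / (d:ℝ)), Real.rpow_pos_of_pos hx _, ?_⟩
      simp only
      rw [← Real.rpow_natCast, ← Real.rpow_mul (le_of_lt hx)]
      field_simp
      simp
  have hinj : Set.InjOn (fun r : ℝ => r ^ d) (Set.Ioi 0) := by
    intro a ha b hb h
    exact (pow_left_inj₀ (le_of_lt ha) (le_of_lt hb) (by omega)).1 h
  have := lintegral_image_eq_lintegral_abs_deriv_mul (s := Set.Ioi (0:ℝ)) (f := fun r : ℝ => r ^ d)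
    (f' := fun r => d * r ^ (d - 1)) measurableSet_Ioi
    (fun x _ => (hasDerivAt_pow d x).hasDerivWithinAt) hinj (fun s => ENNReal.ofReal s * g s)
  rw [him] at this
  rw [this, ← lintegral_const_mul' _ _ (by simp)]
  apply setLIntegral_congr_fun measurableSet_Ioi
  intro r hr
  have hr : 0 < r := hr
  simp only
  rw [← mul_assoc (ENNReal.ofReal _), ← mul_assoc (d : ENNReal), ← ENNReal.ofReal_natCast, ← ENNReal.ofReal_mul (by positivity),
    ← ENNReal.ofReal_mul (by positivity)]
  congr 2
  rw [abs_of_nonneg (by positivity)]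
  obtain ⟨k, rfl⟩ : ∃ k, d = k + 1 := ⟨d - 1, by omega⟩
  have : 2 * (k + 1) - 2 = 2 * k := by omega
  rw [this]
  simp only [Nat.add_sub_cancel]
  ring

lemma polar_exp (p : ℝ × ℝ) : Complex.polarCoord.symm p = p.1 * Complex.exp (p.2 * Complex.I) := by
  rw [Complex.polarCoord_symm_apply, Complex.exp_mul_I]
  push_cast
  ring

lemma lintegral_polar (f : ℂ → ENNReal) (hf : Measurable f) :
    ∫⁻ z, f z = ∫⁻ r in Set.Ioi (0:ℝ), ENNReal.ofReal r *
      ∫⁻ θ in Set.Ioo (-π) π, f (r * Complex.exp (θ * Complex.I)) := by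
  rw [← Complex.lintegral_comp_polarCoord_symm]
  have : polarCoord.target = Set.Ioi (0:ℝ) ×ˢ Set.Ioo (-π) π := rfl
  rw [this]
  simp_rw [polar_exp]
  rw [Measure.volume_eq_prod, setLIntegral_prod]
  · apply lintegral_congr
    intro r
    rw [← lintegral_const_mul]
    · simp
    · apply hf.comp
      fun_prop
  · apply Measurable.aemeasurable
    simp only [smul_eq_mul]
    apply Measurable.mul
    · fun_prop
    · apply hf.comp
      fun_prop

lemma pow_lintegral (d : ℕ) (hd : 1 < d) (G : ℂ → ENNReal) (hG : Measurable G) :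
    ∫⁻ z, ENNReal.ofReal (d ^ 2 * ‖z‖ ^ (2 * d - 2)) * G (z ^ d) = d * ∫⁻ z, G z := by
  rw [lintegral_polar _ hG, ← aux_r d hd, lintegral_polar _ (by fun_prop)]
  apply setLIntegral_congr_fun measurableSet_Ioi
  intro r hr
  have hr : 0 < r := hr
  simp only
  rw [ENNReal.ofReal_mul hr.le, mul_assoc]
  congr 1
  have : ∀ θ : ℝ, ‖(r:ℂ) * Complex.exp (θ * Complex.I)‖ = r := by
    intro θ
    rw [norm_mul, Complex.norm_exp_ofReal_mul_I]
    simp [abs_of_pos hr]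
  simp_rw [this]
  rw [lintegral_const_mul]
  · congr 1
    rw [← aux_theta d hd G hG]
    apply lintegral_congr
    intro θ
    congr 1
    rw [mul_pow, ← Complex.exp_nat_mul]
    push_cast
    ring_nf
  · apply hG.comp
    fun_prop


lemma rot_lintegral (c : ℂ) (hc : ‖c‖ = 1) (g : ℂ → ENNReal) (hg : Measurable g) :
    ∫⁻ z, g (c * z) = ∫⁻ z, g z := by
  let c' : Circle := ⟨c, by simpa [Submonoid.unitSphere] using hc⟩
  have h := (rotation c').measurePreserving
  have := h.lintegral_comp hg
  exact this

lemma transfer_ineq (d : ℕ) (hd : 1 < d) (lam ω : ℂ) (hω : ω ^ d = 1) (T q : ℂ → ℂ)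
    (hT : Measurable T) (hq : Measurable q) (V : Set ℂ) (hV : MeasurableSet V)
    (h : ∀ z, z ^ d + lam ∈ V →
      T (z ^ d + lam) * (d * z ^ (d - 1)) ^ 2 = ∑ i ∈ Finset.range d, (ω ^ i) ^ 2 * q (ω ^ i * z)) :
    ∫⁻ w in V, ‖T w‖ₑ ≤ ∫⁻ z in {z | z ^ d + lam ∈ V}, ‖q z‖ₑ := by
  have hd0 : (d : ENNReal) ≠ 0 := by simp; omega
  have hω1 : ∀ i : ℕ, ‖ω ^ i‖ = 1 := by
    intro i
    have : ‖ω‖ = 1 := by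
      have h1 : ‖ω‖ ^ d = 1 := by rw [← norm_pow, hω, norm_one]
      exact (pow_eq_one_iff_of_nonneg (norm_nonneg _) (by omega)).1 h1
    rw [norm_pow, this, one_pow]
  have hWm : MeasurableSet {z | z ^ d + lam ∈ V} := by
    have : Measurable (fun z : ℂ => z ^ d + lam) := by fun_prop
    exact this hV
  have h1 := pow_lintegral d hd (fun u => V.indicator (fun w => ‖T w‖ₑ) (u + lam))
    ((hT.enorm.indicator hV).comp (by fun_prop))
  rw [lintegral_add_right_eq_self (fun u => V.indicator (fun w => ‖T w‖ₑ) u),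
    lintegral_indicator hV] at h1
  rw [← ENNReal.mul_le_mul_iff_right hd0 (by simp), ← h1]
  calc _ ≤ ∫⁻ z, ∑ i ∈ Finset.range d, ({z | z ^ d + lam ∈ V}.indicator (fun z => ‖q z‖ₑ) (ω ^ i * z)) := by
        apply lintegral_mono
        intro z
        simp only
        by_cases hz : z ^ d + lam ∈ V
        · rw [Set.indicator_of_mem hz]
          have h2 : ∀ i ∈ Finset.range d, ({z | z ^ d + lam ∈ V}.indicator (fun z => ‖q z‖ₑ) (ω ^ i * z)) = ‖(ω ^ i) ^ 2 * q (ω ^ i * z)‖ₑ := by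
            intro i _
            rw [Set.indicator_of_mem]
            · rw [enorm_mul]
              have : ‖(ω ^ i) ^ 2‖ₑ = 1 := by
                rw [← ofReal_norm, norm_pow, hω1]; simp
              rw [this, one_mul]
            · simp only [Set.mem_ofPred_eq, mul_pow]
              rw [← pow_mul, mul_comm i d, pow_mul, hω, one_pow, one_mul]
              exact hz
          rw [Finset.sum_congr rfl h2]
          have h3 : ENNReal.ofReal (d ^ 2 * ‖z‖ ^ (2 * d - 2)) = ‖(d * z ^ (d - 1)) ^ 2‖ₑ := by
            rw [← ofReal_norm]
            congr 1
            rw [norm_pow, norm_mul, norm_pow, mul_pow, ← pow_mul]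
            simp
            left
            congr 1
            omega
          rw [h3, ← enorm_mul, mul_comm, h z hz]
          exact enorm_sum_le _ _
        · rw [Set.indicator_of_notMem hz]
          simp
    _ = ∑ i ∈ Finset.range d, ∫⁻ z, ({z | z ^ d + lam ∈ V}.indicator (fun z => ‖q z‖ₑ) (ω ^ i * z)) := by
        rw [lintegral_finsetSum]
        intro i _
        exact (hq.enorm.indicator hWm).comp (by fun_prop)
    _ = ∑ i ∈ Finset.range d, ∫⁻ z, ({z | z ^ d + lam ∈ V}.indicator (fun z => ‖q z‖ₑ) z) := by
        apply Finset.sum_congr rfl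
        intro i _
        exact rot_lintegral _ (hω1 i) _ (hq.enorm.indicator hWm)
    _ = _ := by
        rw [lintegral_indicator hWm]
        simp

lemma root_sum (d : ℕ) (hd : 1 < d) (ω : ℂ) (hω : IsPrimitiveRoot ω d) (z x : ℂ)
    (hzx : z ^ d ≠ x ^ d) :
    ∑ i ∈ Finset.range d, (ω ^ i) ^ 2 * (1 / (ω ^ i * z - x)) =
      d * z ^ (d - 2) * x / (z ^ d - x ^ d) := by
  have hne : z ^ d - x ^ d ≠ 0 := sub_ne_zero.2 hzx
  have hp : ∀ i : ℕ, (ω ^ i * z) ^ d = z ^ d := by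
    intro i
    rw [mul_pow, ← pow_mul, mul_comm i d, pow_mul, hω.pow_eq_one, one_pow, one_mul]
  have h1 : ∀ i : ℕ, 1 / (ω ^ i * z - x) =
      (∑ j ∈ Finset.range d, (ω ^ i * z) ^ j * x ^ (d - 1 - j)) / (z ^ d - x ^ d) := by
    intro i
    have h2 : ω ^ i * z - x ≠ 0 := by
      intro h
      apply hzx
      rw [← hp i, sub_eq_zero.1 h]
    rw [div_eq_div_iff h2 hne, one_mul, ← hp i, ← (Commute.all _ _).geom_sum₂_mul]
  simp_rw [h1, mul_div_assoc']
  rw [← Finset.sum_div]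
  congr 1
  simp_rw [Finset.mul_sum]
  rw [Finset.sum_comm, Finset.sum_eq_single (d - 2)]
  · have : ∀ i : ℕ, (ω ^ i) ^ 2 * ((ω ^ i * z) ^ (d - 2) * x ^ (d - 1 - (d - 2))) = z ^ (d - 2) * x := by
      intro i
      have e1 : d - 1 - (d - 2) = 1 := by omega
      rw [e1, mul_pow, pow_one]
      have e2 : (ω ^ i) ^ 2 * (ω ^ i) ^ (d - 2) = 1 := by
        rw [← pow_add, show 2 + (d - 2) = d by omega, ← pow_mul, mul_comm i d, pow_mul, hω.pow_eq_one, one_pow]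
      linear_combination z ^ (d - 2) * x * e2
    simp_rw [this]
    simp
    ring
  · intro j hj hj2
    have hj := Finset.mem_range.1 hj
    have : ∀ i : ℕ, (ω ^ i) ^ 2 * ((ω ^ i * z) ^ j * x ^ (d - 1 - j)) = (ω ^ (j + 2)) ^ i * (z ^ j * x ^ (d - 1 - j)) := by
      intro i
      ring
    simp_rw [this]
    rw [← Finset.sum_mul]
    have h0 : ω ^ (j + 2) ≠ 1 := by
      rw [Ne, hω.pow_eq_one_iff_dvd]
      intro hdv
      obtain ⟨k, hk⟩ := hdv
      have : k = 1 := by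
        rcases k with _ | _ | k
        · omega
        · rfl
        · have : d * (k + 1 + 1) = d * k + 2 * d := by ring
          have : 0 ≤ d * k := Nat.zero_le _
          omega
      subst this
      omega
    have h3 := mul_geom_sum (ω ^ (j + 2)) d
    rw [← pow_mul, mul_comm (j + 2) d, pow_mul, hω.pow_eq_one, one_pow, sub_self] at h3
    rcases mul_eq_zero.1 h3 with h | h
    · exact absurd (sub_eq_zero.1 h) h0
    · rw [h, zero_mul]
  · intro h
    exact absurd (Finset.mem_range.2 (by omega)) h


noncomputable def bet (d m : ℕ) (u : ℕ → ℂ) (i : ℕ) : ℂ := ∏ j ∈ Finset.Ico i m, (d : ℂ) * u j ^ (d - 1)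

noncomputable def qf (d m : ℕ) (u : ℕ → ℂ) (w : ℂ) : ℂ :=
  ∑ i ∈ Finset.range (m + 1), bet d m u i * (1 / (w - u i))

noncomputable def Tf (d m : ℕ) (u : ℕ → ℂ) (w : ℂ) : ℂ :=
  ∑ i ∈ Finset.range (m + 1), bet d m u i * (u i / (d * (w - u 0) * (w - u (i + 1))))

lemma bet_succ (d m : ℕ) (u : ℕ → ℂ) (i : ℕ) (hi : i < m) :
    bet d m u i = d * u i ^ (d - 1) * bet d m u (i + 1) := by
  unfold bet
  rw [Finset.prod_eq_prod_Ico_succ_bot hi]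

lemma bet_self (d m : ℕ) (u : ℕ → ℂ) : bet d m u m = 1 := by
  simp [bet]

lemma qf_meas (d m : ℕ) (u : ℕ → ℂ) : Measurable (qf d m u) := by
  unfold qf
  fun_prop

lemma Tf_meas (d m : ℕ) (u : ℕ → ℂ) : Measurable (Tf d m u) := by
  unfold Tf
  fun_prop

lemma Tf_push (d m : ℕ) (hd : 1 < d) (lam : ℂ) (u : ℕ → ℂ) (h0 : u 0 = lam)
    (hu : ∀ i, u (i + 1) = u i ^ d + lam) (ω : ℂ) (hω : IsPrimitiveRoot ω d) (z : ℂ) (hz : z ≠ 0)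
    (hzu : ∀ i ∈ Finset.range (m + 1), z ^ d ≠ u i ^ d) :
    Tf d m u (z ^ d + lam) * (d * z ^ (d - 1)) ^ 2 =
      ∑ i ∈ Finset.range d, (ω ^ i) ^ 2 * qf d m u (ω ^ i * z) := by
  unfold Tf qf
  simp_rw [Finset.mul_sum]
  rw [Finset.sum_comm, Finset.sum_mul]
  apply Finset.sum_congr rfl
  intro k hk
  have h1 := root_sum d hd ω hω z (u k) (hzu k hk)
  have h2 : ∀ i : ℕ, (ω ^ i) ^ 2 * (bet d m u k * (1 / (ω ^ i * z - u k))) =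
    bet d m u k * ((ω ^ i) ^ 2 * (1 / (ω ^ i * z - u k))) := by intro i; ring
  simp_rw [h2]
  rw [← Finset.mul_sum, h1, mul_assoc, h0, hu]
  congr 1
  have e1 : z ^ d + lam - lam = z ^ d := by ring
  have e2 : z ^ d + lam - (u k ^ d + lam) = z ^ d - u k ^ d := by ring
  rw [e1, e2]
  have hne : z ^ d - u k ^ d ≠ 0 := sub_ne_zero.2 (hzu k hk)
  have hd0 : (d : ℂ) ≠ 0 := by
    have : d ≠ 0 := by omega
    exact_mod_cast this
  obtain ⟨e, rfl⟩ : ∃ e, d = e + 2 := ⟨d - 2, by omega⟩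
  simp only [Nat.add_sub_cancel, show e + 2 - 1 = e + 1 by omega]
  field_simp
  ring

lemma Tf_eq (d m : ℕ) (hd : 1 < d) (lam : ℂ) (u : ℕ → ℂ) (h0 : u 0 = lam)
    (hu : ∀ i, u (i + 1) = u i ^ d + lam) (w : ℂ) (hw : ∀ i ∈ Finset.range (m + 2), w ≠ u i) :
    Tf d m u w = qf d m u w - (∑ i ∈ Finset.range (m + 1), bet d m u i) / (w - lam) +
      u m / (d * (w - lam) * (w - u (m + 1))) := by
  have hd0 : (d : ℂ) ≠ 0 := by
    have : d ≠ 0 := by omega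
    exact_mod_cast this
  have hw' : ∀ i ∈ Finset.range (m + 2), w - u i ≠ 0 := fun i hi => sub_ne_zero.2 (hw i hi)
  have hwl : w - lam ≠ 0 := by
    rw [← h0]; exact hw' 0 (by simp)
  have e1 : qf d m u w - (∑ i ∈ Finset.range (m + 1), bet d m u i) / (w - lam) =
    ∑ i ∈ Finset.range (m + 1), bet d m u i * (1 / (w - u i) - 1 / (w - lam)) := by
    unfold qf
    rw [Finset.sum_div, ← Finset.sum_sub_distrib]
    apply Finset.sum_congr rfl
    intro i _
    ring
  rw [e1, Finset.sum_range_succ']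
  unfold Tf
  rw [Finset.sum_range_succ, h0, bet_self]
  simp only [sub_self, mul_zero, add_zero, one_mul]
  congr 1
  apply Finset.sum_congr rfl
  intro i hi
  have hi := Finset.mem_range.1 hi
  rw [bet_succ d m u i hi]
  have h3 := hw' (i + 1) (Finset.mem_range.2 (by omega))
  have h4 : u (i + 1) - lam = u i ^ (d - 1) * u i := by
    rw [hu, ← pow_succ, show d - 1 + 1 = d by omega]; ring
  field_simp
  linear_combination (-bet d m u (i + 1)) * h4


lemma shift_lint (g : ℂ → ENNReal) :
    ∫⁻ θ in Set.Ioo (-π) π, g (Complex.exp ((θ : ℝ) * Complex.I)) =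
    ∫⁻ θ in Set.Ioc 0 (2 * π), g (Complex.exp ((θ : ℝ) * Complex.I)) := by
  have hF : Fact (0 < 2 * π) := ⟨by positivity⟩
  let f : AddCircle (2 * π) → ENNReal := fun x => g ((AddCircle.toCircle x : ℂ))
  have e : (-π) + 2 * π = π := by ring
  have key : ∀ θ : ℝ, (AddCircle.toCircle (θ : AddCircle (2 * π)) : ℂ) = Complex.exp (θ * Complex.I) := by
    intro θ
    rw [AddCircle.toCircle_apply_mk, Circle.coe_exp]
    congr 2
    field_simp
  have h1 := AddCircle.lintegral_preimage (2 * π) (-π) f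
  have h2 := AddCircle.lintegral_preimage (2 * π) 0 f
  rw [← h2, e, zero_add] at h1
  rw [setLIntegral_congr Ioo_ae_eq_Ioc]
  simpa only [f, key] using h1

lemma circle_enorm_le (f : ℂ → ℂ) (r : ℝ) (hr : 0 < r) :
    ‖∮ z in C(0, r), f z‖ₑ ≤
      ENNReal.ofReal r * ∫⁻ θ in Set.Ioo (-π) π, ‖f (r * Complex.exp (θ * Complex.I))‖ₑ := by
  rw [shift_lint (fun w => ‖f (r * w)‖ₑ), ← lintegral_const_mul' _ _ (by simp)]
  rw [circleIntegral, intervalIntegral.integral_of_le (by positivity)]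
  refine (enorm_integral_le_lintegral_enorm _).trans ?_
  apply lintegral_mono
  intro θ
  simp only
  rw [enorm_smul]
  have : ‖deriv (circleMap 0 r) θ‖ₑ = ENNReal.ofReal r := by
    rw [← ofReal_norm]
    simp [abs_of_pos hr]
  rw [this]
  simp [circleMap]

lemma qf_circle (d m : ℕ) (u : ℕ → ℂ) (r : ℝ) (hr : 0 < r)
    (hne : ∀ i ∈ Finset.range (m + 1), ‖u i‖ ≠ r) :
    ∮ z in C(0, r), qf d m u z =
      ∑ i ∈ Finset.range (m + 1), bet d m u i * (if ‖u i‖ < r then 2 * π * Complex.I else 0) := by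
  unfold qf
  rw [circleIntegral.integral_fun_sum]
  · apply Finset.sum_congr rfl
    intro i hi
    rw [circleIntegral.integral_const_mul]
    congr 1
    simp only [one_div]
    split_ifs with h
    · rw [circleIntegral.integral_sub_inv_of_mem_ball]
      simpa using h
    · apply DiffContOnCl.circleIntegral_eq_zero hr.le
      have hlt : r < ‖u i‖ := lt_of_le_of_ne (not_lt.1 h) (hne i hi).symm
      apply DifferentiableOn.diffContOnCl
      rw [closure_ball _ hr.ne']
      intro z hz
      have hz : ‖z‖ ≤ r := by simpa using hz
      apply DifferentiableAt.differentiableWithinAt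
      apply DifferentiableAt.inv (by fun_prop)
      intro h0
      rw [sub_eq_zero.1 h0] at hz
      linarith
  · intro i hi
    apply ContinuousOn.circleIntegrable hr.le
    apply ContinuousOn.mul continuousOn_const
    apply ContinuousOn.div continuousOn_const (by fun_prop)
    intro z hz h0
    apply hne i hi
    rw [← sub_eq_zero.1 h0]
    simpa using hz

lemma circle_lower (d m : ℕ) (u : ℕ → ℂ) (r ρ : ℝ) (hr : 0 < r) (hrρ : r ≤ ρ)
    (hm : ‖u m‖ < r)
    (hb : ∑ i ∈ (Finset.range m).filter (fun i => ‖u i‖ ≤ ρ), ‖bet d m u i‖ ≤ 1 / 2)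
    (hne : ∀ i ∈ Finset.range (m + 1), ‖u i‖ ≠ r) :
    ENNReal.ofReal π ≤ ENNReal.ofReal r *
      ∫⁻ θ in Set.Ioo (-π) π, ‖qf d m u (r * Complex.exp (θ * Complex.I))‖ₑ := by
  refine le_trans ?_ (circle_enorm_le _ r hr)
  rw [qf_circle d m u r hr hne, ← ofReal_norm]
  apply ENNReal.ofReal_le_ofReal
  rw [Finset.sum_range_succ, bet_self, if_pos hm, one_mul]
  have hpi : ‖(2 * π * Complex.I : ℂ)‖ = 2 * π := by
    simp [abs_of_pos pi_pos]
  have h1 : ‖∑ i ∈ Finset.range m, bet d m u i * (if ‖u i‖ < r then 2 * π * Complex.I else 0)‖ ≤ π := by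
    calc _ ≤ ∑ i ∈ Finset.range m, ‖bet d m u i * (if ‖u i‖ < r then 2 * π * Complex.I else 0)‖ := norm_sum_le _ _
      _ ≤ ∑ i ∈ Finset.range m, (if ‖u i‖ ≤ ρ then ‖bet d m u i‖ else 0) * (2 * π) := by
          apply Finset.sum_le_sum
          intro i _
          rw [norm_mul]
          by_cases h : ‖u i‖ < r
          · rw [if_pos h, if_pos (by linarith), hpi]
          · rw [if_neg h, norm_zero, mul_zero]
            apply mul_nonneg _ (by positivity)
            split_ifs <;> positivity
      _ = (∑ i ∈ (Finset.range m).filter (fun i => ‖u i‖ ≤ ρ), ‖bet d m u i‖) * (2 * π) := by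
          rw [← Finset.sum_mul, Finset.sum_filter]
      _ ≤ 1 / 2 * (2 * π) := by gcongr
      _ = π := by ring
  have h2 := norm_sub_le_norm_add (2 * π * Complex.I : ℂ) (∑ i ∈ Finset.range m, bet d m u i * (if ‖u i‖ < r then 2 * π * Complex.I else 0))
  rw [add_comm]
  rw [hpi] at h2
  linarith

lemma annulus_lower (d m : ℕ) (u : ℕ → ℂ) (ρ : ℝ) (s : ℕ → ℝ) (hρ : 0 < ρ)
    (hs : ∀ i ∈ Finset.range (m + 1), 0 < s i) (hsum : ∑ i ∈ Finset.range (m + 1), s i ≤ ρ / 8)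
    (hm : ‖u m‖ ≤ ρ / 2)
    (hb : ∑ i ∈ (Finset.range m).filter (fun i => ‖u i‖ ≤ ρ), ‖bet d m u i‖ ≤ 1 / 2)
    (A : Set ℂ) (hA : MeasurableSet A)
    (hAin : ∀ z : ℂ, ‖z‖ < ρ → (∀ i ∈ Finset.range (m + 1), s i < ‖z - u i‖) → z ∈ A) :
    ENNReal.ofReal (π * (ρ / 4)) ≤ ∫⁻ z in A, ‖qf d m u z‖ₑ := by
  rw [← lintegral_indicator hA, lintegral_polar _ ((qf_meas d m u).enorm.indicator hA)]
  set U : Set ℝ := ⋃ i ∈ Finset.range (m + 1), Set.Icc (‖u i‖ - s i) (‖u i‖ + s i) with hU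
  set B : Set ℝ := Set.Ioo (ρ / 2) ρ \ U with hB
  have hUm : MeasurableSet U := by
    apply Finset.measurableSet_biUnion
    intro i _
    exact measurableSet_Icc
  have hBm : MeasurableSet B := measurableSet_Ioo.diff hUm
  have hvol : ENNReal.ofReal (ρ / 4) ≤ volume B := by
    have h1 : volume (Set.Ioo (ρ / 2) ρ) ≤ volume U + volume B := by
      refine (measure_le_inter_add_sdiff volume _ U).trans ?_
      gcongr
      exact Set.inter_subset_right
    have h2 : volume U ≤ ENNReal.ofReal (ρ / 4) := by
      refine (measure_biUnion_finset_le _ _).trans ?_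
      simp only [Real.volume_Icc]
      rw [← ENNReal.ofReal_sum_of_nonneg]
      · apply ENNReal.ofReal_le_ofReal
        have : ∀ i, ‖u i‖ + s i - (‖u i‖ - s i) = 2 * s i := by intro i; ring
        simp_rw [this]
        rw [← Finset.mul_sum]
        linarith
      · intro i hi
        have := hs i hi
        linarith
    rw [Real.volume_Ioo] at h1
    have h3 : ENNReal.ofReal (ρ / 4) + ENNReal.ofReal (ρ / 4) ≤ ENNReal.ofReal (ρ / 4) + volume B := by
      rw [← ENNReal.ofReal_add (by positivity) (by positivity)]
      refine le_trans (le_of_eq ?_) (h1.trans (by gcongr))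
      congr 1
      ring
    exact (ENNReal.add_le_add_iff_left (by simp)).1 h3
  calc ENNReal.ofReal (π * (ρ / 4)) = ENNReal.ofReal π * ENNReal.ofReal (ρ / 4) :=
        ENNReal.ofReal_mul pi_pos.le
    _ ≤ ENNReal.ofReal π * volume B := by gcongr
    _ = ∫⁻ r in B, ENNReal.ofReal π := by simp
    _ ≤ ∫⁻ r in B, ENNReal.ofReal r *
      ∫⁻ θ in Set.Ioo (-π) π, A.indicator (fun z => ‖qf d m u z‖ₑ) (r * Complex.exp (θ * Complex.I)) := by
        apply setLIntegral_mono' hBm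
        intro r hr
        have hr1 : ρ / 2 < r := hr.1.1
        have hr2 : r < ρ := hr.1.2
        have hrU : ∀ i ∈ Finset.range (m + 1), s i < |r - ‖u i‖| := by
          intro i hi
          by_contra hcon
          apply hr.2
          rw [hU]
          simp only [Set.mem_iUnion]
          refine ⟨i, hi, ?_⟩
          have := abs_le.1 (not_lt.1 hcon)
          constructor <;> linarith
        have hr0 : 0 < r := by linarith
        have hnorm : ∀ θ : ℝ, ‖(r : ℂ) * Complex.exp (θ * Complex.I)‖ = r := by
          intro θ
          rw [norm_mul, Complex.norm_exp_ofReal_mul_I]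
          simp [abs_of_pos hr0]
        have hmem : ∀ θ : ℝ, (r : ℂ) * Complex.exp (θ * Complex.I) ∈ A := by
          intro θ
          apply hAin
          · rw [hnorm]; exact hr2
          · intro i hi
            refine (hrU i hi).trans_le ?_
            have h := abs_norm_sub_norm_le ((r : ℂ) * Complex.exp (θ * Complex.I)) (u i)
            rwa [hnorm] at h
        have : ∀ θ : ℝ, A.indicator (fun z => ‖qf d m u z‖ₑ) (r * Complex.exp (θ * Complex.I)) =
            ‖qf d m u (r * Complex.exp (θ * Complex.I))‖ₑ := by
          intro θ
          rw [Set.indicator_of_mem (hmem θ)]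
        simp_rw [this]
        apply circle_lower d m u r ρ hr0 hr2.le (by linarith) hb
        intro i hi h
        have h1 := hrU i hi
        rw [h, sub_self, abs_zero] at h1
        have := hs i hi
        linarith
    _ ≤ _ := by
        apply lintegral_mono_set
        intro r hr
        have hr1 : ρ / 2 < r := hr.1.1
        exact Set.mem_Ioi.2 (by linarith)


lemma inv_sq_lint (σ : ℝ) (hσ : 0 < σ) (hσ4 : σ ≤ 4) :
    ∫⁻ y : ℂ in {y : ℂ | σ < ‖y‖ ∧ ‖y‖ < 4}, ENNReal.ofReal (‖y‖ ^ 2)⁻¹ =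
      ENNReal.ofReal (2 * π * Real.log (4 / σ)) := by
  have hm : MeasurableSet {y : ℂ | σ < ‖y‖ ∧ ‖y‖ < 4} := by
    apply MeasurableSet.inter
    · exact measurableSet_lt measurable_const measurable_norm
    · exact measurableSet_lt measurable_norm measurable_const
  rw [← lintegral_indicator hm, lintegral_polar]
  swap
  · apply Measurable.indicator _ hm
    fun_prop
  have h1 : ∫⁻ r in Set.Ioi (0:ℝ), ENNReal.ofReal r *
      ∫⁻ θ in Set.Ioo (-π) π, {y : ℂ | σ < ‖y‖ ∧ ‖y‖ < 4}.indicator (fun y => ENNReal.ofReal (‖y‖ ^ 2)⁻¹) (r * Complex.exp (θ * Complex.I))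
      = ∫⁻ r in Set.Ioi (0:ℝ), (Set.Ioo σ 4).indicator (fun r => ENNReal.ofReal (2 * π * r⁻¹)) r := by
    apply setLIntegral_congr_fun measurableSet_Ioi
    intro r hr
    have hr : 0 < r := hr
    have hnorm : ∀ θ : ℝ, ‖(r : ℂ) * Complex.exp (θ * Complex.I)‖ = r := by
      intro θ
      rw [norm_mul, Complex.norm_exp_ofReal_mul_I]
      simp [abs_of_pos hr]
    simp only
    by_cases h : r ∈ Set.Ioo σ 4
    · rw [Set.indicator_of_mem h]
      have : ∀ θ : ℝ, {y : ℂ | σ < ‖y‖ ∧ ‖y‖ < 4}.indicator (fun y => ENNReal.ofReal (‖y‖ ^ 2)⁻¹) (r * Complex.exp (θ * Complex.I)) = ENNReal.ofReal (r ^ 2)⁻¹ := by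
        intro θ
        rw [Set.indicator_of_mem, hnorm]
        simp only [Set.mem_ofPred_eq]
        rw [hnorm]
        exact h
      simp_rw [this]
      rw [setLIntegral_const, Real.volume_Ioo, ← ENNReal.ofReal_mul (by positivity), ← ENNReal.ofReal_mul (by positivity)]
      congr 1
      field_simp
      ring
    · rw [Set.indicator_of_notMem h]
      have : ∀ θ : ℝ, {y : ℂ | σ < ‖y‖ ∧ ‖y‖ < 4}.indicator (fun y => ENNReal.ofReal (‖y‖ ^ 2)⁻¹) (r * Complex.exp (θ * Complex.I)) = 0 := by
        intro θ
        rw [Set.indicator_of_notMem]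
        simp only [Set.mem_ofPred_eq]
        rw [hnorm]
        exact h
      simp_rw [this]
      simp
  rw [h1, lintegral_indicator measurableSet_Ioo, Measure.restrict_restrict measurableSet_Ioo]
  have h2 : Set.Ioo σ 4 ∩ Set.Ioi 0 = Set.Ioo σ 4 := by
    apply Set.inter_eq_left.2
    intro x hx
    exact hσ.trans hx.1
  rw [h2, setLIntegral_congr Ioo_ae_eq_Ioc, ← ofReal_integral_eq_lintegral_ofReal]
  · congr 1
    rw [← intervalIntegral.integral_of_le hσ4, intervalIntegral.integral_const_mul, integral_inv_of_pos hσ (by norm_num)]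
  · rw [← IntegrableOn, ← intervalIntegrable_iff_integrableOn_Ioc_of_le hσ4]
    apply IntervalIntegrable.const_mul
    apply ContinuousOn.intervalIntegrable
    apply ContinuousOn.inv₀ continuousOn_id
    rw [Set.uIcc_of_le hσ4]
    intro x hx
    exact (hσ.trans_le hx.1).ne'
  · filter_upwards [ae_restrict_mem measurableSet_Ioc] with r hr
    have : 0 < r := hσ.trans hr.1
    positivity

lemma err_upper (d m : ℕ) (hd : 1 < d) (lam : ℂ) (hlam : ‖lam‖ ≤ 2) (u : ℕ → ℂ)
    (hu : ∀ i, u (i + 1) = u i ^ d + lam) (ρ : ℝ) (hρ : 0 < ρ) (hρ1 : ρ ≤ 1)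
    (hm : ‖u m‖ ≤ ρ / 2) (V : Set ℂ) (hV : ∀ w ∈ V, ‖w‖ < 2 ∧ ρ ^ d < ‖w - lam‖) :
    ∫⁻ w in V, ‖u m / (d * (w - lam) * (w - u (m + 1)))‖ₑ ≤
      ENNReal.ofReal (4 * π * ‖u m‖ / d * Real.log (4 / ρ ^ d)) := by
  have hd0 : (0:ℝ) < d := by
    have : 0 < d := by omega
    exact_mod_cast this
  have hρd : 0 < ρ ^ d := by positivity
  have hρd1 : ρ ^ d ≤ 1 := pow_le_one₀ hρ.le hρ1
  have hmm : MeasurableSet {y : ℂ | ρ ^ d < ‖y‖ ∧ ‖y‖ < 4} := by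
    apply MeasurableSet.inter
    · exact measurableSet_lt measurable_const measurable_norm
    · exact measurableSet_lt measurable_norm measurable_const
  have hmS : MeasurableSet {w : ℂ | ρ ^ d < ‖w - lam‖ ∧ ‖w - lam‖ < 4} := by
    have : Measurable (fun w : ℂ => w - lam) := by fun_prop
    exact this hmm
  calc _ ≤ ∫⁻ w in {w : ℂ | ρ ^ d < ‖w - lam‖ ∧ ‖w - lam‖ < 4}, ‖u m / (d * (w - lam) * (w - u (m + 1)))‖ₑ := by
        apply lintegral_mono_set
        intro w hw
        obtain ⟨h1, h2⟩ := hV w hw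
        refine ⟨h2, ?_⟩
        have := norm_sub_le w lam
        linarith
    _ ≤ ∫⁻ w in {w : ℂ | ρ ^ d < ‖w - lam‖ ∧ ‖w - lam‖ < 4}, ENNReal.ofReal (2 * ‖u m‖ / d) * ENNReal.ofReal (‖w - lam‖ ^ 2)⁻¹ := by
        apply setLIntegral_mono' hmS
        intro w hw
        obtain ⟨h1, h2⟩ := hw
        rw [← ENNReal.ofReal_mul (by positivity), ← ofReal_norm]
        apply ENNReal.ofReal_le_ofReal
        have h3 : ‖w - u (m + 1)‖ ≥ ‖w - lam‖ / 2 := by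
          have e : w - u (m + 1) = (w - lam) - u m ^ d := by rw [hu]; ring
          have h4 : ‖u m ^ d‖ ≤ ρ ^ d / 2 := by
            rw [norm_pow]
            calc ‖u m‖ ^ d ≤ (ρ / 2) ^ d := by gcongr
              _ = ρ ^ d / 2 ^ d := by rw [div_pow]
              _ ≤ ρ ^ d / 2 := by
                gcongr
                calc (2:ℝ) = 2 ^ 1 := by norm_num
                  _ ≤ 2 ^ d := by gcongr <;> norm_num
          have := norm_sub_norm_le (w - lam) (u m ^ d)
          rw [e]
          linarith
        have hpos : 0 < ‖w - lam‖ := hρd.trans h1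
        rw [norm_div, norm_mul, norm_mul]
        have : ‖(d : ℂ)‖ = d := by simp
        rw [this]
        calc ‖u m‖ / (d * ‖w - lam‖ * ‖w - u (m + 1)‖) ≤ ‖u m‖ / (d * ‖w - lam‖ * (‖w - lam‖ / 2)) := by
              gcongr
          _ = _ := by field_simp
    _ = ENNReal.ofReal (2 * ‖u m‖ / d) * ∫⁻ w in {w : ℂ | ρ ^ d < ‖w - lam‖ ∧ ‖w - lam‖ < 4}, ENNReal.ofReal (‖w - lam‖ ^ 2)⁻¹ := by
        rw [lintegral_const_mul' _ _ (by simp)]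
    _ = ENNReal.ofReal (2 * ‖u m‖ / d) * ENNReal.ofReal (2 * π * Real.log (4 / ρ ^ d)) := by
        congr 1
        rw [← inv_sq_lint _ hρd (by linarith), ← lintegral_indicator hmS, ← lintegral_indicator hmm]
        have := lintegral_sub_right_eq_self (μ := volume) (fun y : ℂ => {y : ℂ | ρ ^ d < ‖y‖ ∧ ‖y‖ < 4}.indicator (fun y => ENNReal.ofReal (‖y‖ ^ 2)⁻¹) y) lam
        rw [← this]
        rfl
    _ = _ := by
        rw [← ENNReal.ofReal_mul (by positivity)]
        congr 1
        ring

theorem transv (d m : ℕ) (hd : 1 < d) (lam : ℂ) (hlam : ‖lam‖ ≤ 2) (u : ℕ → ℂ) (h0 : u 0 = lam)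
    (hu : ∀ i, u (i + 1) = u i ^ d + lam) (ρ : ℝ) (hρ : 0 < ρ) (hρ1 : ρ ≤ 1)
    (s : ℕ → ℝ) (hs : ∀ i ∈ Finset.range (m + 1), 0 < s i)
    (hsum : ∑ i ∈ Finset.range (m + 1), s i ≤ ρ / 8) (hs0 : s 0 = ρ ^ d)
    (hmap : ∀ i < m, ∀ z, ‖z - u i‖ ≤ s i → ‖z ^ d + lam - u (i + 1)‖ ≤ s (i + 1))
    (hlast : ∀ z, ‖z - u m‖ ≤ s m → ‖z‖ ≤ ρ)
    (hm : ‖u m‖ ≤ ρ / 2)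
    (hb : ∑ i ∈ (Finset.range m).filter (fun i => ‖u i‖ ≤ ρ), ‖bet d m u i‖ ≤ 1 / 2)
    (hder : ∑ i ∈ Finset.range (m + 1), bet d m u i = 0) :
    π * (ρ / 4) ≤ 4 * π * ‖u m‖ / d * Real.log (4 / ρ ^ d) := by
  have hd0 : (0:ℝ) < d := by
    have : 0 < d := by omega
    exact_mod_cast this
  have hρd : 0 < ρ ^ d := by positivity
  have hρd1 : ρ ^ d ≤ 1 := pow_le_one₀ hρ.le hρ1
  set V : Set ℂ := {w | ‖w‖ < 2 ∧ ∀ i ∈ Finset.range (m + 1), s i < ‖w - u i‖} with hVdef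
  set W : Set ℂ := {z | z ^ d + lam ∈ V} with hWdef
  have hVm : MeasurableSet V := by
    have : V = {w : ℂ | ‖w‖ < 2} ∩ ⋂ i ∈ Finset.range (m + 1), {w : ℂ | s i < ‖w - u i‖} := by
      ext w
      simp [hVdef]
    rw [this]
    apply MeasurableSet.inter
    · exact measurableSet_lt measurable_norm measurable_const
    · apply Finset.measurableSet_biInter
      intro i _
      exact measurableSet_lt measurable_const (by fun_prop)
  have hfm : Measurable (fun z : ℂ => z ^ d + lam) := by fun_prop
  have hWm : MeasurableSet W := hfm hVm
  have hsm : ∀ z : ℂ, ‖z‖ ≤ ρ → ¬ (z ∈ W) := by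
    intro z hz hzW
    have h1 := hzW.2 0 (by simp)
    rw [h0, hs0] at h1
    have e : z ^ d + lam - lam = z ^ d := by ring
    rw [e, norm_pow] at h1
    have : ‖z‖ ^ d ≤ ρ ^ d := by gcongr
    linarith
  have hWV : W ⊆ V := by
    intro z hz
    constructor
    · by_contra hcon
      have hcon : 2 ≤ ‖z‖ := not_lt.1 hcon
      have h1 : ‖z ^ d + lam‖ < 2 := hz.1
      have h2 : ‖z ^ d‖ - ‖lam‖ ≤ ‖z ^ d + lam‖ := by
        have := norm_sub_norm_le (z ^ d) (-lam)
        simpa using this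
      have h3 : (4:ℝ) ≤ ‖z ^ d‖ := by
        rw [norm_pow]
        calc (4:ℝ) = 2 ^ 2 := by norm_num
          _ ≤ 2 ^ d := by gcongr <;> norm_num; omega
          _ ≤ _ := by gcongr
      linarith
    · intro i hi
      by_contra hcon
      have hcon := not_lt.1 hcon
      have him : i < m + 1 := Finset.mem_range.1 hi
      rcases Nat.lt_succ_iff_lt_or_eq.1 him with h | h
      · have h1 := hmap i h z hcon
        have h2 := hz.2 (i + 1) (Finset.mem_range.2 (by omega))
        linarith
      · subst h
        exact hsm z (hlast z hcon) hz
  have hVl : ∀ w ∈ V, ‖w‖ < 2 ∧ ρ ^ d < ‖w - lam‖ := by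
    intro w hw
    refine ⟨hw.1, ?_⟩
    have := hw.2 0 (by simp)
    rwa [h0, hs0] at this
  have hne : ∀ w ∈ V, ∀ i ∈ Finset.range (m + 2), w ≠ u i := by
    intro w hw i hi h
    have hi := Finset.mem_range.1 hi
    rcases Nat.lt_succ_iff_lt_or_eq.1 hi with h' | h'
    · have h1 := hw.2 i (Finset.mem_range.2 h')
      rw [h, sub_self, norm_zero] at h1
      have := hs i (Finset.mem_range.2 h')
      linarith
    · have h1 := (hVl w hw).2
      rw [h, h', hu] at h1
      have e : u m ^ d + lam - lam = u m ^ d := by ring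
      rw [e, norm_pow] at h1
      have : ‖u m‖ ^ d ≤ ρ ^ d := by gcongr; linarith
      linarith
  obtain ⟨ω, hω⟩ : ∃ ω : ℂ, IsPrimitiveRoot ω d := ⟨_, Complex.isPrimitiveRoot_exp d (by omega)⟩
  have htr := transfer_ineq d hd lam ω hω.pow_eq_one (Tf d m u) (qf d m u) (Tf_meas d m u) (qf_meas d m u)
    V hVm (by
      intro z hz
      apply Tf_push d m hd lam u h0 hu ω hω z
      · intro h
        apply hsm z _ hz
        rw [h, norm_zero]
        exact hρ.le
      · intro i hi h
        apply hne _ hz (i + 1) (Finset.mem_range.2 (by have := Finset.mem_range.1 hi; omega))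
        rw [hu, h])
  have herr := err_upper d m hd lam hlam u hu ρ hρ hρ1 hm V hVl
  have hlow := annulus_lower d m u ρ s hρ hs hsum hm hb (V \ W) (hVm.diff hWm) (by
    intro z hz1 hz2
    exact ⟨⟨by linarith, hz2⟩, hsm z hz1.le⟩)
  have h1 : ∫⁻ w in V, ‖qf d m u w‖ₑ ≤ (∫⁻ w in V, ‖Tf d m u w‖ₑ) +
      ∫⁻ w in V, ‖u m / (d * (w - lam) * (w - u (m + 1)))‖ₑ := by
    rw [← lintegral_add_left (Tf_meas d m u).enorm]
    apply setLIntegral_mono' hVm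
    intro w hw
    have := Tf_eq d m hd lam u h0 hu w (hne w hw)
    rw [hder, zero_div, sub_zero] at this
    have e : qf d m u w = Tf d m u w - u m / (d * (w - lam) * (w - u (m + 1))) := by
      rw [this]; ring
    rw [e]
    exact enorm_sub_le
  have hfin : ∫⁻ w in W, ‖qf d m u w‖ₑ ≠ ⊤ := by
    have hb : ∀ w ∈ W, ‖qf d m u w‖ₑ ≤ ENNReal.ofReal (∑ i ∈ Finset.range (m + 1), ‖bet d m u i‖ / s i) := by
      intro w hw
      have hw := hWV hw
      rw [← ofReal_norm]
      apply ENNReal.ofReal_le_ofReal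
      unfold qf
      refine (norm_sum_le _ _).trans ?_
      apply Finset.sum_le_sum
      intro i hi
      have := hw.2 i hi
      have := hs i hi
      rw [norm_mul, norm_div, norm_one, mul_one_div]
      gcongr
    apply ne_top_of_le_ne_top _ (setLIntegral_mono' hWm hb)
    rw [setLIntegral_const]
    apply ENNReal.mul_ne_top (by simp)
    apply ne_top_of_le_ne_top (measure_ball_lt_top (μ := volume) (x := (0:ℂ)) (r := 2)).ne
    apply measure_mono
    intro w hw
    simpa using (hWV hw).1
  have h2 : ∫⁻ w in V, ‖qf d m u w‖ₑ = (∫⁻ w in W, ‖qf d m u w‖ₑ) + ∫⁻ w in V \ W, ‖qf d m u w‖ₑ := by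
    rw [← lintegral_inter_add_sdiff _ V hWm, Set.inter_eq_right.2 hWV]
  rw [h2] at h1
  have h3 : (∫⁻ w in W, ‖qf d m u w‖ₑ) + ∫⁻ w in V \ W, ‖qf d m u w‖ₑ ≤ (∫⁻ w in W, ‖qf d m u w‖ₑ) +
      ∫⁻ w in V, ‖u m / (d * (w - lam) * (w - u (m + 1)))‖ₑ := h1.trans (by gcongr)
  have h4 := (ENNReal.add_le_add_iff_left hfin).1 h3
  have h5 := hlow.trans (h4.trans herr)
  apply (ENNReal.ofReal_le_ofReal_iff _).1 h5
  have : 0 ≤ Real.log (4 / ρ ^ d) := by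
    apply Real.log_nonneg
    rw [le_div_iff₀ hρd]
    linarith
  positivity


lemma pow_lip (d : ℕ) (R : ℝ) (z w : ℂ) (hz : ‖z‖ ≤ R) (hw : ‖w‖ ≤ R) :
    ‖z ^ d - w ^ d‖ ≤ ‖z - w‖ * (d * R ^ (d - 1)) := by
  have hR : 0 ≤ R := (norm_nonneg _).trans hz
  rw [← (Commute.all z w).mul_geom_sum₂, norm_mul]
  gcongr
  refine (norm_sum_le _ _).trans ?_
  have : ∀ i ∈ Finset.range d, ‖z ^ i * w ^ (d - 1 - i)‖ ≤ R ^ (d - 1) := by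
    intro i hi
    have hi := Finset.mem_range.1 hi
    rw [norm_mul, norm_pow, norm_pow]
    calc _ ≤ R ^ i * R ^ (d - 1 - i) := by gcongr
      _ = _ := by rw [← pow_add]; congr 1; omega
  refine (Finset.sum_le_sum this).trans ?_
  simp

lemma escape_mono (d m : ℕ) (hd : 1 < d) (lam : ℂ) (u : ℕ → ℂ)
    (hu : ∀ i, u (i + 1) = u i ^ d + lam) (i : ℕ) (hi : ‖lam‖ ≤ ‖u i‖) (h2 : 2 < ‖u i‖ ^ (d - 1)) (k : ℕ) :
    ‖u i‖ ≤ ‖u (i + k)‖ := by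
  induction k with
  | zero => simp
  | succ k ih =>
    rw [← add_assoc, hu]
    have h1 : ‖u (i + k) ^ d‖ - ‖lam‖ ≤ ‖u (i + k) ^ d + lam‖ := by
      have := norm_sub_norm_le (u (i + k) ^ d) (-lam)
      simpa using this
    have h3 : ‖u i‖ ^ (d - 1) ≤ ‖u (i + k)‖ ^ (d - 1) := by gcongr
    have e : ‖u (i + k) ^ d‖ = ‖u (i + k)‖ ^ (d - 1) * ‖u (i + k)‖ := by
      rw [norm_pow, ← pow_succ]; congr 1; omega
    nlinarith [norm_nonneg (u i), norm_nonneg (u (i+k))]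

lemma orbit_bound (d m : ℕ) (hd : 1 < d) (lam : ℂ) (u : ℕ → ℂ) (h0 : u 0 = lam)
    (hu : ∀ i, u (i + 1) = u i ^ d + lam) (hm : ‖u m‖ ≤ 1) (i : ℕ) (hi : i ≤ m) :
    ‖u i‖ ^ (d - 1) ≤ 2 := by
  have key : ∀ i ≤ m, ‖lam‖ ≤ ‖u i‖ → ‖u i‖ ^ (d - 1) ≤ 2 := by
    intro i hi hl
    by_contra hcon
    have hcon := not_le.1 hcon
    have := escape_mono d m hd lam u hu i hl hcon (m - i)
    rw [show i + (m - i) = m by omega] at this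
    have h3 : ‖u i‖ ^ (d - 1) ≤ 1 := pow_le_one₀ (norm_nonneg _) (this.trans hm)
    linarith
  by_cases h : ‖lam‖ ≤ ‖u i‖
  · exact key i hi h
  · have h1 := key 0 (by omega) (by rw [h0])
    rw [h0] at h1
    have : ‖u i‖ ^ (d - 1) ≤ ‖lam‖ ^ (d - 1) := by gcongr; exact (not_le.1 h).le
    linarith

lemma le_two_of_pow (d : ℕ) (hd : 1 < d) (x : ℝ) (hx : 0 ≤ x) (h : x ^ (d - 1) ≤ 2) : x ≤ 2 := by
  by_contra hcon
  have hcon := not_le.1 hcon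
  have : x ≤ x ^ (d - 1) := le_self_pow₀ (by linarith) (by omega)
  linarith

lemma geom_bound (L : ℝ) (hL : 9 / 2 ≤ L) (n : ℕ) : ∑ i ∈ Finset.range n, L ^ i ≤ L ^ n := by
  induction n with
  | zero => simp
  | succ n ih =>
    rw [Finset.sum_range_succ, pow_succ]
    have : 0 < L ^ n := by positivity
    nlinarith

set_option maxHeartbeats 1000000 in
theorem nonvan0 (d : ℕ) (hd : 1 < d) (q : ℝ) (hq0 : 0 < q) (hq : q ^ (d - 1) = 9 * d / 4) :
    ∃ c : ℝ, 0 < c ∧ c ≤ 1 / 2 ∧ ∀ m : ℕ, ∀ lam : ℂ, ∀ u : ℕ → ℂ, u 0 = lam →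
      (∀ i, u (i + 1) = u i ^ d + lam) → ‖u m‖ < c / ((m + 1) * q ^ (m + 1)) →
      ∑ i ∈ Finset.range (m + 1), bet d m u i ≠ 0 := by
  have hd2 : (2:ℝ) ≤ d := by exact_mod_cast hd
  set L : ℝ := 9 * d / 4 with hLdef
  have hL : 9 / 2 ≤ L := by rw [hLdef]; linarith
  have hdne : d - 1 ≠ 0 := by omega
  obtain ⟨B, hB0, hB⟩ : ∃ B : ℝ, 0 < B ∧ B ^ (d - 1) = 2 :=
    ⟨2 ^ (((d - 1 : ℕ) : ℝ)⁻¹), by positivity, Real.rpow_inv_natCast_pow (by norm_num) hdne⟩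
  obtain ⟨B', hB'0, hB'⟩ : ∃ B : ℝ, 0 < B ∧ B ^ (d - 1) = 9 / 4 :=
    ⟨(9 / 4) ^ (((d - 1 : ℕ) : ℝ)⁻¹), by positivity, Real.rpow_inv_natCast_pow (by norm_num) hdne⟩
  have hBB : B < B' := by
    apply lt_of_pow_lt_pow_left₀ (d - 1) hB'0.le
    rw [hB, hB']; norm_num
  have hq1 : 1 ≤ q := by
    by_contra hcon
    have := pow_le_one₀ (n := d - 1) hq0.le (not_le.1 hcon).le
    linarith
  set κ : ℝ := min (1 / 8) (B' - B) with hκ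
  have hκ0 : 0 < κ := lt_min (by norm_num) (by linarith)
  have hκ8 : κ ≤ 1 / 8 := min_le_left _ _
  have hκδ : κ ≤ B' - B := min_le_right _ _
  set Q : ℝ := Real.log 4 + Real.log (1 / κ) + Real.log q with hQ
  have hQ1 : 0 ≤ Real.log 4 := Real.log_nonneg (by norm_num)
  have hQ2 : 0 ≤ Real.log (1 / κ) := Real.log_nonneg (by rw [le_div_iff₀ hκ0]; linarith)
  have hQ3 : 0 ≤ Real.log q := Real.log_nonneg hq1
  set A : ℝ := 16 * Q + 2 with hA
  have hA2 : 2 ≤ A := by rw [hA]; linarith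
  refine ⟨κ / A, by positivity, ?_, ?_⟩
  · rw [div_le_iff₀ (by positivity)]; linarith
  intro m lam u h0 hu hum hder
  set ρ : ℝ := κ / q ^ (m + 1) with hρd
  have hqn : 1 ≤ q ^ (m + 1) := one_le_pow₀ hq1
  have hρ0 : 0 < ρ := by positivity
  have hρκ : ρ ≤ κ := div_le_self hκ0.le hqn
  have hn0 : (1:ℝ) ≤ m + 1 := by have : (0:ℝ) ≤ m := by positivity
                                 linarith
  have hum' : ‖u m‖ < ρ / (A * (m + 1)) := by
    have : ρ / (A * (m + 1)) = κ / A / ((m + 1) * q ^ (m + 1)) := by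
      rw [hρd]; field_simp
    rw [this]; exact hum
  have hAn : 2 ≤ A * (m + 1) := by nlinarith
  have hm2 : ‖u m‖ ≤ ρ / 2 := hum'.le.trans (by gcongr)
  have horb := orbit_bound d m hd lam u h0 hu (by linarith)
  have hlam : ‖lam‖ ≤ 2 := le_two_of_pow d hd _ (norm_nonneg _) (by have := horb 0 (by omega); rwa [h0] at this)
  have horbB : ∀ i ≤ m, ‖u i‖ ≤ B := by
    intro i hi
    apply le_of_pow_le_pow_left₀ hdne hB0.le
    rw [hB]; exact horb i hi
  have hρp : ρ ^ (d - 1) ≤ κ / L ^ (m + 1) := by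
    rw [hρd, div_pow, ← pow_mul, mul_comm, pow_mul, hq]
    gcongr
    exact pow_le_of_le_one hκ0.le (by linarith) hdne
  have hLn : 0 < L ^ (m + 1) := by positivity
  have hρp' : ρ ^ (d - 1) * L ^ (m + 1) ≤ κ := by rwa [le_div_iff₀ hLn] at hρp
  have hρd' : ρ ^ d = ρ ^ (d - 1) * ρ := by rw [← pow_succ]; congr 1; omega
  set s : ℕ → ℝ := fun i => L ^ i * ρ ^ d with hs
  have hs0 : ∀ i, 0 < s i := fun i => by simp only [hs]; positivity
  have hsum : ∑ i ∈ Finset.range (m + 1), s i ≤ ρ / 8 := by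
    simp only [hs]
    rw [← Finset.sum_mul]
    calc _ ≤ L ^ (m + 1) * ρ ^ d := by gcongr; exact geom_bound L hL _
      _ = (ρ ^ (d - 1) * L ^ (m + 1)) * ρ := by rw [hρd']; ring
      _ ≤ 1 / 8 * ρ := by gcongr; linarith
      _ = _ := by ring
  have hsi : ∀ i ≤ m, s i ≤ ρ / 8 := fun i hi =>
    (Finset.single_le_sum (f := s) (fun j _ => (hs0 j).le) (Finset.mem_range.2 (by omega))).trans hsum
  have hT := transv d m hd lam hlam u h0 hu ρ hρ0 (by linarith) s (fun i _ => hs0 i) hsum (by simp [hs])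
    (by
      intro i hi z hz
      have e : z ^ d + lam - u (i + 1) = z ^ d - u i ^ d := by rw [hu]; ring
      have h1 := horbB i hi.le
      have h2 := hsi i hi.le
      have h3 : ‖z‖ ≤ B' := by
        have := norm_le_insert' z (u i)
        linarith
      rw [e]
      refine (pow_lip d B' z (u i) h3 (by linarith)).trans ?_
      rw [hB']
      calc _ ≤ s i * (d * (9 / 4)) := by gcongr
        _ = s (i + 1) := by simp only [hs]; rw [hLdef]; ring)
    (by
      intro z hz
      have h2 := hsi m le_rfl
      have := norm_le_insert' z (u m)
      linarith)
    hm2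
    (by
      calc _ ≤ ∑ i ∈ (Finset.range m).filter (fun i => ‖u i‖ ≤ ρ), ρ ^ (d - 1) * L ^ (m - i) := by
            apply Finset.sum_le_sum
            intro i hi
            rw [Finset.mem_filter, Finset.mem_range] at hi
            obtain ⟨hi, hi2⟩ := hi
            unfold bet
            rw [Finset.prod_eq_prod_Ico_succ_bot hi, norm_mul, norm_mul, norm_pow, norm_prod]
            have e1 : ‖(d:ℂ)‖ = d := by simp
            have e2 : ∏ k ∈ Finset.Ico (i + 1) m, ‖(d:ℂ) * u k ^ (d - 1)‖ ≤ L ^ (m - (i + 1)) := by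
              rw [← Nat.card_Ico (i + 1) m, ← Finset.prod_const]
              apply Finset.prod_le_prod (fun _ _ => norm_nonneg _)
              intro k hk
              rw [norm_mul, e1, norm_pow]
              have := horb k (Finset.mem_Ico.1 hk).2.le
              nlinarith
            rw [e1]
            calc _ ≤ (d * ρ ^ (d - 1)) * L ^ (m - (i + 1)) := by gcongr
              _ ≤ (L * ρ ^ (d - 1)) * L ^ (m - (i + 1)) := by gcongr; rw [hLdef]; linarith
              _ = ρ ^ (d - 1) * L ^ (m - i) := by
                rw [show m - i = m - (i + 1) + 1 by omega, pow_succ]; ring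
        _ ≤ ∑ i ∈ Finset.range m, ρ ^ (d - 1) * L ^ (m - i) := by
            apply Finset.sum_le_sum_of_subset_of_nonneg (Finset.filter_subset _ _)
            intros; positivity
        _ ≤ ∑ i ∈ Finset.range (m + 1), ρ ^ (d - 1) * L ^ (m - i) := by
            apply Finset.sum_le_sum_of_subset_of_nonneg (Finset.range_mono (by omega))
            intros; positivity
        _ = ρ ^ (d - 1) * ∑ i ∈ Finset.range (m + 1), L ^ i := by
            rw [← Finset.mul_sum]
            congr 1
            have := Finset.sum_range_reflect (fun i => L ^ i) (m + 1)
            rw [← this]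
            rfl
        _ ≤ ρ ^ (d - 1) * L ^ (m + 1) := by gcongr; exact geom_bound L hL _
        _ ≤ 1 / 2 := by linarith)
    hder
  have hlog : Real.log (4 / ρ ^ d) ≤ d * (Q * (m + 1)) := by
    rw [Real.log_div (by norm_num) (by positivity), Real.log_pow, hρd, Real.log_div hκ0.ne' (by positivity), Real.log_pow]
    have : Real.log κ = - Real.log (1 / κ) := by rw [one_div, Real.log_inv]; ring
    rw [this, hQ]
    push_cast
    have a1 : Real.log 4 ≤ d * (Real.log 4 * (m + 1)) := by
      have : 1 * 1 ≤ (d:ℝ) * (m + 1) := by gcongr; linarith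
      nlinarith
    have a2 : d * Real.log (1 / κ) ≤ d * (Real.log (1 / κ) * (m + 1)) := by
      exact mul_le_mul_of_nonneg_left (le_mul_of_one_le_right hQ2 hn0) (by positivity)
    linarith
  have hd0 : (0:ℝ) < d := by linarith
  have : π * (ρ / 4) ≤ π * (4 * ‖u m‖ * (Q * (m + 1))) := by
    refine hT.trans ?_
    calc _ ≤ 4 * π * ‖u m‖ / d * (d * (Q * (m + 1))) := by gcongr
      _ = _ := by field_simp
  have h5 := le_of_mul_le_mul_left this pi_pos
  rw [lt_div_iff₀ (by positivity)] at hum'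
  rw [hA] at hum'
  nlinarith [norm_nonneg (u m), mul_nonneg (norm_nonneg (u m)) (by linarith : (0:ℝ) ≤ m + 1)]


noncomputable def PP (d : ℕ) : ℕ → Polynomial ℂ
  | 0 => 0
  | n + 1 => PP d n ^ d + Polynomial.X

lemma PP_zero (d : ℕ) : PP d 0 = 0 := rfl
lemma PP_succ (d n : ℕ) : PP d (n + 1) = PP d n ^ d + Polynomial.X := rfl

lemma PP_eval (d n : ℕ) (lam : ℂ) : (PP d n).eval lam = (fc d lam)^[n] 0 := by
  induction n with
  | zero => simp [PP_zero]
  | succ n ih =>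
    rw [Function.iterate_succ_apply', PP_succ, ← ih]
    simp [fc]

lemma PP_deg (d : ℕ) (hd : 1 < d) (m : ℕ) : (PP d (m + 1)).Monic ∧ (PP d (m + 1)).natDegree = d ^ m := by
  induction m with
  | zero =>
    have : PP d (0 + 1) = Polynomial.X := by
      rw [PP_succ, PP_zero, zero_pow (by omega), zero_add]
    rw [this]
    exact ⟨Polynomial.monic_X, by simp⟩
  | succ m ih =>
    obtain ⟨h1, h2⟩ := ih
    rw [PP_succ]
    have h3 : (PP d (m + 1) ^ d).natDegree = d ^ (m + 1) := by
      rw [h1.natDegree_pow, h2]; ring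
    have h4 : (1 : ℕ) < d ^ (m + 1) := Nat.one_lt_pow (by omega) hd
    have h5 : (Polynomial.X : Polynomial ℂ).degree < (PP d (m + 1) ^ d).degree := by
      rw [Polynomial.degree_X, Polynomial.degree_eq_natDegree (h1.pow d).ne_zero, h3]
      exact_mod_cast h4
    refine ⟨(h1.pow d).add_of_left h5, ?_⟩
    rw [Polynomial.natDegree_add_eq_left_of_degree_lt h5, h3]

lemma PP_deriv (d : ℕ) (hd : 1 < d) (m : ℕ) (lam : ℂ) :
    (PP d (m + 1)).derivative.eval lam = ∑ i ∈ Finset.range (m + 1), bet d m (fun i => (PP d (i + 1)).eval lam) i := by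
  induction m with
  | zero => simp [PP_succ, PP_zero, bet, zero_pow (show d ≠ 0 by omega)]
  | succ m ih =>
    rw [PP_succ, Finset.sum_range_succ, bet_self]
    simp only [Polynomial.derivative_add, Polynomial.derivative_pow, Polynomial.derivative_X, Polynomial.eval_add, Polynomial.eval_mul, Polynomial.eval_pow, Polynomial.eval_C, Polynomial.eval_one]
    rw [ih, Finset.mul_sum]
    congr 1
    apply Finset.sum_congr rfl
    intro i hi
    have hi := Finset.mem_range.1 hi
    unfold bet
    rw [Finset.prod_Ico_succ_top (by omega)]
    simp
    ring

lemma PP_small (d : ℕ) (hd : 1 < d) (n : ℕ) (hn : 1 ≤ n) (lam : ℂ) (h : ‖(PP d n).eval lam‖ ≤ 1) : ‖lam‖ ≤ 2 := by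
  obtain ⟨m, rfl⟩ : ∃ m, n = m + 1 := ⟨n - 1, by omega⟩
  have := orbit_bound d m hd lam (fun i => (PP d (i + 1)).eval lam) (by simp [PP_succ, PP_zero, zero_pow (show d ≠ 0 by omega)])
    (by intro i; simp [PP_succ d (i + 1)]) h 0 (by omega)
  apply le_two_of_pow d hd _ (norm_nonneg _)
  simpa [PP_succ, PP_zero, zero_pow (show d ≠ 0 by omega)] using this

theorem nonvan (d : ℕ) (hd : 1 < d) (q : ℝ) (hq0 : 0 < q) (hq : q ^ (d - 1) = 9 * d / 4) :
    ∃ c : ℝ, 0 < c ∧ c ≤ 1 / 2 ∧ ∀ n : ℕ, 1 ≤ n → ∀ lam : ℂ, ‖(PP d n).eval lam‖ < c / (n * q ^ n) →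
      (PP d n).derivative.eval lam ≠ 0 := by
  obtain ⟨c, h1, h2, h3⟩ := nonvan0 d hd q hq0 hq
  refine ⟨c, h1, h2, ?_⟩
  intro n hn lam h
  obtain ⟨m, rfl⟩ : ∃ m, n = m + 1 := ⟨n - 1, by omega⟩
  rw [PP_deriv d hd]
  apply h3 m lam _ (by simp [PP_succ, PP_zero, zero_pow (show d ≠ 0 by omega)])
    (by intro i; simp [PP_succ d (i + 1)])
  push_cast at h
  exact h


/-- the real-linear map `v ↦ a v + b v̄` -/
noncomputable def wl (a b : ℂ) : ℂ →L[ℝ] ℂ :=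
  a • ContinuousLinearMap.id ℝ ℂ + b • (Complex.conjCLE : ℂ →L[ℝ] ℂ)

lemma wl_apply (a b v : ℂ) : wl a b v = a * v + b * (starRingEnd ℂ) v := by
  simp [wl]

def WD (W : ℂ → ℂ) (a b z : ℂ) : Prop := HasFDerivAt W (wl a b) z

lemma WD.mul {W V : ℂ → ℂ} {a b a' b' z : ℂ} (h : WD W a b z) (h' : WD V a' b' z) :
    WD (fun z => W z * V z) (a * V z + W z * a') (b * V z + W z * b') z := by
  have := HasFDerivAt.mul h h'
  unfold WD
  refine this.congr_fderiv ?_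
  ext v
  simp [wl_apply]
  ring

lemma WD.holo {F : ℂ → ℂ} {a z : ℂ} (h : HasDerivAt F a z) : WD F a 0 z := by
  have := h.hasFDerivAt.restrictScalars ℝ
  unfold WD
  refine this.congr_fderiv ?_
  ext v
  simp [wl_apply]
  ring

lemma WD.conj {F : ℂ → ℂ} {a z : ℂ} (h : HasDerivAt F a z) :
    WD (fun z => (starRingEnd ℂ) (F z)) 0 ((starRingEnd ℂ) a) z := by
  have h1 : HasFDerivAt F (wl a 0) z := WD.holo h
  have h2 := (Complex.conjCLE : ℂ →L[ℝ] ℂ).hasFDerivAt.comp z h1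
  unfold WD
  refine h2.congr_fderiv ?_
  ext v
  simp [wl_apply]

lemma WD.realcomp {τ : ℂ → ℝ} {a b z : ℂ} (h : WD (fun z => (τ z : ℂ)) a b z) {p : ℝ → ℝ} {p' : ℝ}
    (hp : HasDerivAt p p' (τ z)) : WD (fun z => ((p (τ z) : ℝ) : ℂ)) (p' * a) (p' * b) z := by
  have h1 : HasFDerivAt (fun z => (τ z : ℂ)) (wl a b) z := h
  have h2 : HasFDerivAt τ (Complex.reCLM.comp (wl a b)) z := by
    have := Complex.reCLM.hasFDerivAt.comp z h1
    exact this
  have h3 : HasFDerivAt (fun z => (τ z : ℂ)) (Complex.ofRealCLM.comp (Complex.reCLM.comp (wl a b))) z :=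
    Complex.ofRealCLM.hasFDerivAt.comp z h2
  have e := h1.unique h3
  have h4 := Complex.ofRealCLM.hasFDerivAt.comp z (hp.comp_hasFDerivAt z h2)
  unfold WD
  refine h4.congr_fderiv ?_
  apply ContinuousLinearMap.ext
  intro v
  have ev : wl a b v = (((wl a b v).re : ℝ) : ℂ) := by
    conv_lhs => rw [e]
    simp
  have : wl (p' * a) (p' * b) v = p' * wl a b v := by
    simp only [wl_apply]; ring
  rw [this, ev]
  simp

lemma int_zero (W A B : ℂ → ℂ) (hW : ∀ z, WD W (A z) (B z) z) (hA : Continuous A) (hB : Continuous B)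
    (cW : HasCompactSupport W) (cA : HasCompactSupport A) (cB : HasCompactSupport B) :
    ∫ z, A z = 0 ∧ ∫ z, B z = 0 := by
  have iA : Integrable A := hA.integrable_of_hasCompactSupport cA
  have iB : Integrable B := hB.integrable_of_hasCompactSupport cB
  have hWd : Differentiable ℝ W := fun z => (hW z).differentiableAt
  have iW : Integrable W := hWd.continuous.integrable_of_hasCompactSupport cW
  have hf : ∀ z v, fderiv ℝ W z v = A z * v + B z * (starRingEnd ℂ) v := by
    intro z v
    rw [HasFDerivAt.fderiv (hW z), wl_apply]
  have key : ∀ v : ℂ, (∫ z, A z) * v + (∫ z, B z) * (starRingEnd ℂ) v = 0 := by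
    intro v
    have h := integral_smul_fderiv_eq_neg_fderiv_smul_of_integrable (μ := (volume : Measure ℂ)) (𝕜 := ℝ) (f := fun _ : ℂ => (1:ℝ)) (g := W) (v := v)
      (by simp) (by simp only [hf, one_smul]; exact (iA.mul_const _).add (iB.mul_const _)) (by simpa using iW)
      (by fun_prop) (fun x _ => hWd x)
    simp only [hf, one_smul, fderiv_fun_const, Pi.zero_apply, zero_apply, zero_smul, integral_zero, neg_zero] at h
    rw [integral_add (iA.mul_const _) (iB.mul_const _), integral_mul_const, integral_mul_const] at h
    exact h
  have k1 := key 1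
  have k2 := key Complex.I
  simp only [map_one, mul_one, Complex.conj_I] at k1 k2
  have k3 : (∫ z, A z) - (∫ z, B z) = 0 := by
    have : Complex.I * ((∫ z, A z) - (∫ z, B z)) = 0 := by linear_combination k2
    exact (mul_eq_zero.1 this).resolve_left Complex.I_ne_zero
  constructor
  · linear_combination (k1 + k3) / 2
  · linear_combination (k1 - k3) / 2

lemma pk_deriv (k : ℕ) (x : ℝ) :
    HasDerivAt (fun x : ℝ => max x 0 ^ (k + 2)) ((k + 2) * max x 0 ^ (k + 1)) x := by
  rcases lt_trichotomy x 0 with h | h | h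
  · have h1 : HasDerivAt (fun _ : ℝ => (0:ℝ)) 0 x := hasDerivAt_const _ _
    rw [max_eq_right h.le]
    simp only [ne_eq, Nat.add_eq_zero_iff, one_ne_zero, and_false, not_false_eq_true, zero_pow, mul_zero]
    refine h1.congr_of_eventuallyEq ?_
    filter_upwards [gt_mem_nhds h] with y hy
    rw [max_eq_right hy.le]
    simp
  · subst h
    simp only [max_self, ne_eq, Nat.add_eq_zero_iff, one_ne_zero, and_false, not_false_eq_true, zero_pow, mul_zero]
    rw [hasDerivAt_iff_isLittleO]
    simp only [max_self, sub_zero, smul_zero]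
    have h1 : (fun x : ℝ => x ^ (k + 2)) =o[nhds 0] (fun x => x) := by
      have := Asymptotics.isLittleO_pow_pow (𝕜 := ℝ) (m := 1) (n := k + 2) (by omega)
      simpa using this
    refine Asymptotics.IsBigO.trans_isLittleO ?_ h1
    apply Asymptotics.IsBigO.of_bound 1
    filter_upwards with y
    simp only [ne_eq, Nat.add_eq_zero_iff, false_and, OfNat.ofNat_ne_zero, and_false, not_false_eq_true, zero_pow, sub_zero, norm_pow, one_mul]
    gcongr
    rw [Real.norm_eq_abs, Real.norm_eq_abs]
    rcases le_total y 0 with h | h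
    · simp [max_eq_right h]
    · simp [max_eq_left h]
  · have h1 := hasDerivAt_pow (k + 2) x
    rw [max_eq_left h.le]
    have e : ((k + 2 : ℕ) : ℝ) * x ^ (k + 2 - 1) = (k + 2) * x ^ (k + 1) := by
      push_cast; congr 1
    rw [e] at h1
    refine h1.congr_of_eventuallyEq ?_
    filter_upwards [lt_mem_nhds h] with y hy
    rw [max_eq_left hy.le]


lemma cont_cut (F F1 : ℂ → ℂ) (r : ℝ) (hF : Continuous F) (hne : ∀ z, ‖F z‖ ≤ r → F1 z ≠ 0) (f : ℂ → ℂ)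
    (h1 : ∀ z, F1 z ≠ 0 → ContinuousAt f z) (h2 : ∀ z, r < ‖F z‖ → f z = 0) : Continuous f := by
  rw [continuous_iff_continuousAt]
  intro z
  by_cases h : F1 z = 0
  · have : r < ‖F z‖ := by
      by_contra hcon
      exact hne z (not_lt.1 hcon) h
    have hev : f =ᶠ[nhds z] fun _ => 0 := by
      filter_upwards [(isOpen_lt continuous_const hF.norm).mem_nhds this] with y hy
      exact h2 y hy
    exact (continuousAt_congr hev).2 continuousAt_const
  · exact h1 z h

lemma wd_cut (F F1 : ℂ → ℂ) (r : ℝ) (hF : Continuous F) (hne : ∀ z, ‖F z‖ ≤ r → F1 z ≠ 0) (W a b : ℂ → ℂ)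
    (h1 : ∀ z, F1 z ≠ 0 → WD W (a z) (b z) z) (h2 : ∀ z, r < ‖F z‖ → W z = 0 ∧ a z = 0 ∧ b z = 0) (z : ℂ) :
    WD W (a z) (b z) z := by
  by_cases h : F1 z = 0
  · have : r < ‖F z‖ := by
      by_contra hcon
      exact hne z (not_lt.1 hcon) h
    have hev : W =ᶠ[nhds z] fun _ => 0 := by
      filter_upwards [(isOpen_lt continuous_const hF.norm).mem_nhds this] with y hy
      exact (h2 y hy).1
    rw [(h2 z this).2.1, (h2 z this).2.2]
    have : WD (fun _ => 0) 0 0 z := WD.holo (hasDerivAt_const z (0:ℂ))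
    exact HasFDerivAt.congr_of_eventuallyEq this hev
  · exact h1 z h

noncomputable def tauf (F : ℂ → ℂ) (r : ℝ) (z : ℂ) : ℝ := 1 - ‖F z‖ ^ 2 / r ^ 2

set_option maxHeartbeats 1000000 in
lemma area_step (F F1 F2 F3 : ℂ → ℂ) (r R : ℝ) (hr : 0 < r) (hF : ∀ z, HasDerivAt F (F1 z) z)
    (hF1 : ∀ z, HasDerivAt F1 (F2 z) z) (hF2 : ∀ z, HasDerivAt F2 (F3 z) z) (hF3 : Continuous F3)
    (hne : ∀ z, ‖F z‖ ≤ r → F1 z ≠ 0) (hR : ∀ z, ‖F z‖ ≤ r → ‖z‖ ≤ R) (k : ℕ) :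
    (k + 3) * ∫ z, max (tauf F r z) 0 ^ (k + 2) ≤ (k + 2) * ∫ z, max (tauf F r z) 0 ^ (k + 1) := by
  have cF : Continuous F := by
    rw [continuous_iff_continuousAt]; exact fun z => (hF z).continuousAt
  have cF1 : Continuous F1 := by
    rw [continuous_iff_continuousAt]; exact fun z => (hF1 z).continuousAt
  have cF2 : Continuous F2 := by
    rw [continuous_iff_continuousAt]; exact fun z => (hF2 z).continuousAt
  have cτ : Continuous (tauf F r) := by unfold tauf; fun_prop
  have hτ0 : ∀ z, r < ‖F z‖ → max (tauf F r z) 0 = 0 := by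
    intro z hz
    apply max_eq_right
    unfold tauf
    rw [sub_nonpos, one_le_div (by positivity)]
    gcongr
  have hR' : ∀ z, z ∉ Metric.closedBall (0:ℂ) R → r < ‖F z‖ := by
    intro z hz
    by_contra hcon
    apply hz
    simpa using hR z (not_lt.1 hcon)
  -- the derivative of tau
  have hτ : ∀ z, WD (fun z => (tauf F r z : ℂ)) (-(F1 z * (starRingEnd ℂ) (F z)) / r ^ 2) (-(F z * (starRingEnd ℂ) (F1 z)) / r ^ 2) z := by
    intro z
    have h1 := (WD.holo (hF z)).mul (WD.conj (hF z))
    have h2 := (WD.holo (hasDerivAt_const z (-1 / (r:ℂ) ^ 2))).mul h1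
    have h3 : HasFDerivAt (fun z => (1:ℂ) + _) _ z := HasFDerivAt.const_add (1:ℂ) h2
    unfold WD
    have e : (fun z => (tauf F r z : ℂ)) = (fun z => (1:ℂ) + -1 / (r:ℂ) ^ 2 * (F z * (starRingEnd ℂ) (F z))) := by
      ext z
      rw [Complex.mul_conj, Complex.normSq_eq_norm_sq]
      unfold tauf
      push_cast
      ring
    rw [e]
    refine h3.congr_fderiv ?_
    ext v
    simp only [wl_apply]
    ring
  have hp : ∀ (j : ℕ) z, WD (fun z => ((max (tauf F r z) 0 ^ (j + 2) : ℝ) : ℂ))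
      ((((j + 2) * max (tauf F r z) 0 ^ (j + 1) : ℝ) : ℂ) * (-(F1 z * (starRingEnd ℂ) (F z)) / r ^ 2))
      ((((j + 2) * max (tauf F r z) 0 ^ (j + 1) : ℝ) : ℂ) * (-(F z * (starRingEnd ℂ) (F1 z)) / r ^ 2)) z := by
    intro j z
    exact (hτ z).realcomp (pk_deriv j _)
  have hg : ∀ z, F1 z ≠ 0 → HasDerivAt (fun z => (F1 z)⁻¹) (-F2 z / F1 z ^ 2) z := fun z hz => (hF1 z).inv hz
  set g : ℂ → ℂ := fun z => (F1 z)⁻¹ with hgdef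
  set G : ℂ → ℂ := fun z => -F2 z / F1 z ^ 2 with hGdef
  set G' : ℂ → ℂ := fun z => (-F3 z * F1 z ^ 2 - -F2 z * (2 * F1 z * F2 z)) / (F1 z ^ 2) ^ 2 with hG'def
  have hG : ∀ z, F1 z ≠ 0 → HasDerivAt G (G' z) z := by
    intro z hz
    have := (hF2 z).neg.div ((hF1 z).pow 2) (pow_ne_zero 2 hz)
    refine this.congr_deriv ?_
    simp only [hG'def]
    norm_num
  set p : ℕ → ℂ → ℂ := fun j z => ((max (tauf F r z) 0 ^ j : ℝ) : ℂ) with hpdef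
  have cp : ∀ j, Continuous (p j) := by
    intro j; simp only [hpdef]; fun_prop
  have hp0 : ∀ j z, r < ‖F z‖ → p (j + 1) z = 0 := by
    intro j z hz
    simp only [hpdef]
    rw [hτ0 z hz]
    simp
  set T : ℂ → ℂ := fun z => (-(F1 z * (starRingEnd ℂ) (F z)) / r ^ 2) with hT
  set T' : ℂ → ℂ := fun z => (-(F z * (starRingEnd ℂ) (F1 z)) / r ^ 2) with hT'
  have cT : Continuous T := by
    have := Complex.continuous_conj
    have := hr.ne'
    simp only [hT]; fun_prop
  have cT' : Continuous T' := by
    have := Complex.continuous_conj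
    simp only [hT']; fun_prop
  have hp' : ∀ (j : ℕ) z, WD (p (j + 2)) ((j + 2) * p (j + 1) z * T z) ((j + 2) * p (j + 1) z * T' z) z := by
    intro j z
    have := hp j z
    push_cast at this
    simp only [hpdef]
    push_cast
    exact this
  have gc : ∀ z, F1 z ≠ 0 → ContinuousAt g z := fun z hz => (hg z hz).continuousAt
  have Gc : ∀ z, F1 z ≠ 0 → ContinuousAt G z := fun z hz => (hG z hz).continuousAt
  have G'c : ∀ z, F1 z ≠ 0 → ContinuousAt G' z := by
    intro z hz
    simp only [hG'def]
    apply ContinuousAt.div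
    · fun_prop
    · fun_prop
    · positivity
  have sc : ∀ z, ContinuousAt (starRingEnd ℂ) z := fun z => Complex.continuous_conj.continuousAt
  have hg : ∀ z, F1 z ≠ 0 → HasDerivAt g (G z) z := hg
  clear_value G' G T T' p g
  have cs : ∀ f : ℂ → ℂ, (∀ z, r < ‖F z‖ → f z = 0) → HasCompactSupport f := by
    intro f hf
    exact HasCompactSupport.intro (isCompact_closedBall (0:ℂ) R) (fun z hz => hf z (hR' z hz))
  set A1 : ℂ → ℂ := fun z => (F1 z * g z + F z * G z) * p (k + 2) z + (F z * g z) * ((k + 2) * p (k + 1) z * T z) with hA1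
  set B1 : ℂ → ℂ := fun z => 0 * p (k + 2) z + (F z * g z) * ((k + 2) * p (k + 1) z * T' z) with hB1
  have w1 := int_zero (fun z => (F z * g z) * p (k + 2) z) A1 B1
    (wd_cut F F1 r cF hne _ A1 B1 (by
      intro z hz
      exact (WD.holo ((hF z).mul (hg z hz))).mul (hp' k z)) (by
      intro z hz
      simp [hA1, hB1, hp0 _ z hz, hp0 (k+1) z hz]))
    (by
      apply cont_cut F F1 r cF hne
      · intro z hz
        have := gc z hz
        have := Gc z hz
        simp only [hA1]
        fun_prop
      · intro z hz
        simp [hA1, hp0 _ z hz, hp0 (k+1) z hz])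
    (by
      apply cont_cut F F1 r cF hne
      · intro z hz
        have := gc z hz
        have := Gc z hz
        simp only [hB1]
        fun_prop
      · intro z hz
        simp [hB1, hp0 _ z hz, hp0 (k+1) z hz])
    (cs _ (by intro z hz; simp [hp0 (k+1) z hz]))
    (cs _ (by intro z hz; simp [hA1, hp0 _ z hz, hp0 (k+1) z hz]))
    (cs _ (by intro z hz; simp [hB1, hp0 _ z hz, hp0 (k+1) z hz]))
  set A2 : ℂ → ℂ := fun z => (G' z * (starRingEnd ℂ) (g z) + G z * 0) * p (k + 1 + 2) z + (G z * (starRingEnd ℂ) (g z)) * (((k + 1 : ℕ) + 2) * p (k + 1 + 1) z * T z) with hA2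
  set B2 : ℂ → ℂ := fun z => (0 * (starRingEnd ℂ) (g z) + G z * (starRingEnd ℂ) (G z)) * p (k + 1 + 2) z + (G z * (starRingEnd ℂ) (g z)) * (((k + 1 : ℕ) + 2) * p (k + 1 + 1) z * T' z) with hB2
  have sB2 : ∀ z, r < ‖F z‖ → B2 z = 0 := by intro z hz; simp [hB2, hp0 (k+1) z hz, hp0 (k+1+1) z hz]
  have sA2 : ∀ z, r < ‖F z‖ → A2 z = 0 := by intro z hz; simp [hA2, hp0 (k+1) z hz, hp0 (k+1+1) z hz]
  have cB2 : Continuous B2 := by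
    apply cont_cut F F1 r cF hne _ _ sB2
    intro z hz
    have := gc z hz
    have := Gc z hz
    have a1 : ContinuousAt (fun z => (starRingEnd ℂ) (g z)) z := ContinuousAt.comp (sc _) (gc z hz)
    have a2 : ContinuousAt (fun z => (starRingEnd ℂ) (G z)) z := ContinuousAt.comp (sc _) (Gc z hz)
    simp only [hB2]
    fun_prop
  have cA2 : Continuous A2 := by
    apply cont_cut F F1 r cF hne _ _ sA2
    intro z hz
    have := gc z hz
    have := Gc z hz
    have := G'c z hz
    have a1 : ContinuousAt (fun z => (starRingEnd ℂ) (g z)) z := ContinuousAt.comp (sc _) (gc z hz)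
    simp only [hA2]
    fun_prop
  have w2 := int_zero (fun z => (G z * (starRingEnd ℂ) (g z)) * p (k + 1 + 2) z) A2 B2
    (wd_cut F F1 r cF hne _ A2 B2 (by
      intro z hz
      exact ((WD.holo (hG z hz)).mul (WD.conj (hg z hz))).mul (hp' (k + 1) z)) (by
      intro z hz
      exact ⟨by simp [hp0 (k+1+1) z hz], sA2 z hz, sB2 z hz⟩))
    cA2 cB2
    (cs _ (by intro z hz; simp [hp0 (k+1+1) z hz]))
    (cs _ sA2) (cs _ sB2)
  have sA1 : ∀ z, r < ‖F z‖ → A1 z = 0 := by intro z hz; simp [hA1, hp0 _ z hz]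
  have cA1 : Continuous A1 := by
    apply cont_cut F F1 r cF hne _ _ sA1
    intro z hz
    have := gc z hz
    have := Gc z hz
    simp only [hA1]
    fun_prop
  set P : ℂ → ℝ := fun z => max (tauf F r z) 0 with hP
  have cP : Continuous P := by simp only [hP]; fun_prop
  have hrC : (r:ℂ) ≠ 0 := by exact_mod_cast hr.ne'
  have hkC : ((k:ℂ) + 3) ≠ 0 := by exact_mod_cast (by positivity : ((k:ℝ) + 3) ≠ 0)
  have key : ∀ z, A1 z + r ^ 2 / (k + 3) * B2 z =
      (((k + 3) * P z ^ (k + 2) - (k + 2) * P z ^ (k + 1) + r ^ 2 / (k + 3) * ‖G z‖ ^ 2 * P z ^ (k + 3) : ℝ) : ℂ) := by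
    intro z
    by_cases h : r < ‖F z‖
    · have : P z = 0 := hτ0 z h
      rw [sA1 z h, sB2 z h, this]
      simp
    · have h' := not_lt.1 h
      have hz := hne z h'
      have hPz : P z = 1 - ‖F z‖ ^ 2 / r ^ 2 := by
        have : 0 ≤ tauf F r z := by
          unfold tauf
          rw [sub_nonneg, div_le_one (by positivity)]
          gcongr
        simp only [hP]
        rw [max_eq_left this, tauf]
      have hFF : F z * (starRingEnd ℂ) (F z) = r ^ 2 * (1 - P z) := by
        rw [Complex.mul_conj, Complex.normSq_eq_norm_sq, hPz]
        push_cast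
        field_simp
        ring
      have hgF : F1 z * g z = 1 := by rw [hgdef]; exact mul_inv_cancel₀ hz
      have hgc : (starRingEnd ℂ) (g z) * (starRingEnd ℂ) (F1 z) = 1 := by
        rw [← map_mul, mul_comm, hgF, map_one]
      have hpx : ∀ j, p j z = (P z : ℂ) ^ j := by
        intro j; simp only [hpdef, hP]; push_cast; rfl
      have hGG : G z * (starRingEnd ℂ) (G z) = ‖G z‖ ^ 2 := by
        rw [Complex.mul_conj, Complex.normSq_eq_norm_sq]; push_cast; rfl
      simp only [hA1, hB2, hT, hT', hpx]
      rw [hGG]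
      push_cast
      generalize (P z : ℂ) = x at *
      have h1 : F z * g z * ((k + 2) * x ^ (k + 1) * (-(F1 z * (starRingEnd ℂ) (F z)) / r ^ 2)) = -((k + 2) * x ^ (k + 1)) * (1 - x) := by
        calc _ = -((k + 2) * x ^ (k + 1)) * (F1 z * g z) * (F z * (starRingEnd ℂ) (F z) / r ^ 2) := by ring
          _ = _ := by rw [hgF, hFF]; field_simp
      have h2 : (r:ℂ) ^ 2 / (k + 3) * ((0 * (starRingEnd ℂ) (g z) + (‖G z‖:ℂ) ^ 2) * x ^ (k + 1 + 2) + G z * (starRingEnd ℂ) (g z) * ((k + 1 + 2) * x ^ (k + 1 + 1) * (-(F z * (starRingEnd ℂ) (F1 z)) / r ^ 2)))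
        = (r:ℂ) ^ 2 / (k + 3) * (‖G z‖:ℂ) ^ 2 * x ^ (k + 3) - G z * F z * x ^ (k + 2) * ((starRingEnd ℂ) (g z) * (starRingEnd ℂ) (F1 z)) := by
        have e3 : ((k:ℂ) + 1 + 2) = k + 3 := by ring
        rw [e3]
        field_simp
        ring
      rw [h1, h2, hgF, hgc]
      ring
  have iA1 : Integrable A1 := cA1.integrable_of_hasCompactSupport (cs _ sA1)
  have iB2 : Integrable B2 := cB2.integrable_of_hasCompactSupport (cs _ sB2)
  have hIz : ∫ z, (A1 z + r ^ 2 / (k + 3) * B2 z) = 0 := by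
    rw [integral_add iA1 (iB2.const_mul _), integral_const_mul, w1.1, w2.2]
    simp
  have iS : Integrable (fun z => A1 z + r ^ 2 / (k + 3) * B2 z) := iA1.add (iB2.const_mul _)
  simp_rw [key] at hIz iS
  rw [integral_complex_ofReal] at hIz
  have hIz' : _ = (0:ℝ) := Complex.ofReal_eq_zero.1 hIz
  have iP : ∀ j, Integrable (fun z => P z ^ (j + 1)) := by
    intro j
    apply Continuous.integrable_of_hasCompactSupport (by fun_prop)
    apply HasCompactSupport.intro (isCompact_closedBall (0:ℂ) R)
    intro z hz
    have : P z = 0 := hτ0 z (hR' z hz)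
    rw [this]; simp
  have hle : ∫ z, ((k + 3) * P z ^ (k + 2) - (k + 2) * P z ^ (k + 1)) ≤ 0 := by
    rw [← hIz']
    apply integral_mono
    · exact ((iP (k + 1)).const_mul _).sub ((iP k).const_mul _)
    · have := iS.re
      exact this
    · intro z
      simp only
      have : 0 ≤ P z := le_max_right _ _
      have : 0 ≤ r ^ 2 / (k + 3) * ‖G z‖ ^ 2 * P z ^ (k + 3) := by positivity
      linarith
  rw [integral_sub ((iP (k + 1)).const_mul _) ((iP k).const_mul _), integral_const_mul, integral_const_mul] at hle
  linarith


theorem area_log : ∃ C0 : ℝ, 0 ≤ C0 ∧ ∀ (F F1 F2 F3 : ℂ → ℂ) (r : ℝ), 0 < r → (∀ z, HasDerivAt F (F1 z) z) →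
    (∀ z, HasDerivAt F1 (F2 z) z) → (∀ z, HasDerivAt F2 (F3 z) z) → Continuous F3 →
    (∀ z, ‖F z‖ ≤ r → F1 z ≠ 0) → (∀ z, ‖F z‖ ≤ r → ‖z‖ ≤ 2) →
    ∫⁻ z in {z | ‖F z‖ < r}, ENNReal.ofReal (Real.log (r / ‖F z‖)) ≤ ENNReal.ofReal C0 := by
  have hsumm : Summable (fun n : ℕ => 1 / ((n : ℝ) + 1) ^ 2) := by
    have := (summable_nat_add_iff 1).2 (Real.summable_one_div_nat_pow.2 (by norm_num : 1 < 2))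
    simpa using this
  set S : ℝ := ∑' n : ℕ, 1 / ((n : ℝ) + 1) ^ 2 with hS
  have hS0 : 0 ≤ S := tsum_nonneg (fun n => by positivity)
  refine ⟨2 * (volume (Metric.closedBall (0:ℂ) 2)).toReal * S, by positivity, ?_⟩
  intro F F1 F2 F3 r hr hF hF1 hF2 hF3 hne hR
  have cF : Continuous F := by
    rw [continuous_iff_continuousAt]; exact fun z => (hF z).continuousAt
  have cτ : Continuous (tauf F r) := by unfold tauf; fun_prop
  have hstep := area_step F F1 F2 F3 r 2 hr hF hF1 hF2 hF3 hne hR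
  set P : ℂ → ℝ := fun z => max (tauf F r z) 0 with hP
  have cP : Continuous P := by simp only [hP]; fun_prop
  have hP0 : ∀ z, 0 ≤ P z := fun z => le_max_right _ _
  have hP1 : ∀ z, P z ≤ 1 := by
    intro z
    apply max_le _ zero_le_one
    unfold tauf
    have : 0 ≤ ‖F z‖ ^ 2 / r ^ 2 := by positivity
    linarith
  have hPz : ∀ z, z ∉ Metric.closedBall (0:ℂ) 2 → P z = 0 := by
    intro z hz
    have h1 : r < ‖F z‖ := by
      by_contra hcon
      apply hz
      simpa using hR z (not_lt.1 hcon)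
    apply max_eq_right
    unfold tauf
    rw [sub_nonpos, one_le_div (by positivity)]
    gcongr
  have iP : ∀ j, Integrable (fun z => P z ^ (j + 1)) := by
    intro j
    apply Continuous.integrable_of_hasCompactSupport (by fun_prop)
    apply HasCompactSupport.intro (isCompact_closedBall (0:ℂ) 2)
    intro z hz
    rw [hPz z hz]; simp
  have hbfin : volume (Metric.closedBall (0:ℂ) 2) ≠ ⊤ := measure_closedBall_lt_top.ne
  set a : ℕ → ℝ := fun j => ∫ z, P z ^ (j + 1) with ha
  have ha0 : a 0 ≤ (volume (Metric.closedBall (0:ℂ) 2)).toReal := by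
    have e : (volume (Metric.closedBall (0:ℂ) 2)).toReal = ∫ z, (Metric.closedBall (0:ℂ) 2).indicator (fun _ => (1:ℝ)) z := by
      rw [integral_indicator measurableSet_closedBall]; simp [Measure.real]
    rw [e]
    apply integral_mono (iP 0)
    · rw [integrable_indicator_iff measurableSet_closedBall]
      exact integrableOn_const hbfin
    · intro z
      by_cases hz : z ∈ Metric.closedBall (0:ℂ) 2
      · rw [Set.indicator_of_mem hz]; simpa using hP1 z
      · rw [Set.indicator_of_notMem hz]; simp [hPz z hz]
  have hapos : 0 ≤ a 0 := integral_nonneg (fun z => by simpa using hP0 z)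
  have hak : ∀ k, a k ≤ 2 * a 0 / (k + 2) := by
    intro k
    induction k with
    | zero => simp
    | succ k ih =>
      have h1 : (k + 3) * a (k + 1) ≤ (k + 2) * a k := hstep k
      rw [le_div_iff₀ (by positivity)] at ih ⊢
      push_cast
      linarith
  have hmS : MeasurableSet {z | ‖F z‖ < r} := measurableSet_lt (by fun_prop) measurable_const
  calc ∫⁻ z in {z | ‖F z‖ < r}, ENNReal.ofReal (Real.log (r / ‖F z‖))
      ≤ ∫⁻ z in {z | ‖F z‖ < r}, ∑' n : ℕ, ENNReal.ofReal (P z ^ (n + 1) / (n + 1)) := by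
        apply setLIntegral_mono' hmS
        intro z hz
        have hz : ‖F z‖ < r := hz
        by_cases h0 : F z = 0
        · simp [h0]
        have hFp : 0 < ‖F z‖ := by positivity
        have ht : P z = tauf F r z := by
          apply max_eq_left
          unfold tauf
          rw [sub_nonneg, div_le_one (by positivity)]
          gcongr
        have hlt : |P z| < 1 := by
          rw [abs_of_nonneg (hP0 z), ht, tauf]
          have : 0 < ‖F z‖ ^ 2 / r ^ 2 := by positivity
          linarith
        have hs := Real.hasSum_pow_div_log_of_abs_lt_one hlt
        rw [← ENNReal.ofReal_tsum_of_nonneg _ hs.summable, hs.tsum_eq]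
        · apply ENNReal.ofReal_le_ofReal
          rw [ht, tauf, sub_sub_cancel, ← div_pow, Real.log_pow]
          have e1 : Real.log (‖F z‖ / r) = - Real.log (r / ‖F z‖) := by
            rw [← Real.log_inv, inv_div]
          have e2 : 0 ≤ Real.log (r / ‖F z‖) := by
            apply Real.log_nonneg
            rw [le_div_iff₀ hFp]
            linarith
          rw [e1]
          push_cast
          linarith
        · intro n
          have := hP0 z
          positivity
    _ ≤ ∫⁻ z, ∑' n : ℕ, ENNReal.ofReal (P z ^ (n + 1) / (n + 1)) := setLIntegral_le_lintegral _ _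
    _ = ∑' n : ℕ, ∫⁻ z, ENNReal.ofReal (P z ^ (n + 1) / (n + 1)) := by
        apply lintegral_tsum
        intro n
        apply Continuous.aemeasurable
        apply ENNReal.continuous_ofReal.comp
        fun_prop
    _ = ∑' n : ℕ, ENNReal.ofReal (a n / (n + 1)) := by
        congr 1
        ext n
        rw [← ofReal_integral_eq_lintegral_ofReal ((iP n).div_const _), integral_div]
        filter_upwards with z
        have := hP0 z
        simp only [Pi.zero_apply]
        positivity
    _ ≤ ∑' n : ℕ, ENNReal.ofReal (2 * (volume (Metric.closedBall (0:ℂ) 2)).toReal * (1 / ((n:ℝ) + 1) ^ 2)) := by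
        apply ENNReal.tsum_le_tsum
        intro n
        apply ENNReal.ofReal_le_ofReal
        calc a n / (n + 1) ≤ (2 * a 0 / (n + 2)) / (n + 1) := by gcongr; exact hak n
          _ ≤ (2 * a 0 / (n + 1)) / (n + 1) := by gcongr; norm_num
          _ = 2 * a 0 * (1 / ((n:ℝ) + 1) ^ 2) := by field_simp
          _ ≤ _ := by gcongr
    _ = ENNReal.ofReal (2 * (volume (Metric.closedBall (0:ℂ) 2)).toReal * S) := by
        rw [← ENNReal.ofReal_tsum_of_nonneg _ (hsumm.mul_left _), tsum_mul_left]
        intro n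
        positivity


lemma green_dir (v : ℂ) (f f1 f2 φ φ1 φ2 : ℂ → ℝ) (hf : ∀ z, HasLineDerivAt ℝ f (f1 z) z v)
    (hf1 : ∀ z, HasLineDerivAt ℝ f1 (f2 z) z v) (hφ : ∀ z, HasLineDerivAt ℝ φ (φ1 z) z v)
    (hφ1 : ∀ z, HasLineDerivAt ℝ φ1 (φ2 z) z v) (cf : Continuous f) (cf1 : Continuous f1) (cf2 : Continuous f2)
    (cφ : Continuous φ) (cφ1 : Continuous φ1) (cφ2 : Continuous φ2)
    (sf : HasCompactSupport f) (sf1 : HasCompactSupport f1) (sf2 : HasCompactSupport f2) :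
    ∫ z, f z * φ2 z = ∫ z, f2 z * φ z := by
  have I : ∀ g h : ℂ → ℝ, Continuous g → Continuous h → HasCompactSupport g → Integrable (fun z => g z * h z) := by
    intro g h hg hh sg
    exact (hg.mul hh).integrable_of_hasCompactSupport sg.mul_right
  have h1 := integral_bilinear_hasLineDerivAt_right_eq_neg_left_of_integrable (μ := (volume : Measure ℂ))
    (B := ContinuousLinearMap.mul ℝ ℝ) (f := f) (f' := f1) (g := φ1) (g' := φ2) (v := v)
    (I _ _ cf1 cφ1 sf1) (I _ _ cf cφ2 sf) (I _ _ cf cφ1 sf) (fun x _ => hf x) (fun x _ => hφ1 x)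
  have h2 := integral_bilinear_hasLineDerivAt_right_eq_neg_left_of_integrable (μ := (volume : Measure ℂ))
    (B := ContinuousLinearMap.mul ℝ ℝ) (f := f1) (f' := f2) (g := φ) (g' := φ1) (v := v)
    (I _ _ cf2 cφ sf2) (I _ _ cf1 cφ1 sf1) (I _ _ cf1 cφ sf1) (fun x _ => hf1 x) (fun x _ => hφ x)
  simp only [ContinuousLinearMap.mul_apply'] at h1 h2
  rw [h1, h2, neg_neg]

lemma lap_dir (φ : ℂ → ℝ) (hφ : ContDiff ℝ 2 φ) (v : ℂ) :
    (∀ z, HasLineDerivAt ℝ φ (fderiv ℝ φ z v) z v) ∧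
    (∀ z, HasLineDerivAt ℝ (fun z => fderiv ℝ φ z v) (iteratedFDeriv ℝ 2 φ z ![v, v]) z v) ∧
    Continuous (fun z => fderiv ℝ φ z v) ∧ Continuous (fun z => iteratedFDeriv ℝ 2 φ z ![v, v]) := by
  have hd : ContDiff ℝ 1 (fderiv ℝ φ) := hφ.fderiv_right (by norm_num)
  refine ⟨?_, ?_, ?_, ?_⟩
  · intro z
    exact ((hφ.differentiable (by norm_num)) z).hasFDerivAt.hasLineDerivAt v
  · intro z
    have h1 : HasFDerivAt (fun z => fderiv ℝ φ z v) ((ContinuousLinearMap.apply ℝ ℝ v).comp (fderiv ℝ (fderiv ℝ φ) z)) z :=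
      (ContinuousLinearMap.apply ℝ ℝ v).hasFDerivAt.comp z ((hd.differentiable (by norm_num)) z).hasFDerivAt
    have h2 := h1.hasLineDerivAt v
    rw [iteratedFDeriv_two_apply]
    exact h2
  · have := hd.continuous
    fun_prop
  · have := hφ.continuous_iteratedFDeriv (m := 2) (by norm_num)
    fun_prop

lemma lap_cont (φ : ℂ → ℝ) (hφ : ContDiff ℝ 2 φ) : Continuous (lap φ) := by
  unfold lap
  exact (lap_dir φ hφ 1).2.2.2.add (lap_dir φ hφ Complex.I).2.2.2

lemma green_radial (φ : ℂ → ℝ) (hφ : ContDiff ℝ 2 φ) (a : ℂ) (T : ℝ) (m m1 m2 : ℝ → ℝ)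
    (hm : ∀ t, 0 ≤ t → HasDerivAt m (m1 t) t) (hm1 : ∀ t, 0 ≤ t → HasDerivAt m1 (m2 t) t)
    (cm2 : ContinuousOn m2 (Set.Ici 0)) (h0 : ∀ t, T ≤ t → m t = 0 ∧ m1 t = 0 ∧ m2 t = 0) :
    ∫ z, m (‖z - a‖ ^ 2) * lap φ z = ∫ z, 4 * (m1 (‖z - a‖ ^ 2) + ‖z - a‖ ^ 2 * m2 (‖z - a‖ ^ 2)) * φ z := by
  have hsq : ∀ v z : ℂ, HasLineDerivAt ℝ (fun z : ℂ => ‖z - a‖ ^ 2) (2 * inner ℝ (z - a) v) z v := by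
    intro v z
    have h1 : HasFDerivAt (fun z : ℂ => z - a) (ContinuousLinearMap.id ℝ ℂ) z := (hasFDerivAt_id z).sub_const a
    have h2 := h1.norm_sq.hasLineDerivAt v
    refine h2.congr_deriv ?_
    simp
    ring
  have cn : Continuous (fun z : ℂ => ‖z - a‖ ^ 2) := by fun_prop
  have hin : ∀ v z : ℂ, HasLineDerivAt ℝ (fun z : ℂ => 2 * inner ℝ (z - a) v) (2 * ‖v‖ ^ 2) z v := by
    intro v z
    have h1 : HasFDerivAt (fun z : ℂ => z - a) (ContinuousLinearMap.id ℝ ℂ) z := (hasFDerivAt_id z).sub_const a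
    have h2 := ((h1.inner ℝ (hasFDerivAt_const v z)).const_mul 2).hasLineDerivAt v
    refine h2.congr_deriv ?_
    simp
  have compl : ∀ (p : ℝ → ℝ) (p1 : ℝ → ℝ), (∀ t, 0 ≤ t → HasDerivAt p (p1 t) t) → ∀ v z : ℂ,
      HasLineDerivAt ℝ (fun z : ℂ => p (‖z - a‖ ^ 2)) (p1 (‖z - a‖ ^ 2) * (2 * inner ℝ (z - a) v)) z v := by
    intro p p1 hp v z
    have h1 := hsq v z
    unfold HasLineDerivAt at h1 ⊢
    have h3 : HasDerivAt p (p1 (‖z - a‖ ^ 2)) (‖z + (0:ℝ) • v - a‖ ^ 2) := by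
      simpa using hp (‖z - a‖ ^ 2) (by positivity)
    exact HasDerivAt.comp 0 h3 h1
  have ccont : ∀ p : ℝ → ℝ, ContinuousOn p (Set.Ici 0) → Continuous (fun z : ℂ => p (‖z - a‖ ^ 2)) := by
    intro p hp
    exact hp.comp_continuous cn (fun z => by simp)
  have cm : ContinuousOn m (Set.Ici 0) := fun t ht => (hm t ht).continuousAt.continuousWithinAt
  have cm1 : ContinuousOn m1 (Set.Ici 0) := fun t ht => (hm1 t ht).continuousAt.continuousWithinAt
  have Cm := ccont m cm
  have Cm1 := ccont m1 cm1
  have Cm2 := ccont m2 cm2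
  have Cin : ∀ v : ℂ, Continuous (fun z : ℂ => 2 * inner ℝ (z - a) v) := by intro v; fun_prop
  have CD : ∀ v : ℂ, Continuous (fun z : ℂ => m2 (‖z - a‖ ^ 2) * (2 * inner ℝ (z - a) v) * (2 * inner ℝ (z - a) v) + m1 (‖z - a‖ ^ 2) * (2 * ‖v‖ ^ 2)) := by
    intro v
    exact ((Cm2.mul (Cin v)).mul (Cin v)).add (Cm1.mul continuous_const)
  have hsupp : ∀ f : ℂ → ℝ, (∀ z, T ≤ ‖z - a‖ ^ 2 → f z = 0) → HasCompactSupport f := by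
    intro f hf
    apply HasCompactSupport.intro (isCompact_closedBall a (1 + |T|))
    intro z hz
    apply hf
    rw [Metric.mem_closedBall, dist_eq_norm, not_le] at hz
    have := le_abs_self T
    have := abs_nonneg T
    nlinarith
  have D : ∀ v : ℂ, ∫ z, m (‖z - a‖ ^ 2) * iteratedFDeriv ℝ 2 φ z ![v, v] =
      ∫ z, (m2 (‖z - a‖ ^ 2) * (2 * inner ℝ (z - a) v) * (2 * inner ℝ (z - a) v) + m1 (‖z - a‖ ^ 2) * (2 * ‖v‖ ^ 2)) * φ z := by
    intro v
    obtain ⟨l1, l2, l3, l4⟩ := lap_dir φ hφ v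
    apply green_dir v _ (fun z => m1 (‖z - a‖ ^ 2) * (2 * inner ℝ (z - a) v)) _ φ _ _ (compl m m1 hm v)
      _ l1 l2 Cm (Cm1.mul (Cin v)) (CD v) hφ.continuous l3 l4
    · apply hsupp; intro z hz; simp [(h0 _ hz).1]
    · apply hsupp; intro z hz; simp [(h0 _ hz).2.1]
    · apply hsupp; intro z hz; simp [(h0 _ hz).2.1, (h0 _ hz).2.2]
    · intro z
      have e1 := compl m1 m2 hm1 v z
      have e2 := hin v z
      unfold HasLineDerivAt at e1 e2 ⊢
      have e3 := e1.mul e2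
      refine e3.congr_deriv ?_
      simp
  have I : ∀ g : ℂ → ℝ, Continuous g → (∀ z, T ≤ ‖z - a‖ ^ 2 → g z = 0) → Integrable g := by
    intro g hg sg
    exact hg.integrable_of_hasCompactSupport (hsupp g sg)
  have cφ := hφ.continuous
  have l1 := (lap_dir φ hφ 1).2.2.2
  have l2 := (lap_dir φ hφ Complex.I).2.2.2
  unfold lap
  simp_rw [mul_add]
  rw [integral_add, D, D, ← integral_add]
  · congr 1
    ext z
    have e1 : inner ℝ (z - a) 1 = (z - a).re := by simp [Complex.inner]
    have e2 : inner ℝ (z - a) Complex.I = (z - a).im := by simp [Complex.inner]; ring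
    have e3 : ‖z - a‖ ^ 2 = (z - a).re ^ 2 + (z - a).im ^ 2 := by
      rw [← Complex.normSq_eq_norm_sq, Complex.normSq_apply]; ring
    rw [e1, e2]
    generalize m2 (‖z - a‖ ^ 2) = x2
    generalize m1 (‖z - a‖ ^ 2) = x1
    rw [e3]
    simp
    ring
  · apply I _ ((CD _).mul cφ)
    intro z hz; simp [(h0 _ hz).2.1, (h0 _ hz).2.2]
  · apply I _ ((CD _).mul cφ)
    intro z hz; simp [(h0 _ hz).2.1, (h0 _ hz).2.2]
  · apply I _ (Cm.mul l1)
    intro z hz; simp [(h0 _ hz).1]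
  · apply I _ (Cm.mul l2)
    intro z hz; simp [(h0 _ hz).1]


noncomputable def capD (ε x t : ℝ) : ℝ :=
  4 * (-3 * max (1 - t * x) 0 ^ 2 * x * (Real.log (t + ε) / 2) + 6 * max (1 - t * x) 0 * x ^ 2 * t * (Real.log (t + ε) / 2)
    - 3 * max (1 - t * x) 0 ^ 2 * x * (t / (t + ε)) + max (1 - t * x) 0 ^ 3 * (ε / (2 * (t + ε) ^ 2)))

lemma cap_identity (φ : ℂ → ℝ) (hφ : ContDiff ℝ 2 φ) (a : ℂ) (ε x : ℝ) (hε : 0 < ε) (hx : 0 < x) :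
    ∫ z, (max (1 - ‖z - a‖ ^ 2 * x) 0 ^ 3 * (Real.log (‖z - a‖ ^ 2 + ε) / 2)) * lap φ z =
      ∫ z, capD ε x (‖z - a‖ ^ 2) * φ z := by
  have hp : ∀ (k : ℕ) (t : ℝ), HasDerivAt (fun t : ℝ => max (1 - t * x) 0 ^ (k + 2)) ((k + 2) * max (1 - t * x) 0 ^ (k + 1) * (-x)) t := by
    intro k t
    have h1 : HasDerivAt (fun t : ℝ => 1 - t * x) (-x) t := by
      have := ((hasDerivAt_id t).mul_const x).const_sub 1
      simpa using this
    exact HasDerivAt.comp t (pk_deriv k (1 - t * x)) h1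
  have hl : ∀ t : ℝ, 0 ≤ t → HasDerivAt (fun t : ℝ => Real.log (t + ε) / 2) (1 / (2 * (t + ε))) t := by
    intro t ht
    have h1 : HasDerivAt (fun t : ℝ => t + ε) 1 t := (hasDerivAt_id t).add_const ε
    have h2 := (h1.log (by positivity)).div_const 2
    refine h2.congr_deriv ?_
    field_simp
  have hl1 : ∀ t : ℝ, 0 ≤ t → HasDerivAt (fun t : ℝ => 1 / (2 * (t + ε))) (-1 / (2 * (t + ε) ^ 2)) t := by
    intro t ht
    have h1 : HasDerivAt (fun t : ℝ => 2 * (t + ε)) (2 * 1) t := ((hasDerivAt_id t).add_const ε).const_mul 2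
    have h2 := h1.inv (by positivity)
    simp only [one_div]
    refine h2.congr_deriv ?_
    field_simp
  have h := green_radial φ hφ a (1 / x) (fun t => max (1 - t * x) 0 ^ (1 + 2) * (Real.log (t + ε) / 2))
    (fun t => ((1:ℕ) + 2) * max (1 - t * x) 0 ^ (1 + 1) * (-x) * (Real.log (t + ε) / 2) + max (1 - t * x) 0 ^ (1 + 2) * (1 / (2 * (t + ε))))
    (fun t => ((1:ℕ) + 2) * (((0:ℕ) + 2) * max (1 - t * x) 0 ^ (0 + 1) * (-x)) * (-x) * (Real.log (t + ε) / 2) +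
      ((1:ℕ) + 2) * max (1 - t * x) 0 ^ (1 + 1) * (-x) * (1 / (2 * (t + ε))) +
      (((1:ℕ) + 2) * max (1 - t * x) 0 ^ (1 + 1) * (-x) * (1 / (2 * (t + ε))) + max (1 - t * x) 0 ^ (1 + 2) * (-1 / (2 * (t + ε) ^ 2))))
    (fun t ht => (hp 1 t).mul (hl t ht))
    (fun t ht => by
      have e1 := (((hp 0 t).const_mul (((1:ℕ):ℝ) + 2)).mul_const (-x)).mul (hl t ht)
      exact e1.add ((hp 1 t).mul (hl1 t ht)))
    (by
      intro t ht
      have ht : 0 ≤ t := ht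
      have h1 : t + ε ≠ 0 := by positivity
      have h2 : (2 * (t + ε)) ≠ 0 := by positivity
      have h3 : (2 * (t + ε) ^ 2) ≠ 0 := by positivity
      apply ContinuousAt.continuousWithinAt
      fun_prop (disch := assumption))
    (by
      intro t ht
      have : max (1 - t * x) 0 = 0 := by
        apply max_eq_right
        rw [div_le_iff₀ hx] at ht
        linarith
      simp [this])
  simp only [show (1 + 2) = 3 by norm_num, Nat.cast_one] at h
  norm_num at h
  have e : ∀ z : ℂ, capD ε x (‖z - a‖ ^ 2) * φ z = _ := fun z => by
    unfold capD
    rfl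
  have h' : ∀ F G A B : ℝ, F = G → A = B → F = A → G = B := by intros; subst_vars; rfl
  refine h' _ _ _ _ ?_ ?_ h
  · congr 1
  · congr 1
    ext z
    unfold capD
    have : 0 ≤ ‖z - a‖ ^ 2 := by positivity
    generalize ‖z - a‖ ^ 2 = t at *
    have : t + ε ≠ 0 := by positivity
    field_simp
    ring


lemma decay (φ : ℂ → ℝ) (φinf : ℝ) (hφ : ContDiff ℝ 2 φ)
    (hi : ContDiffAt ℝ 2 (fun w : ℂ => if w = 0 then φinf else φ w⁻¹) 0) (a : ℂ) :
    ∃ C, 0 ≤ C ∧ ∀ z, |φ z - φinf| ≤ C / (1 + ‖z - a‖) := by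
  have h1 := (hi.differentiableAt (by norm_num)).isBigO_sub
  obtain ⟨C1, hC1⟩ := h1.bound
  rw [Metric.eventually_nhds_iff] at hC1
  obtain ⟨δ, hδ, h2⟩ := hC1
  simp only [sub_zero, dist_zero_right, if_true] at h2
  have cont : Continuous (fun z => (φ z - φinf) * (1 + ‖z - a‖)) := by
    have := hφ.continuous
    fun_prop
  obtain ⟨C2, hC2⟩ := (isCompact_closedBall (0:ℂ) (1 / δ + 1)).exists_bound_of_continuousOn cont.continuousOn
  have key : ∀ z, |φ z - φinf| * (1 + ‖z - a‖) ≤ max C2 (|C1| * (2 + ‖a‖)) := by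
    intro z
    by_cases hz : ‖z‖ ≤ 1 / δ + 1
    · have := hC2 z (by simpa using hz)
      rw [Real.norm_eq_abs, abs_mul, abs_of_nonneg (by positivity : 0 ≤ 1 + ‖z - a‖)] at this
      exact this.trans (le_max_left _ _)
    · push Not at hz
      have hd : 0 < 1 / δ := by positivity
      have hz0 : 0 < ‖z‖ := by linarith
      have hzn : z ≠ 0 := norm_pos_iff.1 hz0
      have h3 := @h2 z⁻¹ (by
        rw [norm_inv, inv_lt_comm₀ hz0 hδ]
        rw [← one_div]; linarith)
      simp only [inv_eq_zero, hzn, if_false, inv_inv, norm_inv, Real.norm_eq_abs] at h3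
      refine le_trans ?_ (le_max_right _ _)
      have h4 : 1 + ‖z - a‖ ≤ (2 + ‖a‖) * ‖z‖ := by
        have := norm_sub_le z a
        nlinarith [norm_nonneg a]
      calc |φ z - φinf| * (1 + ‖z - a‖) ≤ (|C1| * ‖z‖⁻¹) * ((2 + ‖a‖) * ‖z‖) := by
            gcongr
            exact h3.trans (by gcongr; exact le_abs_self _)
        _ = |C1| * (2 + ‖a‖) := by field_simp
  refine ⟨max C2 (|C1| * (2 + ‖a‖)), le_trans (by positivity) (le_max_right _ _), fun z => ?_⟩
  rw [le_div_iff₀ (by positivity)]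
  exact key z

lemma log_bd (ε t : ℝ) (hε : 0 < ε) (h1 : ε ≤ 1) (ht : 0 ≤ t) : |Real.log (t + ε)| ≤ (|Real.log ε| + 4) * (1 + t) ^ (1 / 4 : ℝ) := by
  have e1 : Real.log (1 + t) ≤ 4 * (1 + t) ^ (1 / 4 : ℝ) := by
    have := Real.log_le_rpow_div (x := 1 + t) (by positivity) (ε := 1 / 4) (by norm_num)
    linarith
  have e2 : Real.log (t + ε) ≤ Real.log (1 + t) := Real.log_le_log (by positivity) (by linarith)
  have e3 : Real.log ε ≤ Real.log (t + ε) := Real.log_le_log (by positivity) (by linarith)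
  have e4 : 1 ≤ (1 + t) ^ (1 / 4 : ℝ) := Real.one_le_rpow (by linarith) (by norm_num)
  have e5 := abs_nonneg (Real.log ε)
  have e6 := neg_abs_le (Real.log ε)
  rw [abs_le]
  constructor <;> nlinarith

lemma capD_bd (ε x t : ℝ) (hε : 0 < ε) (h1 : ε ≤ 1) (hx : 0 < x) (hx1 : x ≤ 1) (ht : 0 ≤ t) :
    |capD ε x t| ≤ (100 * (|Real.log ε| + 4) + 100 / ε) * (1 + t) ^ (-(3 / 4) : ℝ) := by
  set c := max (1 - t * x) 0 with hc
  set l := Real.log (t + ε) / 2 with hl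
  have c0 : 0 ≤ c := le_max_right _ _
  have c1 : c ≤ 1 := max_le (by nlinarith) (by norm_num)
  have cx : c * x * (1 + t) ≤ 2 := by
    rcases le_total (1 - t * x) 0 with h | h
    · rw [max_eq_right h] at hc
      rw [hc]; norm_num
    · have : x * (1 + t) ≤ 2 := by nlinarith
      have h0 : 0 ≤ x * (1 + t) := by positivity
      nlinarith
  have ctx : c * (x * t) ≤ c := by
    rcases le_total (1 - t * x) 0 with h | h
    · rw [max_eq_right h] at hc
      rw [hc]; norm_num
    · nlinarith
  have u : c * x ≤ 2 / (1 + t) := by rw [le_div_iff₀ (by positivity)]; exact cx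
  have u1 : c ^ 2 * x ≤ 2 / (1 + t) := by
    have : 0 ≤ c * x := by positivity
    nlinarith
  have u2 : c * x ^ 2 * t ≤ 2 / (1 + t) := by
    nlinarith
  have u3 : t / (t + ε) ≤ 1 := by rw [div_le_one (by positivity)]; linarith
  have u3' : 0 ≤ t / (t + ε) := by positivity
  have u4 : ε / (2 * (t + ε) ^ 2) ≤ 1 / ε / (1 + t) := by
    rw [div_div, div_le_div_iff₀ (by positivity) (by positivity)]
    have : ε * (1 + t) ≤ t + ε := by nlinarith
    have h2 : ε * (1 + t) * ε ≤ (t + ε) * (t + ε) := by gcongr; linarith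
    nlinarith
  have u4' : 0 ≤ ε / (2 * (t + ε) ^ 2) := by positivity
  have c3 : c ^ 3 ≤ 1 := pow_le_one₀ c0 c1
  have lb := log_bd ε t hε h1 ht
  have la : |l| ≤ (|Real.log ε| + 4) * (1 + t) ^ (1 / 4 : ℝ) := by
    rw [hl, abs_div]; 
    have := abs_nonneg (Real.log (t + ε))
    norm_num; linarith
  set L := (|Real.log ε| + 4) * (1 + t) ^ (1 / 4 : ℝ) with hL
  have e4 : 1 ≤ (1 + t) ^ (1 / 4 : ℝ) := Real.one_le_rpow (by linarith) (by norm_num)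
  have L4 : 4 ≤ L := by have := abs_nonneg (Real.log ε); nlinarith
  have p : (1 + t) ^ (-(3 / 4) : ℝ) = (1 + t) ^ (1 / 4 : ℝ) / (1 + t) := by
    rw [← Real.rpow_sub_one (by positivity)]; norm_num
  have main : |capD ε x t| ≤ 4 * (3 * (2 / (1 + t)) * L + 6 * (2 / (1 + t)) * L + 3 * (2 / (1 + t)) * 1 + 1 * (1 / ε / (1 + t))) := by
    unfold capD
    rw [abs_mul]
    norm_num only [abs_of_pos]
    gcongr
    refine (abs_add_le _ _).trans ?_
    gcongr
    · refine (abs_sub _ _).trans ?_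
      gcongr
      · refine (abs_add_le _ _).trans ?_
        gcongr
        · rw [abs_mul, show |-3 * max (1 - t * x) 0 ^ 2 * x| = 3 * (c ^ 2 * x) by
            rw [show -3 * max (1 - t * x) 0 ^ 2 * x = -(3 * (c ^ 2 * x)) by rw [hc]; ring, abs_neg, abs_of_nonneg (by positivity)]]
          gcongr
        · rw [abs_mul, show |6 * max (1 - t * x) 0 * x ^ 2 * t| = 6 * (c * x ^ 2 * t) by
            rw [show 6 * max (1 - t * x) 0 * x ^ 2 * t = (6 * (c * x ^ 2 * t)) by rw [hc]; ring, abs_of_nonneg (by positivity)]]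
          gcongr
      · rw [abs_of_nonneg (by positivity)]
        rw [mul_assoc 3]
        gcongr
    · rw [abs_of_nonneg (by positivity)]
      gcongr
  refine main.trans ?_
  rw [p]
  have : 4 * (3 * (2 / (1 + t)) * L + 6 * (2 / (1 + t)) * L + 3 * (2 / (1 + t)) * 1 + 1 * (1 / ε / (1 + t)))
     = (72 * L + 24 + 4 / ε) / (1 + t) := by ring
  rw [this, ← mul_div_assoc]
  gcongr
  have h5 : 100 / ε ≤ 100 / ε * (1 + t) ^ (1 / 4 : ℝ) := le_mul_of_one_le_right (by positivity) e4
  have h6 : 4 / ε ≤ 100 / ε := by gcongr; norm_num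
  calc _ ≤ 100 * L + 100 / ε * (1 + t) ^ (1 / 4 : ℝ) := by linarith
    _ = _ := by rw [hL]; ring


lemma int_dec (a : ℂ) (s : ℝ) (hs : 1 < s) : Integrable (fun z : ℂ => (1 + ‖z - a‖ ^ 2) ^ (-s)) := by
  have h := integrable_rpow_neg_one_add_norm_sq (E := ℂ) (μ := volume) (r := 2 * s) (by
    rw [Complex.finrank_real_complex]; push_cast; linarith)
  have h2 := h.comp_sub_right a
  refine h2.congr (Filter.Eventually.of_forall fun z => ?_)
  simp only
  congr 1; ring

lemma stepA (ψ : ℂ → ℝ) (hψ : ContDiff ℝ 2 ψ) (a : ℂ) (A B : ℝ) (hA0 : 0 ≤ A) (hB0 : 0 ≤ B)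
    (hA : ∀ z, |ψ z| ≤ A * (1 + ‖z - a‖ ^ 2) ^ (-(1 / 2) : ℝ))
    (hB : ∀ z, |lap ψ z| ≤ B / (1 + ‖z - a‖ ^ 2) ^ 2) (ε : ℝ) (hε : 0 < ε) (hε1 : ε ≤ 1) :
    ∫ z, (Real.log (‖z - a‖ ^ 2 + ε) / 2) * lap ψ z = ∫ z, (2 * ε / (‖z - a‖ ^ 2 + ε) ^ 2) * ψ z := by
  have lc := lap_cont ψ hψ
  have cψ := hψ.continuous
  have hev : ∀ᶠ x : ℝ in nhdsWithin 0 (Set.Ioi 0), 0 < x ∧ x ≤ 1 := by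
    filter_upwards [Ioc_mem_nhdsGT (show (0:ℝ) < 1 by norm_num)] with x hx using ⟨hx.1, hx.2⟩
  have clog : Continuous (fun z : ℂ => Real.log (‖z - a‖ ^ 2 + ε)) := by
    apply Continuous.log
    · fun_prop
    · intro z; positivity
  have hlog : ∀ z : ℂ, |Real.log (‖z - a‖ ^ 2 + ε)| ≤ (|Real.log ε| + 4) * (1 + ‖z - a‖ ^ 2) ^ (1 / 4 : ℝ) :=
    fun z => log_bd ε _ hε hε1 (by positivity)
  have T1 : Filter.Tendsto (fun x : ℝ => ∫ z, (max (1 - ‖z - a‖ ^ 2 * x) 0 ^ 3 * (Real.log (‖z - a‖ ^ 2 + ε) / 2)) * lap ψ z)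
      (nhdsWithin 0 (Set.Ioi 0)) (nhds (∫ z, (Real.log (‖z - a‖ ^ 2 + ε) / 2) * lap ψ z)) := by
    apply tendsto_integral_filter_of_dominated_convergence
      (fun z => ((|Real.log ε| + 4) * B) * (1 + ‖z - a‖ ^ 2) ^ (-(7 / 4) : ℝ))
    · refine Filter.Eventually.of_forall fun x => ?_
      apply Continuous.aestronglyMeasurable
      fun_prop
    · filter_upwards [hev] with x hx
      refine Filter.Eventually.of_forall fun z => ?_
      have ht : 0 ≤ ‖z - a‖ ^ 2 := by positivity
      have c0 : 0 ≤ max (1 - ‖z - a‖ ^ 2 * x) 0 := le_max_right _ _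
      have c1 : max (1 - ‖z - a‖ ^ 2 * x) 0 ^ 3 ≤ 1 := pow_le_one₀ c0 (max_le (by nlinarith) (by norm_num))
      rw [Real.norm_eq_abs, abs_mul, abs_mul, abs_of_nonneg (by positivity : 0 ≤ max (1 - ‖z - a‖ ^ 2 * x) 0 ^ 3), abs_div]
      have := hlog z
      have h2 := abs_nonneg (Real.log (‖z - a‖ ^ 2 + ε))
      calc _ ≤ 1 * ((|Real.log ε| + 4) * (1 + ‖z - a‖ ^ 2) ^ (1 / 4 : ℝ)) * (B / (1 + ‖z - a‖ ^ 2) ^ 2) := by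
            gcongr
            · norm_num; linarith
            · exact hB z
        _ = _ := by
            rw [show (-(7 / 4) : ℝ) = 1 / 4 - (2:ℕ) by norm_num, Real.rpow_sub_natCast (by positivity)]
            ring
    · exact (int_dec a _ (by norm_num)).const_mul _
    · refine Filter.Eventually.of_forall fun z => ?_
      have : Continuous (fun x : ℝ => (max (1 - ‖z - a‖ ^ 2 * x) 0 ^ 3 * (Real.log (‖z - a‖ ^ 2 + ε) / 2)) * lap ψ z) := by fun_prop
      have h := (this.tendsto 0).mono_left (nhdsWithin_le_nhds (s := Set.Ioi 0))
      simpa using h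
  have T2 : Filter.Tendsto (fun x : ℝ => ∫ z, capD ε x (‖z - a‖ ^ 2) * ψ z)
      (nhdsWithin 0 (Set.Ioi 0)) (nhds (∫ z, (2 * ε / (‖z - a‖ ^ 2 + ε) ^ 2) * ψ z)) := by
    apply tendsto_integral_filter_of_dominated_convergence
      (fun z => ((100 * (|Real.log ε| + 4) + 100 / ε) * A) * (1 + ‖z - a‖ ^ 2) ^ (-(5 / 4) : ℝ))
    · refine Filter.Eventually.of_forall fun x => ?_
      unfold capD
      apply Measurable.aestronglyMeasurable
      have := cψ.measurable
      fun_prop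
    · filter_upwards [hev] with x hx
      refine Filter.Eventually.of_forall fun z => ?_
      rw [Real.norm_eq_abs, abs_mul]
      calc _ ≤ ((100 * (|Real.log ε| + 4) + 100 / ε) * (1 + ‖z - a‖ ^ 2) ^ (-(3 / 4) : ℝ)) * (A * (1 + ‖z - a‖ ^ 2) ^ (-(1 / 2) : ℝ)) := by
            gcongr
            · exact capD_bd ε x _ hε hε1 hx.1 hx.2 (by positivity)
            · exact hA z
        _ = _ := by
            rw [show (-(5 / 4) : ℝ) = -(3 / 4) + -(1 / 2) by norm_num, Real.rpow_add (by positivity)]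
            ring
    · exact (int_dec a _ (by norm_num)).const_mul _
    · refine Filter.Eventually.of_forall fun z => ?_
      have : Continuous (fun x : ℝ => capD ε x (‖z - a‖ ^ 2) * ψ z) := by unfold capD; fun_prop
      have h := (this.tendsto 0).mono_left (nhdsWithin_le_nhds (s := Set.Ioi 0))
      convert h using 2
      unfold capD
      have h3 : ‖z - a‖ ^ 2 + ε ≠ 0 := by positivity
      simp
      left
      field_simp
      norm_num
  have hE : (fun x : ℝ => ∫ z, (max (1 - ‖z - a‖ ^ 2 * x) 0 ^ 3 * (Real.log (‖z - a‖ ^ 2 + ε) / 2)) * lap ψ z)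
      =ᶠ[nhdsWithin 0 (Set.Ioi 0)] (fun x : ℝ => ∫ z, capD ε x (‖z - a‖ ^ 2) * ψ z) := by
    filter_upwards [hev] with x hx
    exact cap_identity ψ hψ a ε x hε hx.1
  exact tendsto_nhds_unique (T1.congr' hE) T2


lemma ball_real : (volume : Measure ℂ).real (Metric.ball 0 1) = π := by
  simp [Measure.real]

lemma fs_deriv (y : ℝ) : HasDerivAt (fun y : ℝ => -(1 + y ^ 2)⁻¹) (2 * y / (1 + y ^ 2) ^ 2) y := by
  have h1 : HasDerivAt (fun y : ℝ => 1 + y ^ 2) (2 * y) y := by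
    have := (hasDerivAt_pow 2 y).const_add 1
    simpa using this
  have h2 := (h1.inv (by positivity)).neg
  refine h2.congr_deriv ?_
  ring

lemma fs_total : ∫ w : ℂ, 2 / (1 + ‖w‖ ^ 2) ^ 2 = 2 * π := by
  have h := integral_fun_norm_addHaar (volume : Measure ℂ) (fun y : ℝ => 2 / (1 + y ^ 2) ^ 2)
  rw [h, ball_real, Complex.finrank_real_complex]
  have h2 := integral_Ioi_of_hasDerivAt_of_nonneg' (a := 0) (l := 0) (fun x _ => fs_deriv x) (fun x hx => by
      have : 0 < x := hx
      positivity) (by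
      have : Filter.Tendsto (fun y : ℝ => 1 + y ^ 2) Filter.atTop Filter.atTop :=
        Filter.tendsto_atTop_add_const_left _ _ (Filter.tendsto_pow_atTop (by norm_num))
      simpa using this.inv_tendsto_atTop.neg)
  have h3 : ∫ y in Set.Ioi (0:ℝ), y ^ (2 - 1) • (2 / (1 + y ^ 2) ^ 2) = 1 := by
    have h4 : ∫ y in Set.Ioi (0:ℝ), y ^ (2 - 1) • (2 / (1 + y ^ 2) ^ 2) = ∫ y in Set.Ioi (0:ℝ), 2 * y / (1 + y ^ 2) ^ 2 := by
      congr 1; ext y; simp; ring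
    rw [h4, h2]; norm_num
  rw [h3]; simp

lemma fs_ball : ∫ z : ℂ in {z | ‖z‖ ≤ 2}, 1 / (1 + ‖z‖ ^ 2) ^ 2 = 4 / 5 * π := by
  have hm : MeasurableSet {z : ℂ | ‖z‖ ≤ 2} := measurableSet_le (by fun_prop) (by fun_prop)
  rw [← integral_indicator hm]
  have h := integral_fun_norm_addHaar (volume : Measure ℂ) (Set.indicator (Set.Iic 2) (fun y : ℝ => 1 / (1 + y ^ 2) ^ 2))
  have e : (fun z : ℂ => Set.indicator (Set.Iic 2) (fun y : ℝ => 1 / (1 + y ^ 2) ^ 2) ‖z‖) =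
    Set.indicator {z : ℂ | ‖z‖ ≤ 2} (fun z => 1 / (1 + ‖z‖ ^ 2) ^ 2) := by
    ext z; by_cases hz : ‖z‖ ≤ 2 <;> simp [Set.indicator, hz]
  rw [← e, h, ball_real, Complex.finrank_real_complex]
  have h3 : ∫ y in Set.Ioi (0:ℝ), y ^ (2 - 1) • (Set.indicator (Set.Iic 2) (fun y : ℝ => 1 / (1 + y ^ 2) ^ 2) y) = 2 / 5 := by
    have e2 : (fun y : ℝ => y ^ (2 - 1) • (Set.indicator (Set.Iic 2) (fun y : ℝ => 1 / (1 + y ^ 2) ^ 2) y)) =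
      Set.indicator (Set.Iic 2) (fun y : ℝ => (1 / 2) * (2 * y / (1 + y ^ 2) ^ 2)) := by
      ext y; by_cases hz : y ≤ 2 <;> simp [Set.indicator, hz]
      ring
    rw [e2, setIntegral_indicator measurableSet_Iic, Set.Ioi_inter_Iic, ← intervalIntegral.integral_of_le (by norm_num),
      intervalIntegral.integral_const_mul, intervalIntegral.integral_eq_sub_of_hasDerivAt (fun x _ => fs_deriv x)]
    · norm_num
    · apply Continuous.intervalIntegrable
      apply Continuous.div <;> [fun_prop; fun_prop; skip]
      intro x; positivity
  rw [h3]; simp; ring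

lemma log_int : Integrable (fun w : ℂ => (|Real.log ‖w‖| + Real.log (1 + ‖w‖ ^ 2)) / (1 + ‖w‖ ^ 2) ^ 2) := by
  refine (integrable_fun_norm_addHaar (volume : Measure ℂ) (f := fun y : ℝ => (|Real.log y| + Real.log (1 + y ^ 2)) / (1 + y ^ 2) ^ 2)).2 ?_
  rw [Complex.finrank_real_complex]
  refine Integrable.mono' (integrable_inv_one_add_sq.const_mul 4).integrableOn ?_ ?_
  · apply Measurable.aestronglyMeasurable
    have : Measurable (fun y : ℝ => |Real.log y|) := Real.measurable_log.abs
    fun_prop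
  · filter_upwards [ae_restrict_mem measurableSet_Ioi] with y hy
    have hy : 0 < y := hy
    have l0 : 0 ≤ Real.log (1 + y ^ 2) := Real.log_nonneg (by nlinarith)
    rw [Real.norm_eq_abs, abs_of_nonneg (by simp; positivity)]
    have h1 : y * |Real.log y| ≤ 1 + y ^ 2 := by
      rcases le_total y 1 with h | h
      · have := Real.abs_log_mul_self_lt y hy h
        rw [abs_mul, abs_of_pos hy] at this
        nlinarith
      · rw [abs_of_nonneg (Real.log_nonneg h)]
        have := Real.log_le_sub_one_of_pos hy
        nlinarith
    have h2 : Real.log (1 + y ^ 2) ≤ 2 * y := by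
      have : Real.log (1 + y ^ 2) ≤ Real.log ((1 + y) ^ 2) := Real.log_le_log (by positivity) (by nlinarith)
      rw [Real.log_pow] at this
      have h4 := Real.log_le_sub_one_of_pos (show 0 < 1 + y by linarith)
      push_cast at this
      linarith
    have : 4 * (1 + y ^ 2)⁻¹ = (4 * (1 + y ^ 2)) / (1 + y ^ 2) ^ 2 := by field_simp
    rw [this]
    simp only [smul_eq_mul, show 2 - 1 = 1 by rfl, pow_one]
    rw [← mul_div_assoc]
    apply div_le_div_of_nonneg_right _ (by positivity)
    nlinarith

lemma PL (ψ : ℂ → ℝ) (hψ : ContDiff ℝ 2 ψ) (a : ℂ) (A B : ℝ) (hA0 : 0 ≤ A) (hB0 : 0 ≤ B)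
    (hA : ∀ z, |ψ z| ≤ A * (1 + ‖z - a‖ ^ 2) ^ (-(1 / 2) : ℝ))
    (hB : ∀ z, |lap ψ z| ≤ B / (1 + ‖z - a‖ ^ 2) ^ 2) :
    Integrable (fun z => Real.log ‖z - a‖ * lap ψ z) ∧ ∫ z, Real.log ‖z - a‖ * lap ψ z = 2 * π * ψ a := by
  have lc := lap_cont ψ hψ
  have cψ := hψ.continuous
  have hD : Integrable (fun z : ℂ => B * ((|Real.log ‖z - a‖| + Real.log (1 + ‖z - a‖ ^ 2)) / (1 + ‖z - a‖ ^ 2) ^ 2)) :=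
    (log_int.comp_sub_right a).const_mul B
  have hl0 : ∀ z : ℂ, 0 ≤ Real.log (1 + ‖z - a‖ ^ 2) := fun z => Real.log_nonneg (by nlinarith [sq_nonneg ‖z - a‖])
  have hev : ∀ᶠ x : ℝ in nhdsWithin 0 (Set.Ioi 0), 0 < x ∧ x ≤ 1 := by
    filter_upwards [Ioc_mem_nhdsGT (show (0:ℝ) < 1 by norm_num)] with x hx using ⟨hx.1, hx.2⟩
  refine ⟨?_, ?_⟩
  · refine hD.mono' ?_ (Filter.Eventually.of_forall fun z => ?_)
    · apply Measurable.aestronglyMeasurable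
      have := lc.measurable
      fun_prop
    · rw [Real.norm_eq_abs, abs_mul, mul_div_left_comm]
      refine mul_le_mul ?_ (hB z) (abs_nonneg _) (add_nonneg (abs_nonneg _) (hl0 z))
      linarith [hl0 z]
  have T1 : Filter.Tendsto (fun η : ℝ => ∫ z, (Real.log (‖z - a‖ ^ 2 + η ^ 2) / 2) * lap ψ z)
      (nhdsWithin 0 (Set.Ioi 0)) (nhds (∫ z, Real.log ‖z - a‖ * lap ψ z)) := by
    apply tendsto_integral_filter_of_dominated_convergence _ _ _ hD
    · have : ∀ᵐ z : ℂ, z ≠ a := by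
        rw [ae_iff]; simp
      filter_upwards [this] with z hz
      have hz : ‖z - a‖ ≠ 0 := by simpa [sub_eq_zero] using hz
      have : ContinuousAt (fun η : ℝ => (Real.log (‖z - a‖ ^ 2 + η ^ 2) / 2) * lap ψ z) 0 := by
        have : ‖z - a‖ ^ 2 + (0:ℝ) ^ 2 ≠ 0 := by positivity
        fun_prop (disch := assumption)
      have h := this.tendsto.mono_left (nhdsWithin_le_nhds (s := Set.Ioi 0))
      simpa using h
    · refine Filter.Eventually.of_forall fun x => ?_
      apply Measurable.aestronglyMeasurable
      have := lc.measurable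
      fun_prop
    · have hne : ∀ᵐ z : ℂ, z ≠ a := by
        rw [ae_iff]; simp
      filter_upwards [hev] with x hx
      filter_upwards [hne] with z hz
      have hz : 0 < ‖z - a‖ := by rw [norm_pos_iff]; simpa [sub_eq_zero] using hz
      rw [Real.norm_eq_abs, abs_mul, mul_div_left_comm]
      refine mul_le_mul ?_ (hB z) (abs_nonneg _) (add_nonneg (abs_nonneg _) (hl0 z))
      · have e1 : Real.log (‖z - a‖ ^ 2 + x ^ 2) ≤ Real.log (1 + ‖z - a‖ ^ 2) := Real.log_le_log (by positivity) (by nlinarith)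
        have e2 : Real.log (‖z - a‖ ^ 2) ≤ Real.log (‖z - a‖ ^ 2 + x ^ 2) := Real.log_le_log (by positivity) (by nlinarith)
        rw [Real.log_pow] at e2
        push_cast at e2
        have := neg_abs_le (Real.log ‖z - a‖)
        have := abs_nonneg (Real.log ‖z - a‖)
        have := hl0 z
        rw [abs_le]; constructor <;> linarith
  have hI2 : Integrable (fun w : ℂ => 2 / (1 + ‖w‖ ^ 2) ^ 2) := by
    have := (int_dec 0 2 (by norm_num)).const_mul 2
    refine this.congr (Filter.Eventually.of_forall fun z => ?_)
    simp only [sub_zero]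
    rw [Real.rpow_neg (by positivity)]
    norm_cast
  have T2 : Filter.Tendsto (fun η : ℝ => ∫ w : ℂ, 2 / (1 + ‖w‖ ^ 2) ^ 2 * ψ (η • w + a))
      (nhdsWithin 0 (Set.Ioi 0)) (nhds (∫ w : ℂ, 2 / (1 + ‖w‖ ^ 2) ^ 2 * ψ a)) := by
    apply tendsto_integral_filter_of_dominated_convergence (fun w : ℂ => 2 / (1 + ‖w‖ ^ 2) ^ 2 * A) _ _ (hI2.mul_const A)
    · refine Filter.Eventually.of_forall fun w => ?_
      have : Continuous (fun η : ℝ => 2 / (1 + ‖w‖ ^ 2) ^ 2 * ψ (η • w + a)) := by fun_prop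
      have h := (this.tendsto 0).mono_left (nhdsWithin_le_nhds (s := Set.Ioi 0))
      simpa using h
    · refine Filter.Eventually.of_forall fun x => ?_
      apply Measurable.aestronglyMeasurable
      have := cψ.measurable
      fun_prop
    · refine Filter.Eventually.of_forall fun x => Filter.Eventually.of_forall fun w => ?_
      rw [Real.norm_eq_abs, abs_mul, abs_of_nonneg (by positivity)]
      gcongr
      refine (hA _).trans ?_
      apply mul_le_of_le_one_right hA0
      apply Real.rpow_le_one_of_one_le_of_nonpos
      · nlinarith [sq_nonneg ‖x • w + a - a‖]
      · norm_num
  rw [integral_mul_const, fs_total] at T2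
  refine tendsto_nhds_unique T1 (T2.congr' ?_)
  filter_upwards [hev] with η hη
  rw [stepA ψ hψ a A B hA0 hB0 hA hB (η ^ 2) (by have := hη.1; positivity) (by nlinarith [hη.1, hη.2])]
  have h := Measure.integral_comp_smul (volume : Measure ℂ) (fun w : ℂ => (2 * η ^ 2 / (‖w‖ ^ 2 + η ^ 2) ^ 2) * ψ (w + a)) η
  have h2 := integral_add_right_eq_self (μ := (volume : Measure ℂ)) (fun z : ℂ => (2 * η ^ 2 / (‖z - a‖ ^ 2 + η ^ 2) ^ 2) * ψ z) a
  rw [← h2]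
  simp only [add_sub_cancel_right]
  have hp := hη.1
  rw [Complex.finrank_real_complex, abs_of_nonneg (by positivity), smul_eq_mul, inv_mul_eq_div, eq_div_iff (by positivity)] at h
  rw [← h, ← integral_mul_const]
  congr 1; ext w
  rw [norm_smul, Real.norm_eq_abs, abs_of_pos hp]
  have : (1 + ‖w‖ ^ 2) ≠ 0 := by positivity
  have : (η * ‖w‖) ^ 2 + η ^ 2 = η ^ 2 * (1 + ‖w‖ ^ 2) := by ring
  rw [this]
  field_simp


lemma lap_sub_const (φ : ℂ → ℝ) (hφ : ContDiff ℝ 2 φ) (c : ℝ) : lap (fun z => φ z - c) = lap φ := by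
  ext z
  unfold lap
  have h : iteratedFDeriv ℝ 2 (fun z => φ z - c) z = iteratedFDeriv ℝ 2 φ z := by
    ext m
    rw [iteratedFDeriv_two_apply, iteratedFDeriv_two_apply]
    have : fderiv ℝ (fun z => φ z - c) = fderiv ℝ φ := by
      ext y
      rw [fderiv_sub_const]
    rw [this]
  rw [h]

lemma PL2 (φ : ℂ → ℝ) (φinf : ℝ) (hφ : ContDiff ℝ 2 φ)
    (hi : ContDiffAt ℝ 2 (fun w : ℂ => if w = 0 then φinf else φ w⁻¹) 0)
    (K : ℝ) (hK : ∀ lam : ℂ, |(1 + ‖lam‖ ^ 2) ^ 2 * lap φ lam / 2| ≤ K) (a : ℂ) :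
    Integrable (fun z => Real.log ‖z - a‖ * lap φ z) ∧ ∫ z, Real.log ‖z - a‖ * lap φ z = 2 * π * (φ a - φinf) := by
  obtain ⟨C, hC0, hC⟩ := decay φ φinf hφ hi a
  have K0 : 0 ≤ K := (abs_nonneg _).trans (hK 0)
  have h := PL (fun z => φ z - φinf) (hφ.sub contDiff_const) a C (2 * K * (4 * (1 + ‖a‖ ^ 2) ^ 2)) hC0 (by positivity) ?_ ?_
  · rw [lap_sub_const φ hφ] at h
    exact h
  · intro z
    refine (hC z).trans ?_
    rw [div_eq_mul_inv]
    gcongr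
    rw [Real.rpow_neg (by positivity), ← Real.sqrt_eq_rpow]
    gcongr
    rw [Real.sqrt_le_left (by positivity)]
    nlinarith [norm_nonneg (z - a)]
  · intro z
    rw [lap_sub_const φ hφ]
    have h1 := hK z
    rw [abs_div, abs_mul, abs_of_nonneg (by positivity : 0 ≤ (1 + ‖z‖ ^ 2) ^ 2), abs_of_pos (by norm_num : (0:ℝ) < 2), div_le_iff₀ (by norm_num)] at h1
    rw [le_div_iff₀ (by positivity)]
    have h2 : 1 + ‖z - a‖ ^ 2 ≤ 2 * (1 + ‖z‖ ^ 2) * (1 + ‖a‖ ^ 2) := by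
      have := norm_sub_le z a
      have h3 : ‖z - a‖ ^ 2 ≤ (‖z‖ + ‖a‖) ^ 2 := by gcongr
      nlinarith [sq_nonneg (‖z‖ - ‖a‖), mul_nonneg (sq_nonneg ‖z‖) (sq_nonneg ‖a‖)]
    calc |lap φ z| * (1 + ‖z - a‖ ^ 2) ^ 2 ≤ |lap φ z| * (2 * (1 + ‖z‖ ^ 2) * (1 + ‖a‖ ^ 2)) ^ 2 := by gcongr
      _ = ((1 + ‖z‖ ^ 2) ^ 2 * |lap φ z|) * (4 * (1 + ‖a‖ ^ 2) ^ 2) := by ring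
      _ ≤ (K * 2) * (4 * (1 + ‖a‖ ^ 2) ^ 2) := by gcongr
      _ = _ := by ring

noncomputable def cc (d : ℕ) (lam : ℂ) : ℝ := (d / 2 : ℝ) * Real.log 2 + 1 / 2 * Real.log (1 + ‖lam‖ ^ 2)

lemma cc_nonneg (d : ℕ) (lam : ℂ) : 0 ≤ cc d lam := by
  unfold cc
  have : 0 ≤ Real.log (1 + ‖lam‖ ^ 2) := Real.log_nonneg (by nlinarith [sq_nonneg ‖lam‖])
  have : 0 ≤ Real.log 2 := Real.log_nonneg (by norm_num)
  positivity

lemma one_step (d : ℕ) (hd : 1 < d) (lam z : ℂ) :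
    |1 / 2 * Real.log (1 + ‖z ^ d + lam‖ ^ 2) - d * (1 / 2 * Real.log (1 + ‖z‖ ^ 2))| ≤ cc d lam := by
  have sq : ∀ u v : ℂ, ‖u - v‖ ^ 2 ≤ 2 * ‖u‖ ^ 2 + 2 * ‖v‖ ^ 2 := by
    intro u v
    have h1 := norm_sub_le u v
    have h3 : ‖u - v‖ ^ 2 ≤ (‖u‖ + ‖v‖) ^ 2 := by gcongr
    nlinarith [sq_nonneg (‖u‖ - ‖v‖)]
  have e1 : ‖z ^ d‖ ^ 2 = (‖z‖ ^ 2) ^ d := by rw [norm_pow, ← pow_mul, ← pow_mul, mul_comm]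
  have h1 : 1 + ‖z ^ d + lam‖ ^ 2 ≤ 2 ^ d * (1 + ‖z‖ ^ 2) ^ d * (1 + ‖lam‖ ^ 2) := by
    have a1 := sq (z ^ d) (-lam)
    rw [sub_neg_eq_add, norm_neg, e1] at a1
    have a2 : 1 + (‖z‖ ^ 2) ^ d ≤ (1 + ‖z‖ ^ 2) ^ d := by
      have := pow_add_pow_le (x := (1:ℝ)) (y := ‖z‖ ^ 2) (n := d) (by norm_num) (by positivity) (by omega)
      rwa [one_pow] at this
    have a3 : (2:ℝ) ≤ 2 ^ d := by
      calc (2:ℝ) = 2 ^ 1 := by norm_num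
        _ ≤ 2 ^ d := pow_le_pow_right₀ (by norm_num) (by omega)
    have p0 : 0 ≤ (‖z‖ ^ 2) ^ d := by positivity
    have p1 : 0 ≤ ‖lam‖ ^ 2 := by positivity
    calc 1 + ‖z ^ d + lam‖ ^ 2 ≤ 2 * (1 + (‖z‖ ^ 2) ^ d) * (1 + ‖lam‖ ^ 2) := by nlinarith [mul_nonneg p0 p1]
      _ ≤ _ := by gcongr
  have h2 : (1 + ‖z‖ ^ 2) ^ d ≤ 2 ^ d * (1 + ‖z ^ d + lam‖ ^ 2) * (1 + ‖lam‖ ^ 2) := by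
    have a1 := sq (z ^ d + lam) lam
    rw [add_sub_cancel_right, e1] at a1
    have a2 : (1 + ‖z‖ ^ 2) ^ d ≤ 2 ^ (d - 1) * (1 ^ d + (‖z‖ ^ 2) ^ d) := add_pow_le (by norm_num) (by positivity) d
    have p0 : 0 ≤ ‖z ^ d + lam‖ ^ 2 := by positivity
    have p1 : 0 ≤ ‖lam‖ ^ 2 := by positivity
    have a4 : 1 ^ d + (‖z‖ ^ 2) ^ d ≤ 2 * (1 + ‖z ^ d + lam‖ ^ 2) * (1 + ‖lam‖ ^ 2) := by
      rw [one_pow]; nlinarith [mul_nonneg p0 p1]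
    calc (1 + ‖z‖ ^ 2) ^ d ≤ 2 ^ (d - 1) * (1 ^ d + (‖z‖ ^ 2) ^ d) := a2
      _ ≤ 2 ^ (d - 1) * (2 * (1 + ‖z ^ d + lam‖ ^ 2) * (1 + ‖lam‖ ^ 2)) := by gcongr
      _ = (2 ^ (d - 1) * 2) * (1 + ‖z ^ d + lam‖ ^ 2) * (1 + ‖lam‖ ^ 2) := by ring
      _ = _ := by rw [← pow_succ, Nat.sub_add_cancel (by omega)]
  have l1 := Real.log_le_log (by positivity) h1
  have l2 := Real.log_le_log (by positivity) h2
  rw [Real.log_mul (by positivity) (by positivity), Real.log_mul (by positivity) (by positivity), Real.log_pow, Real.log_pow] at l1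
  rw [Real.log_mul (by positivity) (by positivity), Real.log_mul (by positivity) (by positivity), Real.log_pow, Real.log_pow] at l2
  unfold cc
  rw [abs_le]
  constructor <;> linarith

lemma growth (d : ℕ) (hd : 1 < d) (gI : ℂ → ℝ)
    (hgI : ∀ lam : ℂ, Filter.Tendsto
      (fun k : ℕ => (1 / 2) * Real.log (1 + ‖(fc d lam)^[k] 0‖ ^ 2) / (d : ℝ) ^ (k - 1))
      Filter.atTop (nhds (gI lam))) (N : ℕ) (lam : ℂ) :
    |(d:ℝ) ^ N * gI lam - 1 / 2 * Real.log (1 + ‖(fc d lam)^[N + 1] 0‖ ^ 2)| ≤ cc d lam := by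
  have hd2 : (2:ℝ) ≤ d := by exact_mod_cast hd
  set L : ℕ → ℝ := fun k => 1 / 2 * Real.log (1 + ‖(fc d lam)^[k] 0‖ ^ 2) with hL
  have st : ∀ k, |L (k + 1) - d * L k| ≤ cc d lam := by
    intro k
    have := one_step d hd lam ((fc d lam)^[k] 0)
    simp only [hL, Function.iterate_succ_apply']
    exact this
  have c0 := cc_nonneg d lam
  have key : ∀ m : ℕ, |L (N + 1 + m) / (d:ℝ) ^ (N + m) - L (N + 1) / (d:ℝ) ^ N| ≤ cc d lam * (1 / (d:ℝ) ^ N - 1 / (d:ℝ) ^ (N + m)) := by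
    intro m
    induction m with
    | zero => simp
    | succ m ih =>
      have h1 := st (N + 1 + m)
      have p : (0:ℝ) < (d:ℝ) ^ (N + m) := by positivity
      have e : L (N + 1 + (m + 1)) / (d:ℝ) ^ (N + (m + 1)) - L (N + 1) / (d:ℝ) ^ N =
        (L (N + 1 + m + 1) - d * L (N + 1 + m)) / (d:ℝ) ^ (N + m + 1) + (L (N + 1 + m) / (d:ℝ) ^ (N + m) - L (N + 1) / (d:ℝ) ^ N) := by
        rw [← add_assoc, ← add_assoc, pow_succ]
        field_simp
        ring
      rw [e]
      refine (abs_add_le _ _).trans ?_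
      rw [abs_div, abs_of_pos (by positivity : (0:ℝ) < (d:ℝ) ^ (N + m + 1))]
      have h3 : |L (N + 1 + m + 1) - d * L (N + 1 + m)| / (d:ℝ) ^ (N + m + 1) ≤ cc d lam * (1 / (d:ℝ) ^ (N + m) - 1 / (d:ℝ) ^ (N + m + 1)) := by
        rw [div_le_iff₀ (by positivity)]
        have : (1 / (d:ℝ) ^ (N + m) - 1 / (d:ℝ) ^ (N + m + 1)) * (d:ℝ) ^ (N + m + 1) = d - 1 := by
          rw [pow_succ]; field_simp
        rw [mul_assoc, this]
        nlinarith
      rw [← add_assoc]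
      linarith
  have T : Filter.Tendsto (fun m : ℕ => |L (N + 1 + m) / (d:ℝ) ^ (N + m) - L (N + 1) / (d:ℝ) ^ N|) Filter.atTop (nhds |gI lam - L (N + 1) / (d:ℝ) ^ N|) := by
    have h1 := (hgI lam).comp (Filter.tendsto_add_atTop_nat (N + 1))
    refine ((h1.sub_const _).abs).congr fun m => ?_
    simp only [Function.comp, hL]
    rw [show m + (N + 1) = N + 1 + m by ring, show N + 1 + m - 1 = N + m by omega]
  have h4 : |gI lam - L (N + 1) / (d:ℝ) ^ N| ≤ cc d lam / (d:ℝ) ^ N := by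
    refine le_of_tendsto' T fun m => (key m).trans ?_
    rw [div_eq_mul_one_div (cc d lam)]
    gcongr
    have : 0 ≤ 1 / (d:ℝ) ^ (N + m) := by positivity
    linarith
  rw [le_div_iff₀ (by positivity)] at h4
  rw [← abs_of_pos (by positivity : (0:ℝ) < (d:ℝ) ^ N), ← abs_mul] at h4
  refine le_trans (le_of_eq ?_) h4
  rw [abs_of_pos (by positivity : (0:ℝ) < (d:ℝ) ^ N)]
  congr 1
  field_simp
  simp only [hL]
  ring


lemma root_logsum (d : ℕ) (hd : 1 < d) (N : ℕ)
    (hs : ∀ z : ℂ, (PP d (N + 1)).eval z = 0 → (PP d (N + 1)).derivative.eval z ≠ 0) :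
    ∃ S : Finset ℂ, S.card = d ^ N ∧ (∀ z, (PP d (N + 1)).eval z ≠ 0 → Real.log ‖(PP d (N + 1)).eval z‖ = ∑ a ∈ S, Real.log ‖z - a‖) ∧
      ∀ z, z ∈ S ↔ (PP d (N + 1)).eval z = 0 := by
  obtain ⟨hm, hdeg⟩ := PP_deg d hd N
  set P := PP d (N + 1)
  have hP0 : P ≠ 0 := hm.ne_zero
  have hsp : P.Splits := IsAlgClosed.splits P
  have hnd : P.roots.Nodup := by
    rw [Multiset.nodup_iff_count_le_one]
    intro z
    rw [Polynomial.count_roots]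
    by_contra! h
    rw [Polynomial.one_lt_rootMultiplicity_iff_isRoot hP0] at h
    exact hs z h.1 h.2
  have mem : ∀ z, z ∈ P.roots.toFinset ↔ P.eval z = 0 := by
    intro z
    rw [Multiset.mem_toFinset, Polynomial.mem_roots hP0, Polynomial.IsRoot]
  refine ⟨P.roots.toFinset, ?_, ?_, mem⟩
  · rw [Multiset.toFinset_card_of_nodup hnd, ← hsp.natDegree_eq_card_roots, hdeg]
  · intro z hz
    have e : P.eval z = ∏ a ∈ P.roots.toFinset, (z - a) := by
      rw [hsp.eval_eq_prod_roots_of_monic hm, Finset.prod, Multiset.toFinset_val, hnd.dedup]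
    rw [e, norm_prod, Real.log_prod]
    intro a ha h0
    rw [norm_eq_zero, sub_eq_zero] at h0
    rw [mem, ← h0] at ha
    exact hz ha

lemma logm_bound : ∃ C0 : ℝ, 0 ≤ C0 ∧ ∀ (d : ℕ), 1 < d → ∀ n : ℕ, 1 ≤ n → ∀ r : ℝ, 0 < r → r ≤ 1 →
    (∀ z, ‖(PP d n).eval z‖ ≤ r → (PP d n).derivative.eval z ≠ 0) →
    Integrable (fun z : ℂ => max (-Real.log ‖(PP d n).eval z‖) 0 / (1 + ‖z‖ ^ 2) ^ 2) ∧
    ∫ z : ℂ, max (-Real.log ‖(PP d n).eval z‖) 0 / (1 + ‖z‖ ^ 2) ^ 2 ≤ 4 / 5 * π * Real.log (1 / r) + C0 := by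
  obtain ⟨C0, hC0, area⟩ := area_log
  refine ⟨C0, hC0, ?_⟩
  intro d hd n hn r hr hr1 hnv
  have ar := area (fun z => (PP d n).eval z) (fun z => (PP d n).derivative.eval z)
    (fun z => (PP d n).derivative.derivative.eval z) (fun z => (PP d n).derivative.derivative.derivative.eval z) r hr
    (fun z => Polynomial.hasDerivAt _ z) (fun z => Polynomial.hasDerivAt _ z) (fun z => Polynomial.hasDerivAt _ z)
    (Polynomial.continuous _) hnv (fun z hz => PP_small d hd n hn z (hz.trans hr1))
  have cP : Continuous (fun z => (PP d n).eval z) := Polynomial.continuous _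
  set P := PP d n
  have mP := cP.measurable
  have hmS : MeasurableSet {z : ℂ | ‖P.eval z‖ < r} := measurableSet_lt (by fun_prop) (by fun_prop)
  have hm2 : MeasurableSet {z : ℂ | ‖z‖ ≤ 2} := measurableSet_le (by fun_prop) (by fun_prop)
  set g : ℂ → ℝ := Set.indicator {z : ℂ | ‖P.eval z‖ < r} (fun z => Real.log (r / ‖P.eval z‖)) with hg
  have g0 : ∀ z, 0 ≤ g z := by
    intro z
    apply Set.indicator_nonneg
    intro z hz
    have hz : ‖P.eval z‖ < r := hz
    rcases eq_or_lt_of_le (norm_nonneg (P.eval z)) with h | h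
    · rw [← h]; simp
    · apply Real.log_nonneg
      rw [le_div_iff₀ h]; linarith
  have mg : Measurable g := by
    apply Measurable.indicator _ hmS
    fun_prop
  have lg : ∫⁻ z, ENNReal.ofReal (g z) ≤ ENNReal.ofReal C0 := by
    refine le_trans (le_of_eq ?_) ar
    rw [← lintegral_indicator hmS]
    congr 1; ext z
    by_cases hz : z ∈ {z : ℂ | ‖P.eval z‖ < r}
    · rw [hg, Set.indicator_of_mem hz, Set.indicator_of_mem hz]
    · rw [hg, Set.indicator_of_notMem hz, Set.indicator_of_notMem hz, ENNReal.ofReal_zero]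
  have ig : Integrable g := by
    refine ⟨mg.aestronglyMeasurable, ?_⟩
    rw [hasFiniteIntegral_iff_ofReal (Filter.Eventually.of_forall g0)]
    exact lt_of_le_of_lt lg ENNReal.ofReal_lt_top
  have ig2 : ∫ z, g z ≤ C0 := by
    rw [integral_eq_lintegral_of_nonneg_ae (Filter.Eventually.of_forall g0) mg.aestronglyMeasurable]
    exact ENNReal.toReal_le_of_le_ofReal hC0 lg
  have hI2 : Integrable (fun w : ℂ => 1 / (1 + ‖w‖ ^ 2) ^ 2) := by
    have := (int_dec 0 2 (by norm_num))
    refine this.congr (Filter.Eventually.of_forall fun z => ?_)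
    simp only [sub_zero]
    rw [Real.rpow_neg (by positivity)]
    norm_cast
    rw [one_div]
  have lr : 0 ≤ Real.log (1 / r) := Real.log_nonneg (by rw [le_div_iff₀ hr]; linarith)
  have ih := (hI2.indicator hm2).const_mul (Real.log (1 / r))
  have dom : ∀ z, max (-Real.log ‖P.eval z‖) 0 / (1 + ‖z‖ ^ 2) ^ 2 ≤
      Real.log (1 / r) * Set.indicator {z : ℂ | ‖z‖ ≤ 2} (fun w : ℂ => 1 / (1 + ‖w‖ ^ 2) ^ 2) z + g z := by
    intro z
    have i0 : 0 ≤ Set.indicator {z : ℂ | ‖z‖ ≤ 2} (fun w : ℂ => 1 / (1 + ‖w‖ ^ 2) ^ 2) z := Set.indicator_nonneg (fun w _ => by positivity) z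
    rcases le_total 1 ‖P.eval z‖ with h | h
    · rw [max_eq_right (by have := Real.log_nonneg h; linarith), zero_div]
      exact add_nonneg (mul_nonneg lr i0) (g0 z)
    · have hz := PP_small d hd n hn z h
      rw [Set.indicator_of_mem (show z ∈ {z : ℂ | ‖z‖ ≤ 2} from hz)]
      have h1 : max (-Real.log ‖P.eval z‖) 0 ≤ Real.log (1 / r) + g z := by
        apply max_le _ (add_nonneg lr (g0 z))
        rcases eq_or_lt_of_le (norm_nonneg (P.eval z)) with h0 | h0
        · rw [← h0]; simp only [Real.log_zero, neg_zero]; exact add_nonneg lr (g0 z)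
        rw [one_div, Real.log_inv]
        by_cases hz : z ∈ {z : ℂ | ‖P.eval z‖ < r}
        · rw [hg, Set.indicator_of_mem hz, Real.log_div hr.ne' h0.ne']
          linarith
        · rw [hg, Set.indicator_of_notMem hz]
          have := Real.log_le_log hr (not_lt.1 hz)
          linarith
      have h2 : 1 ≤ (1 + ‖z‖ ^ 2) ^ 2 := by nlinarith [sq_nonneg ‖z‖]
      calc _ ≤ (Real.log (1 / r) + g z) / (1 + ‖z‖ ^ 2) ^ 2 := by gcongr
        _ = Real.log (1 / r) * (1 / (1 + ‖z‖ ^ 2) ^ 2) + g z / (1 + ‖z‖ ^ 2) ^ 2 := by ring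
        _ ≤ _ := by
          gcongr
          exact div_le_self (g0 z) h2
  have isum := ih.add ig
  have I1 : Integrable (fun z : ℂ => max (-Real.log ‖P.eval z‖) 0 / (1 + ‖z‖ ^ 2) ^ 2) := by
    refine isum.mono' ?_ (Filter.Eventually.of_forall fun z => ?_)
    · apply Measurable.aestronglyMeasurable
      fun_prop
    · rw [Real.norm_eq_abs, abs_of_nonneg (div_nonneg (le_max_right _ _) (by positivity))]
      exact dom z
  refine ⟨I1, (integral_mono I1 isum dom).trans ?_⟩
  have e := integral_add ih ig
  simp only [Pi.add_apply]
  rw [e, integral_const_mul, integral_indicator hm2, fs_ball]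
  linarith

lemma log_diff (p L G cst : ℝ) (hp : 0 < p) (hL : L = 1 / 2 * Real.log (1 + p ^ 2)) (h : |G - L| ≤ cst) :
    |Real.log p - G| ≤ max (-Real.log p) 0 + 1 / 2 * Real.log 2 + cst := by
  have h1 : Real.log p ≤ L := by
    have := Real.log_le_log (by positivity : 0 < p ^ 2) (by linarith : p ^ 2 ≤ 1 + p ^ 2)
    rw [Real.log_pow] at this
    push_cast at this
    linarith
  have h2 : L ≤ Real.log p + max (-Real.log p) 0 + 1 / 2 * Real.log 2 := by
    rcases le_total 1 p with h | h
    · have := Real.log_le_log (by positivity : 0 < 1 + p ^ 2) (by nlinarith : 1 + p ^ 2 ≤ 2 * p ^ 2)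
      rw [Real.log_mul (by norm_num) (by positivity), Real.log_pow] at this
      push_cast at this
      have := le_max_right (-Real.log p) 0
      linarith
    · have := Real.log_le_log (by positivity : 0 < 1 + p ^ 2) (by nlinarith : 1 + p ^ 2 ≤ 2)
      have := le_max_left (-Real.log p) 0
      linarith
  rw [abs_le] at h ⊢
  have := le_max_right (-Real.log p) 0
  have : 0 ≤ Real.log 2 := Real.log_nonneg (by norm_num)
  constructor <;> linarith [h.1, h.2]


lemma core (d : ℕ) (hd : 1 < d) (gI : ℂ → ℝ)
    (hgI : ∀ lam : ℂ, Filter.Tendsto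
      (fun k : ℕ => (1 / 2) * Real.log (1 + ‖(fc d lam)^[k] 0‖ ^ 2) / (d : ℝ) ^ (k - 1))
      Filter.atTop (nhds (gI lam))) : ∃ E : ℝ, 0 ≤ E ∧ ∀ (N : ℕ) (r : ℝ), 0 < r → r ≤ 1 →
    (∀ z, ‖(PP d (N + 1)).eval z‖ ≤ r → (PP d (N + 1)).derivative.eval z ≠ 0) →
    ∀ φ : ℂ → ℝ, ∀ φinf : ℝ, ContDiff ℝ 2 φ →
      ContDiffAt ℝ 2 (fun w : ℂ => if w = 0 then φinf else φ w⁻¹) 0 →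
      ∀ K : ℝ, (∀ lam : ℂ, |(1 + ‖lam‖ ^ 2) ^ 2 * lap φ lam / 2| ≤ K) →
      |((d : ℝ) - 1) * (∑ᶠ lam ∈ {l : ℂ | (fc d l)^[N + 1] 0 = 0}, φ lam)
          - (d : ℝ) ^ (N + 1) * (((d : ℝ) - 1) / d *
              (φinf + ∫ lam : ℂ, gI lam * lap φ lam / (2 * π)))|
        ≤ ((d:ℝ) - 1) * K * (4 / 5 * Real.log (1 / r) + E) := by
  obtain ⟨C0, hC0, lm⟩ := logm_bound
  have hd2 : (2:ℝ) ≤ d := by exact_mod_cast hd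
  set h : ℂ → ℝ := fun z => (1 / 2 * Real.log 2 + cc d z) / (1 + ‖z‖ ^ 2) ^ 2 with hh
  have hI2 : Integrable (fun w : ℂ => 1 / (1 + ‖w‖ ^ 2) ^ 2) := by
    have := (int_dec 0 2 (by norm_num))
    refine this.congr (Filter.Eventually.of_forall fun z => ?_)
    simp only [sub_zero]
    rw [Real.rpow_neg (by positivity)]
    norm_cast
    rw [one_div]
  have l20 : 0 ≤ Real.log 2 := Real.log_nonneg (by norm_num)
  have ih : Integrable h := by
    refine ((hI2.const_mul (1 / 2 * Real.log 2 + d / 2 * Real.log 2)).add (log_int)).mono' ?_ (Filter.Eventually.of_forall fun z => ?_)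
    · apply Measurable.aestronglyMeasurable
      simp only [hh, cc]
      fun_prop
    · have := cc_nonneg d z
      rw [Real.norm_eq_abs, abs_of_nonneg (by simp only [hh]; positivity)]
      simp only [hh, Pi.add_apply]
      rw [mul_one_div, ← add_div]
      apply div_le_div_of_nonneg_right _ (by positivity)
      unfold cc
      have : 0 ≤ Real.log (1 + ‖z‖ ^ 2) := Real.log_nonneg (by nlinarith [sq_nonneg ‖z‖])
      have := abs_nonneg (Real.log ‖z‖)
      linarith
  have h0 : ∀ z, 0 ≤ h z := by
    intro z
    have := cc_nonneg d z
    simp only [hh]; positivity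
  have H0 : 0 ≤ ∫ z, h z := integral_nonneg h0
  refine ⟨(C0 + ∫ z, h z) / π, by positivity, ?_⟩
  intro N r hr hr1 hnv φ φinf hφ hi K hK
  have K0 : 0 ≤ K := (abs_nonneg _).trans (hK 0)
  obtain ⟨IM, BM⟩ := lm d hd (N + 1) (by omega) r hr hr1 hnv
  obtain ⟨S, cS, lS, mS⟩ := root_logsum d hd N (fun z hz => hnv z (by rw [hz]; simpa using hr.le))
  have lc := (lap_cont φ hφ).measurable
  have mP : Measurable (fun z => (PP d (N + 1)).eval z) := (Polynomial.continuous _).measurable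
  have mgI : Measurable gI := by
    refine measurable_of_tendsto_metrizable (f := fun k lam => (1 / 2) * Real.log (1 + ‖(fc d lam)^[k] 0‖ ^ 2) / (d : ℝ) ^ (k - 1)) (fun k => ?_) (tendsto_pi_nhds.2 hgI)
    have : Measurable (fun lam : ℂ => (fc d lam)^[k] 0) := by
      have h1 : Continuous (fun z => (PP d k).eval z) := Polynomial.continuous _
      have h2 := h1.measurable
      simpa only [PP_eval] using h2
    fun_prop
  have fS : ∑ᶠ lam ∈ {l : ℂ | (fc d l)^[N + 1] 0 = 0}, φ lam = ∑ a ∈ S, φ a := by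
    have hset : {l : ℂ | (fc d l)^[N + 1] 0 = 0} = (S : Set ℂ) := by
      ext z
      rw [Finset.mem_coe, mS, PP_eval]
      rfl
    rw [hset, finsum_mem_coe_finset]
  have ne : ∀ᵐ z : ℂ, (PP d (N + 1)).eval z ≠ 0 := by
    rw [ae_iff]
    have : {a : ℂ | ¬ (PP d (N + 1)).eval a ≠ 0} = ↑S := by
      ext z; simp [mS]
    rw [this]
    exact S.finite_toSet.measure_zero _
  have pl := fun a => PL2 φ φinf hφ hi K hK a
  have IS : Integrable (fun z => ∑ a ∈ S, Real.log ‖z - a‖ * lap φ z) := integrable_finsetSum _ (fun a _ => (pl a).1)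
  have eS : ∫ z, ∑ a ∈ S, Real.log ‖z - a‖ * lap φ z = 2 * π * (∑ a ∈ S, φ a - d ^ N * φinf) := by
    rw [integral_finsetSum _ (fun a _ => (pl a).1), Finset.sum_congr rfl (fun a _ => (pl a).2), ← Finset.mul_sum, Finset.sum_sub_distrib,
      Finset.sum_const, cS]
    simp
  have aeq : (fun z => Real.log ‖(PP d (N + 1)).eval z‖ * lap φ z) =ᵐ[volume] (fun z => ∑ a ∈ S, Real.log ‖z - a‖ * lap φ z) := by
    filter_upwards [ne] with z hz
    rw [lS z hz, Finset.sum_mul]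
  have IL : Integrable (fun z => Real.log ‖(PP d (N + 1)).eval z‖ * lap φ z) := IS.congr aeq.symm
  have eL : ∫ z, Real.log ‖(PP d (N + 1)).eval z‖ * lap φ z = 2 * π * (∑ a ∈ S, φ a - d ^ N * φinf) := by
    rw [integral_congr_ae aeq, eS]
  have lapb : ∀ z, |lap φ z| ≤ 2 * K / (1 + ‖z‖ ^ 2) ^ 2 := by
    intro z
    have h1 := hK z
    rw [abs_div, abs_mul, abs_of_nonneg (by positivity : 0 ≤ (1 + ‖z‖ ^ 2) ^ 2), abs_of_pos (by norm_num : (0:ℝ) < 2), div_le_iff₀ (by norm_num)] at h1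
    rw [le_div_iff₀ (by positivity)]
    linarith
  have Idom := (IM.add ih).const_mul (2 * K)
  have dom : ∀ᵐ z : ℂ, ‖(Real.log ‖(PP d (N + 1)).eval z‖ - d ^ N * gI z) * lap φ z‖ ≤
      2 * K * (max (-Real.log ‖(PP d (N + 1)).eval z‖) 0 / (1 + ‖z‖ ^ 2) ^ 2 + h z) := by
    filter_upwards [ne] with z hz
    rw [Real.norm_eq_abs, abs_mul]
    have g1 := growth d hd gI hgI N z
    rw [← PP_eval] at g1
    have g2 := log_diff _ _ _ _ (norm_pos_iff.2 hz) rfl g1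
    have g3 : 0 ≤ max (-Real.log ‖(PP d (N + 1)).eval z‖) 0 + 1 / 2 * Real.log 2 + cc d z := (abs_nonneg _).trans g2
    calc _ ≤ (max (-Real.log ‖(PP d (N + 1)).eval z‖) 0 + 1 / 2 * Real.log 2 + cc d z) * (2 * K / (1 + ‖z‖ ^ 2) ^ 2) :=
          mul_le_mul g2 (lapb z) (abs_nonneg _) g3
      _ = _ := by simp only [Pi.add_apply, hh]; ring
  have ID : Integrable (fun z => (Real.log ‖(PP d (N + 1)).eval z‖ - d ^ N * gI z) * lap φ z) := by
    refine Idom.mono' ?_ dom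
    apply Measurable.aestronglyMeasurable
    fun_prop
  have bD : |∫ z, (Real.log ‖(PP d (N + 1)).eval z‖ - d ^ N * gI z) * lap φ z| ≤ 2 * K * (4 / 5 * π * Real.log (1 / r) + C0 + ∫ z, h z) := by
    rw [← Real.norm_eq_abs]
    refine (norm_integral_le_of_norm_le Idom dom).trans ?_
    rw [integral_const_mul]
    have e := integral_add IM ih
    simp only [Pi.add_apply]
    rw [e]
    gcongr
  have eD : ∫ z, (Real.log ‖(PP d (N + 1)).eval z‖ - d ^ N * gI z) * lap φ z =
      2 * π * (∑ a ∈ S, φ a - d ^ N * φinf) - d ^ N * (2 * π) * ∫ z, gI z * lap φ z / (2 * π) := by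
    have e1 := integral_sub IL ID
    rw [eL] at e1
    have e2 : ∫ z, (Real.log ‖(PP d (N + 1)).eval z‖ * lap φ z - (Real.log ‖(PP d (N + 1)).eval z‖ - d ^ N * gI z) * lap φ z) =
       d ^ N * (2 * π) * ∫ z, gI z * lap φ z / (2 * π) := by
      rw [← integral_const_mul]
      congr 1; ext z
      field_simp
      ring
    linarith
  have fin : ((d : ℝ) - 1) * (∑ a ∈ S, φ a) - (d : ℝ) ^ (N + 1) * (((d : ℝ) - 1) / d *
              (φinf + ∫ lam : ℂ, gI lam * lap φ lam / (2 * π))) =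
      ((d:ℝ) - 1) / (2 * π) * ∫ z, (Real.log ‖(PP d (N + 1)).eval z‖ - d ^ N * gI z) * lap φ z := by
    rw [eD, pow_succ]
    generalize ∫ lam : ℂ, gI lam * lap φ lam / (2 * π) = J
    field_simp
    ring
  rw [fS, fin, abs_mul, abs_of_nonneg (div_nonneg (by linarith) (by positivity))]
  calc _ ≤ ((d:ℝ) - 1) / (2 * π) * (2 * K * (4 / 5 * π * Real.log (1 / r) + C0 + ∫ z, h z)) :=
        mul_le_mul_of_nonneg_left bD (div_nonneg (by linarith) (by positivity))
    _ = _ := by field_simp; ring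

theorem statement11 (d : ℕ) (hd : 1 < d) (gI : ℂ → ℝ)
    (hgI : ∀ lam : ℂ, Filter.Tendsto
      (fun k : ℕ => (1 / 2) * Real.log (1 + ‖(fc d lam)^[k] 0‖ ^ 2) / (d : ℝ) ^ (k - 1))
      Filter.atTop (nhds (gI lam))) :
    ∃ C : ℝ, 0 < C ∧ ∀ n : ℕ, 1 ≤ n → ∀ φ : ℂ → ℝ, ∀ φinf : ℝ,
      ContDiff ℝ 2 φ →
      ContDiffAt ℝ 2 (fun w : ℂ => if w = 0 then φinf else φ w⁻¹) 0 →
      ∀ K : ℝ, (∀ lam : ℂ, |(1 + ‖lam‖ ^ 2) ^ 2 * lap φ lam / 2| ≤ K) →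
      |((d : ℝ) - 1) * (∑ᶠ lam ∈ {l : ℂ | (fc d l)^[n] 0 = 0}, φ lam)
          - (d : ℝ) ^ n * (((d : ℝ) - 1) / d *
              (φinf + ∫ lam : ℂ, gI lam * lap φ lam / (2 * π)))|
        ≤ K * ((2 * Real.log d) * n + C) := by
  obtain ⟨E, hE, main⟩ := core d hd gI hgI
  have hd2 : (2:ℝ) ≤ d := by exact_mod_cast hd
  have hq' : (0:ℝ) ≤ 9 * d / 4 := by positivity
  have hdd : d - 1 ≠ 0 := by omega
  set q : ℝ := (9 * d / 4 : ℝ) ^ (((d - 1 : ℕ) : ℝ)⁻¹) with hqd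
  have hq : q ^ (d - 1) = 9 * d / 4 := Real.rpow_inv_natCast_pow hq' hdd
  have hq1 : 1 ≤ q := Real.one_le_rpow (by linarith) (by positivity)
  have hq0 : 0 < q := by linarith
  have lq : ((d:ℝ) - 1) * Real.log q = Real.log (9 * d / 4) := by
    rw [← hq, Real.log_pow, Nat.cast_sub (by omega)]; simp
  obtain ⟨c, c0, c1, hc⟩ := nonvan d hd q hq0 hq
  set δ := 2 * Real.log d - 4 / 5 * Real.log (9 * d / 4) with hδ
  have δ0 : 0 < δ := by
    have a1 : Real.log (9 * d / 4) = Real.log (9 / 4) + Real.log d := by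
      rw [← Real.log_mul (by norm_num) (by positivity)]; congr 1; ring
    have a2 : Real.log 2 ≤ Real.log d := Real.log_le_log (by norm_num) hd2
    have a3 : Real.log ((9 / 4 : ℝ) ^ 4) < Real.log (2 ^ 6) := Real.log_lt_log (by norm_num) (by norm_num)
    rw [Real.log_pow, Real.log_pow] at a3
    push_cast at a3
    rw [hδ, a1]; linarith
  set s := δ / (4 / 5 * ((d:ℝ) - 1)) with hs
  have hd1 : (0:ℝ) < (d:ℝ) - 1 := by linarith
  have s0 : 0 < s := by positivity
  set C1 := ((d:ℝ) - 1) * (4 / 5 * (Real.log (2 / c) - Real.log s) + E) with hC1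
  refine ⟨|C1| + 1, by positivity, ?_⟩
  intro n hn φ φinf hφ hi K hK
  have K0 : 0 ≤ K := (abs_nonneg _).trans (hK 0)
  obtain ⟨N, rfl⟩ : ∃ N, n = N + 1 := ⟨n - 1, by omega⟩
  set n := N + 1 with hnn
  have n1 : (1:ℝ) ≤ n := by exact_mod_cast hn
  have qn : 1 ≤ q ^ n := one_le_pow₀ hq1
  have nq : 1 ≤ (n:ℝ) * q ^ n := by nlinarith
  have m := main N (c / 2 / (n * q ^ n)) (by positivity) (by
      rw [div_le_one (by positivity)]; linarith) (fun z hz => hc n hn z (lt_of_le_of_lt hz (by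
        apply div_lt_div_of_pos_right _ (by positivity)
        linarith))) φ φinf hφ hi K hK
  refine m.trans ?_
  have lr : Real.log (1 / (c / 2 / (n * q ^ n))) = Real.log (2 / c) + Real.log n + n * Real.log q := by
    rw [show 1 / (c / 2 / (n * q ^ n)) = 2 / c * n * q ^ n by field_simp, Real.log_mul (by positivity) (by positivity),
      Real.log_mul (by positivity) (by positivity), Real.log_pow]
  have ln : Real.log n ≤ s * n - Real.log s := by
    have := Real.log_le_sub_one_of_pos (show 0 < s * n by positivity)
    rw [Real.log_mul (by positivity) (by positivity)] at this
    linarith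
  rw [lr, mul_comm ((d:ℝ) - 1) K, mul_assoc]
  gcongr
  have e1 : (4 / 5 * ((d:ℝ) - 1)) * s = δ := by rw [hs]; field_simp
  have e2 : (4 / 5 * ((d:ℝ) - 1)) * Real.log n ≤ (4 / 5 * ((d:ℝ) - 1)) * (s * n - Real.log s) := by gcongr
  have e3 : (4 / 5 * ((d:ℝ) - 1)) * (s * n - Real.log s) = δ * n - (4 / 5 * ((d:ℝ) - 1)) * Real.log s := by
    rw [← e1]; ring
  have e4 := le_abs_self C1
  have e5 : ((d:ℝ) - 1) * (4 / 5 * (Real.log (2 / c) + Real.log n + n * Real.log q) + E) =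
     (4 / 5 * ((d:ℝ) - 1)) * Real.log n + 4 / 5 * n * (((d:ℝ) - 1) * Real.log q) + ((d:ℝ) - 1) * (4 / 5 * Real.log (2 / c) + E) := by ring
  rw [e5, lq]
  have e6 : C1 = ((d:ℝ) - 1) * (4 / 5 * Real.log (2 / c) + E) - (4 / 5 * ((d:ℝ) - 1)) * Real.log s := by rw [hC1]; ring
  have e7 : 2 * Real.log d * n = δ * n + 4 / 5 * n * Real.log (9 * d / 4) := by rw [hδ]; ring
  linarith
end

section
/- For every integer n ≥ 1 and every w ∈ ℂ, the function λ ↦ ∏_{z : Φ_n(λ,z)=0} ((f_λ^n)′(z) − w), where the product is over the roots of Φ_n(λ,·) counted with multiplicity, is a polynomial in λ of degree n·(d−1)·ν(n)/d whose leading coefficient is d^{n·ν(n)}; in particular both the degree and the leading coefficient are independent of w. -/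
open Polynomial

noncomputable def nu (d n : ℕ) : ℤ :=
  ∑ m ∈ n.divisors, ArithmeticFunction.moebius (n / m) * (d : ℤ) ^ m

noncomputable section Helpers

def itP (d : ℕ) : ℕ → Polynomial (Polynomial ℂ)
  | 0 => X
  | m + 1 => itP d m ^ d + C X

def gP (d : ℕ) (lam : ℂ) (m : ℕ) : Polynomial ℂ := (itP d m).map (evalRingHom lam)

def ppP (d : ℕ) (lam : ℂ) (m : ℕ) : Polynomial ℂ := gP d lam m - X

/-- the critical orbit polynomials -/
def crP (d : ℕ) : ℕ → Polynomial ℂ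
  | 0 => 0
  | m + 1 => crP d m ^ d + X

lemma gP_succ (d : ℕ) (lam : ℂ) (m : ℕ) : gP d lam (m + 1) = gP d lam m ^ d + C lam := by
  simp [gP, itP]

lemma gP_eval (d : ℕ) (lam : ℂ) (m : ℕ) (z : ℂ) :
    (gP d lam m).eval z = (fc d lam)^[m] z := by
  induction m with
  | zero => simp [gP, itP]
  | succ m ih => rw [gP_succ, Function.iterate_succ_apply', ← ih]; simp [fc]

lemma crP_eval (d : ℕ) (hd : 1 < d) (lam : ℂ) (m : ℕ) :
    (crP d m).eval lam = (fc d lam)^[m] 0 := by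
  induction m with
  | zero => simp [crP]
  | succ m ih => rw [crP, Function.iterate_succ_apply', ← ih]; simp [fc]

lemma gP_monic (d : ℕ) (hd : 1 < d) (lam : ℂ) (m : ℕ) :
    (gP d lam m).Monic ∧ (gP d lam m).natDegree = d ^ m := by
  induction m with
  | zero => simp [gP, itP]
  | succ m ih =>
    obtain ⟨h1, h2⟩ := ih
    have h3 : (gP d lam m ^ d).natDegree = d ^ (m + 1) := by
      rw [h1.natDegree_pow, h2]; ring
    have hpos : 0 < d ^ (m + 1) := by positivity
    rw [gP_succ]
    refine ⟨(h1.pow d).add_of_left ?_, ?_⟩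
    · refine lt_of_le_of_lt degree_C_le ?_
      rw [← natDegree_pos_iff_degree_pos, h3]; exact hpos
    · rw [natDegree_add_C, h3]

lemma crP_monic (d : ℕ) (hd : 1 < d) (m : ℕ) :
    (crP d (m + 1)).Monic ∧ (crP d (m + 1)).natDegree = d ^ m := by
  induction m with
  | zero => 
    have : d ≠ 0 := by omega
    simp [crP, this]
  | succ m ih =>
    obtain ⟨h1, h2⟩ := ih
    have h3 : (crP d (m + 1) ^ d).natDegree = d ^ (m + 1) := by
      rw [h1.natDegree_pow, h2]; ring
    have hlt : 1 < d ^ (m + 1) := Nat.one_lt_pow (by omega) hd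
    have hdeg : (X : ℂ[X]).degree < (crP d (m + 1) ^ d).degree := by
      rw [degree_X, degree_eq_natDegree (h1.pow d).ne_zero, h3]
      exact_mod_cast hlt
    rw [crP]
    refine ⟨(h1.pow d).add_of_left hdeg, ?_⟩
    rw [natDegree_add_eq_left_of_degree_lt hdeg, h3]

lemma ppP_monic (d : ℕ) (hd : 1 < d) (lam : ℂ) (m : ℕ) (hm : 1 ≤ m) :
    (ppP d lam m).Monic ∧ (ppP d lam m).natDegree = d ^ m := by
  obtain ⟨h1, h2⟩ := gP_monic d hd lam m
  have hlt : 1 < d ^ m := Nat.one_lt_pow (by omega) hd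
  have hdeg : (X : ℂ[X]).degree < (gP d lam m).degree := by
    rw [degree_X, degree_eq_natDegree h1.ne_zero, h2]
    exact_mod_cast hlt
  refine ⟨h1.sub_of_left hdeg, ?_⟩
  rw [ppP, natDegree_sub_eq_left_of_natDegree_lt, h2]
  rw [natDegree_X, h2]; exact hlt

lemma ppP_eval (d : ℕ) (lam : ℂ) (m : ℕ) (z : ℂ) :
    (ppP d lam m).eval z = (fc d lam)^[m] z - z := by
  rw [ppP, eval_sub, gP_eval, eval_X]

lemma swap_prod (p g : ℂ[X]) (hp : p.Monic) (hg : g.Monic) :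
    (p.roots.map g.eval).prod =
      (-1) ^ (p.natDegree * g.natDegree) * (g.roots.map p.eval).prod := by
  have h := resultant_comm p g p.natDegree g.natDegree
  rw [resultant_eq_prod_eval p g _ le_rfl (IsAlgClosed.splits p),
    resultant_eq_prod_eval g p _ le_rfl (IsAlgClosed.splits g), hp.leadingCoeff,
    hg.leadingCoeff] at h
  simpa using h

lemma key_lt (d : ℕ) (hd : 1 < d) (lam : ℂ) (m i : ℕ) (hi : i < m) :
    ((ppP d lam m).roots.map (fc d lam)^[i]).prod = (-1) ^ d * (fc d lam)^[m] 0 := by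
  obtain ⟨h1, h2⟩ := ppP_monic d hd lam m (by omega)
  obtain ⟨h3, h4⟩ := gP_monic d hd lam i
  have h := swap_prod _ _ h1 h3
  have e : (gP d lam i).eval = (fc d lam)^[i] := funext fun z => gP_eval d lam i z
  rw [e] at h
  rw [h, h2, h4, ← pow_add]
  congr 1
  · rcases Nat.even_or_odd d with hh | hh
    · rw [hh.neg_one_pow, (hh.pow_of_ne_zero (by omega)).neg_one_pow]
    · rw [hh.neg_one_pow, hh.pow.neg_one_pow]
  · have : (gP d lam i).roots.map (ppP d lam m).eval
        = (gP d lam i).roots.map (fun y => (fc d lam)^[m - i] 0 - y) := by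
      refine Multiset.map_congr rfl fun y hy => ?_
      rw [mem_roots h3.ne_zero, IsRoot.def, gP_eval] at hy
      rw [ppP_eval]
      conv_lhs => rw [show m = (m - i) + i by omega, Function.iterate_add_apply, hy]
    rw [this]
    have e2 := (IsAlgClosed.splits (gP d lam i)).eq_prod_roots_of_monic h3
    have e3 : (gP d lam i).eval ((fc d lam)^[m - i] 0) = (fc d lam)^[m] 0 := by
      rw [gP_eval, ← Function.iterate_add_apply]
      congr 2; omega
    rw [← e3]
    conv_rhs => rw [e2]
    rw [eval_multiset_prod, Multiset.map_map]
    simp [Function.comp_def]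

lemma key (d : ℕ) (hd : 1 < d) (lam : ℂ) (m i : ℕ) (hm : 1 ≤ m) :
    ((ppP d lam m).roots.map (fc d lam)^[i]).prod = (-1) ^ d * (fc d lam)^[m] 0 := by
  rw [← key_lt d hd lam m (i % m) (Nat.mod_lt _ hm)]
  congr 1
  refine Multiset.map_congr rfl fun z hz => ?_
  rw [mem_roots (ppP_monic d hd lam m hm).1.ne_zero, IsRoot.def, ppP_eval, sub_eq_zero] at hz
  exact (Function.IsPeriodicPt.iterate_mod_apply (f := fc d lam) hz i).symm

lemma roots_prod_map (s : Finset ℕ) (p : ℕ → ℂ[X]) (hp : ∀ m ∈ s, (p m).Monic) (h : ℂ → ℂ) :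
    ((∏ m ∈ s, p m).roots.map h).prod = ∏ m ∈ s, ((p m).roots.map h).prod := by
  rw [roots_prod _ _ (monic_prod_of_monic _ _ hp).ne_zero, Multiset.map_bind, Multiset.prod_bind]
  rfl

lemma fc_deriv (d : ℕ) (lam : ℂ) (n : ℕ) (z : ℂ) :
    deriv ((fc d lam)^[n]) z = (d : ℂ) ^ n * ∏ i ∈ Finset.range n, ((fc d lam)^[i] z) ^ (d - 1) := by
  apply HasDerivAt.deriv
  induction n with
  | zero => simpa using hasDerivAt_id z
  | succ n ih =>
    have := (ih.pow d).add_const lam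
    rw [Function.iterate_succ']
    refine (this.congr_deriv ?_)
    rw [Finset.prod_range_succ]
    ring

lemma fc_deriv_eval (d : ℕ) (lam : ℂ) (n : ℕ) (z : ℂ) :
    deriv ((fc d lam)^[n]) z = ((itP d n).derivative.map (evalRingHom lam)).eval z := by
  have e : (gP d lam n).eval = (fc d lam)^[n] := funext fun z => gP_eval d lam n z
  rw [← e, Polynomial.deriv, gP, derivative_map]

/-- periodic points are large when the parameter is large -/
lemma escape (d : ℕ) (hd : 1 < d) (lam z : ℂ) (hl : 8 ≤ ‖lam‖) (hz : ‖lam‖ / 2 < ‖z‖) (k : ℕ) :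
    ‖z‖ < ‖(fc d lam)^[k + 1] z‖ := by
  have step : ∀ y : ℂ, ‖lam‖ / 2 < ‖y‖ → ‖y‖ < ‖fc d lam y‖ := by
    intro y hy
    have h1 : ‖y‖ ^ d - ‖lam‖ ≤ ‖fc d lam y‖ := by
      have := norm_sub_le (fc d lam y) lam
      have e : fc d lam y - lam = y ^ d := by simp [fc]
      rw [e, norm_pow] at this
      linarith
    have h2 : ‖y‖ ^ 2 ≤ ‖y‖ ^ d := pow_le_pow_right₀ (by linarith) hd
    nlinarith
  induction k with
  | zero => simpa using step z hz
  | succ k ih =>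
    rw [Function.iterate_succ_apply']
    exact ih.trans (step _ (hz.trans ih))

lemma per_le (d : ℕ) (hd : 1 < d) (lam z : ℂ) (n : ℕ) (hn : 1 ≤ n) (hl : 8 ≤ ‖lam‖)
    (hz : (fc d lam)^[n] z = z) : ‖z‖ ≤ ‖lam‖ / 2 := by
  by_contra! h
  have := escape d hd lam z hl h (n - 1)
  rw [Nat.sub_add_cancel hn, hz] at this
  exact lt_irrefl _ this

lemma per_ge (d : ℕ) (hd : 1 < d) (lam z : ℂ) (n : ℕ) (hn : 1 ≤ n) (hl : 8 ≤ ‖lam‖)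
    (M : ℝ) (hM : 1 ≤ M) (hlM : 2 * M ^ d ≤ ‖lam‖)
    (hz : (fc d lam)^[n] z = z) : M ≤ ‖z‖ := by
  have h1 : (fc d lam)^[n] (fc d lam z) = fc d lam z := by
    rw [← Function.iterate_succ_apply, Function.iterate_succ_apply', hz]
  have h2 := per_le d hd lam _ n hn hl h1
  have h3 : ‖lam‖ ≤ ‖fc d lam z‖ + ‖z‖ ^ d := by
    have := norm_sub_le (fc d lam z) (z ^ d)
    have e : fc d lam z - z ^ d = lam := by simp [fc]
    rwa [e, norm_pow] at this
  exact le_of_pow_le_pow_left₀ (n := d) (by omega) (norm_nonneg _) (by linarith)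

lemma deriv_ge (d : ℕ) (hd : 1 < d) (lam z : ℂ) (n : ℕ) (hn : 1 ≤ n) (hl : 8 ≤ ‖lam‖)
    (M : ℝ) (hM : 1 ≤ M) (hlM : 2 * M ^ d ≤ ‖lam‖)
    (hz : (fc d lam)^[n] z = z) : M ≤ ‖deriv ((fc d lam)^[n]) z‖ := by
  rw [fc_deriv, norm_mul, norm_prod, norm_pow, Complex.norm_natCast]
  have hi : ∀ i, M ≤ ‖((fc d lam)^[i] z) ^ (d - 1)‖ := by
    intro i
    have h1 : (fc d lam)^[n] ((fc d lam)^[i] z) = (fc d lam)^[i] z := by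
      rw [← Function.iterate_add_apply, add_comm, Function.iterate_add_apply, hz]
    have h2 := per_ge d hd lam _ n hn hl M hM hlM h1
    rw [norm_pow]
    exact h2.trans (le_self_pow₀ (hM.trans h2) (by omega))
  have h3 : M ≤ ∏ i ∈ Finset.range n, ‖((fc d lam)^[i] z) ^ (d - 1)‖ := by
    calc M ≤ M ^ n := le_self_pow₀ hM (by omega)
      _ = ∏ i ∈ Finset.range n, M := by simp
      _ ≤ _ := Finset.prod_le_prod (fun _ _ => by linarith) (fun i _ => hi i)
  have h4 : (1 : ℝ) ≤ (d : ℝ) ^ n := one_le_pow₀ (by exact_mod_cast hd.le)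
  nlinarith

lemma prod_close (s : Multiset ℂ) (a b : ℂ → ℂ) (ε : ℝ) (hε : 0 ≤ ε)
    (h : ∀ z ∈ s, ‖b z - a z‖ ≤ ε * ‖a z‖) :
    ‖(s.map b).prod - (s.map a).prod‖ ≤ ((1 + ε) ^ s.card - 1) * ‖(s.map a).prod‖ := by
  induction s using Multiset.induction_on with
  | empty => simp
  | cons x s ih =>
    have ih' := ih fun z hz => h z (Multiset.mem_cons_of_mem hz)
    have hx := h x (Multiset.mem_cons_self x s)
    simp only [Multiset.map_cons, Multiset.prod_cons, Multiset.card_cons]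
    set A := (s.map a).prod
    set B := (s.map b).prod
    have e : b x * B - a x * A = (b x - a x) * A + (b x - a x) * (B - A) + a x * (B - A) := by ring
    have h1 := norm_add₃_le (a := (b x - a x) * A) (b := (b x - a x) * (B - A)) (c := a x * (B - A))
    rw [← e] at h1
    simp only [norm_mul] at h1 ⊢
    have h2 : ‖b x - a x‖ * ‖A‖ ≤ ε * ‖a x‖ * ‖A‖ := by gcongr
    have h3 : ‖b x - a x‖ * ‖B - A‖ ≤ ε * ‖a x‖ * (((1 + ε) ^ s.card - 1) * ‖A‖) := by gcongr
    have h4 : ‖a x‖ * ‖B - A‖ ≤ ‖a x‖ * (((1 + ε) ^ s.card - 1) * ‖A‖) := by gcongr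
    refine h1.trans ((add_le_add (add_le_add h2 h3) h4).trans (le_of_eq ?_))
    ring

lemma degree_lt_of_isLittleO (p g : ℂ[X]) (hg : g ≠ 0)
    (h : p.eval =o[Bornology.cobounded ℂ] g.eval) : p.degree < g.degree := by
  by_contra! hle
  have h1 := (isBigO_cobounded_of_degree_le hle).trans_isLittleO h
  have h2 := Asymptotics.isLittleO_irrefl' (l := Bornology.cobounded ℂ) (f' := g.eval) ?_
  · exact h2 h1
  · refine Filter.Eventually.frequently ?_
    have := eventually_cofinite_not_isRoot hg
    have := this.filter_mono (Bornology.le_cofinite ℂ)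
    filter_upwards [this] with x hx
    simpa [IsRoot] using hx

lemma nu_eq (d n : ℕ) : nu d n =
    ∑ m ∈ n.divisors.filter (fun m => ArithmeticFunction.moebius (n / m) = 1), (d : ℤ) ^ m -
    ∑ m ∈ n.divisors.filter (fun m => ArithmeticFunction.moebius (n / m) = -1), (d : ℤ) ^ m := by
  rw [nu, Finset.sum_filter, Finset.sum_filter, ← Finset.sum_sub_distrib]
  refine Finset.sum_congr rfl fun m _ => ?_
  rcases ArithmeticFunction.moebius_eq_or (n / m) with h | h | h <;> simp [h]

lemma crP_prod (d : ℕ) (hd : 1 < d) (s : Finset ℕ) (hs : ∀ m ∈ s, 1 ≤ m) :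
    (∏ m ∈ s, crP d m).Monic ∧ (d : ℤ) * (∏ m ∈ s, crP d m).natDegree = ∑ m ∈ s, (d : ℤ) ^ m := by
  have hm : ∀ m ∈ s, (crP d m).Monic ∧ (d : ℤ) * (crP d m).natDegree = (d : ℤ) ^ m := by
    intro m hm
    obtain ⟨k, rfl⟩ : ∃ k, m = k + 1 := ⟨m - 1, by have := hs m hm; omega⟩
    refine ⟨(crP_monic d hd k).1, ?_⟩
    rw [(crP_monic d hd k).2]; push_cast; ring
  refine ⟨monic_prod_of_monic _ _ fun m h => (hm m h).1, ?_⟩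
  rw [natDegree_prod_of_monic _ _ fun m h => (hm m h).1]
  push_cast
  rw [Finset.mul_sum]
  exact Finset.sum_congr rfl fun m h => (hm m h).2

end Helpers

theorem statement12 (d : ℕ) (hd : 1 < d) (n : ℕ) (hn : 1 ≤ n)
    (Φ : Polynomial (Polynomial ℂ))
    (hΦprod : ∀ lam z : ℂ,
      (∏ m ∈ n.divisors.filter fun m => ArithmeticFunction.moebius (n / m) = 1,
          ((fc d lam)^[m] z - z)) =
        (Φ.map (evalRingHom lam)).eval z *
          ∏ m ∈ n.divisors.filter fun m => ArithmeticFunction.moebius (n / m) = -1,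
            ((fc d lam)^[m] z - z))
    (hΦmonic : ∀ lam : ℂ, (Φ.map (evalRingHom lam)).Monic)
    (hΦdeg : ∀ lam : ℂ, ((Φ.map (evalRingHom lam)).natDegree : ℤ) = nu d n) :
    ∀ w : ℂ, ∃ q : Polynomial ℂ,
      (∀ lam : ℂ, q.eval lam =
          (((Φ.map (evalRingHom lam)).roots).map
            (fun z => deriv ((fc d lam)^[n]) z - w)).prod) ∧
      (q.natDegree : ℤ) = (n : ℤ) * ((d : ℤ) - 1) * nu d n / (d : ℤ) ∧
      q.leadingCoeff = (d : ℂ) ^ ((n : ℤ) * nu d n) := by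
  classical
  set Tp := n.divisors.filter fun m => ArithmeticFunction.moebius (n / m) = 1 with hTp
  set Tm := n.divisors.filter fun m => ArithmeticFunction.moebius (n / m) = -1 with hTm
  have hTp1 : ∀ m ∈ Tp, 1 ≤ m := fun m hm =>
    Nat.pos_of_mem_divisors (Finset.mem_filter.1 hm).1
  have hTm1 : ∀ m ∈ Tm, 1 ≤ m := fun m hm =>
    Nat.pos_of_mem_divisors (Finset.mem_filter.1 hm).1
  obtain ⟨N, hN⟩ : ∃ N : ℕ, (N : ℤ) = nu d n := ⟨_, hΦdeg 0⟩
  have hNl : ∀ lam : ℂ, (Φ.map (evalRingHom lam)).natDegree = N := fun lam => by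
    have := hΦdeg lam
    rw [← hN] at this
    exact_mod_cast this
  have hcard : ∀ lam : ℂ, Multiset.card (Φ.map (evalRingHom lam)).roots = N := fun lam => by
    rw [← hNl lam]
    exact (IsAlgClosed.splits _).natDegree_eq_card_roots.symm
  -- polynomial identity
  have hpoly : ∀ lam : ℂ, ∏ m ∈ Tp, ppP d lam m =
      Φ.map (evalRingHom lam) * ∏ m ∈ Tm, ppP d lam m := by
    intro lam
    refine Polynomial.funext fun z => ?_
    rw [eval_mul, eval_prod, eval_prod]
    simp only [ppP_eval]
    exact hΦprod lam z
  have hpp : ∀ lam : ℂ, ∀ m ∈ Tp, (ppP d lam m).Monic := fun lam m hm =>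
    (ppP_monic d hd lam m (hTp1 m hm)).1
  have hpm : ∀ lam : ℂ, ∀ m ∈ Tm, (ppP d lam m).Monic := fun lam m hm =>
    (ppP_monic d hd lam m (hTm1 m hm)).1
  -- roots are periodic
  have hper : ∀ lam : ℂ, ∀ z ∈ (Φ.map (evalRingHom lam)).roots, (fc d lam)^[n] z = z := by
    intro lam z hz
    have hz' := (mem_roots (hΦmonic lam).ne_zero).1 hz
    have h0 := hΦprod lam z
    rw [IsRoot.def.1 hz', zero_mul, Finset.prod_eq_zero_iff] at h0
    obtain ⟨m, hm, hm0⟩ := h0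
    have hdvd : m ∣ n := Nat.dvd_of_mem_divisors (Finset.mem_filter.1 hm).1
    have hp : Function.IsPeriodicPt (fc d lam) m z := sub_eq_zero.1 hm0
    exact hp.trans_dvd hdvd
  -- the constant coefficient
  obtain ⟨c, hc⟩ : ∃ c : ℂ[X], c = Φ.coeff 0 := ⟨_, rfl⟩
  have hceval : ∀ lam : ℂ, c.eval lam = (Φ.map (evalRingHom lam)).eval 0 := fun lam => by
    rw [← coeff_zero_eq_eval_zero, coeff_map, hc]; rfl
  have hcid : ∏ m ∈ Tp, crP d m = c * ∏ m ∈ Tm, crP d m := by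
    refine Polynomial.funext fun lam => ?_
    rw [eval_mul, eval_prod, eval_prod, hceval]
    simp only [crP_eval d hd]
    simpa using hΦprod lam 0
  obtain ⟨hP1, hP2⟩ := crP_prod d hd Tp hTp1
  obtain ⟨hM1, hM2⟩ := crP_prod d hd Tm hTm1
  have hcmonic : c.Monic := hM1.of_mul_monic_right (hcid ▸ hP1)
  have hcdeg : d * c.natDegree = N := by
    have h1 := congrArg natDegree hcid
    rw [hcmonic.natDegree_mul hM1] at h1
    have h2 := nu_eq d n
    rw [← hTp, ← hTm, ← hP2, ← hM2, h1, ← hN] at h2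
    push_cast at h2
    have : ((d * c.natDegree : ℕ) : ℤ) = N := by push_cast; linarith
    exact_mod_cast this
  -- product of iterates
  have hiter : ∀ lam : ℂ, (∏ m ∈ Tm, crP d m).eval lam ≠ 0 → ∀ i,
      ((Φ.map (evalRingHom lam)).roots.map (fc d lam)^[i]).prod = (-1) ^ N * c.eval lam := by
    intro lam hlam i
    have hne : ∏ m ∈ Tm, ((-1) ^ d * (fc d lam)^[m] 0) ≠ 0 := by
      rw [eval_prod, Finset.prod_ne_zero_iff] at hlam
      rw [Finset.prod_ne_zero_iff]
      intro m hm
      have := hlam m hm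
      rw [crP_eval d hd] at this
      exact mul_ne_zero (pow_ne_zero _ (by norm_num)) this
    have hgen : ∀ j, ((Φ.map (evalRingHom lam)).roots.map (fc d lam)^[j]).prod *
        ∏ m ∈ Tm, ((-1) ^ d * (fc d lam)^[m] 0) = ∏ m ∈ Tp, ((-1) ^ d * (fc d lam)^[m] 0) := by
      intro j
      have h1 := roots_prod_map Tp (ppP d lam) (hpp lam) (fc d lam)^[j]
      rw [hpoly lam, roots_mul (mul_ne_zero (hΦmonic lam).ne_zero
        (monic_prod_of_monic _ _ (hpm lam)).ne_zero), Multiset.map_add, Multiset.prod_add,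
        roots_prod_map Tm (ppP d lam) (hpm lam),
        Finset.prod_congr rfl fun m hm => key d hd lam m j (hTm1 m hm),
        Finset.prod_congr rfl fun m hm => key d hd lam m j (hTp1 m hm)] at h1
      exact h1
    have h2 := mul_right_cancel₀ hne ((hgen i).trans (hgen 0).symm)
    rw [h2]
    have h3 := swap_prod _ X (hΦmonic lam) monic_X
    rw [hNl, natDegree_X, roots_X, mul_one] at h3
    simpa [hceval] using h3
  -- the leading polynomial
  obtain ⟨q0, hq0⟩ : ∃ q0 : ℂ[X], q0 = C ((d : ℂ) ^ (n * N)) * c ^ (n * (d - 1)) := ⟨_, rfl⟩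
  have hd0 : (d : ℂ) ≠ 0 := by exact_mod_cast (by omega : d ≠ 0)
  have hdn0 : (d : ℂ) ^ (n * N) ≠ 0 := pow_ne_zero _ hd0
  have hq0ne : q0 ≠ 0 := by
    rw [hq0]
    exact mul_ne_zero (C_ne_zero.2 hdn0) (pow_ne_zero _ hcmonic.ne_zero)
  have hq0deg : q0.natDegree = n * (d - 1) * c.natDegree := by
    rw [hq0, natDegree_C_mul hdn0, hcmonic.natDegree_pow]
  have hq0lead : q0.leadingCoeff = (d : ℂ) ^ (n * N) := by
    rw [hq0, leadingCoeff_mul, leadingCoeff_C, (hcmonic.pow _).leadingCoeff, mul_one]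
  have hsign : ((-1 : ℂ) ^ N) ^ (d - 1) = 1 := by
    rw [← hcdeg, ← pow_mul]
    apply Even.neg_one_pow
    have : Even (d * (d - 1)) := by
      have := Nat.even_mul_pred_self d
      exact this
    rw [show d * c.natDegree * (d - 1) = d * (d - 1) * c.natDegree by ring]
    exact this.mul_right _
  have hq0eval : ∀ lam : ℂ, (∏ m ∈ Tm, crP d m).eval lam ≠ 0 →
      ((Φ.map (evalRingHom lam)).roots.map (fun z => deriv ((fc d lam)^[n]) z)).prod
        = q0.eval lam := by
    intro lam hlam
    simp only [fc_deriv]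
    rw [Multiset.prod_map_mul, Multiset.map_const', Multiset.prod_replicate, hcard, ← pow_mul]
    rw [Multiset.prod_map_prod]
    simp only [Multiset.prod_map_pow]
    rw [Finset.prod_congr rfl fun i _ => by rw [hiter lam hlam i], Finset.prod_const,
      Finset.card_range, mul_pow, hsign, one_mul, hq0, ← pow_mul]
    simp only [eval_mul, eval_C, eval_pow]
    rw [mul_comm n (d - 1)]
  intro w
  obtain ⟨g, hg⟩ : ∃ g : ℂ[X][X], g = (itP d n).derivative - C (C w) := ⟨_, rfl⟩
  obtain ⟨q, hq⟩ : ∃ q : ℂ[X], q = resultant Φ g N g.natDegree := ⟨_, rfl⟩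
  have hqeval : ∀ lam : ℂ, q.eval lam =
          (((Φ.map (evalRingHom lam)).roots).map
            (fun z => deriv ((fc d lam)^[n]) z - w)).prod := by
    intro lam
    have h1 : q.eval lam = evalRingHom lam (resultant Φ g N g.natDegree) := by rw [hq]; rfl
    have h2 := resultant_eq_prod_eval (Φ.map (evalRingHom lam)) (g.map (evalRingHom lam))
      g.natDegree natDegree_map_le (IsAlgClosed.splits _)
    rw [hNl, (hΦmonic lam).leadingCoeff, one_pow, one_mul] at h2
    rw [h1, ← resultant_map_map, h2]
    congr 1
    refine Multiset.map_congr rfl fun z _ => ?_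
    rw [fc_deriv_eval, hg]
    simp
  have hlit : (q - q0).eval =o[Bornology.cobounded ℂ] q0.eval := by
    rw [Asymptotics.isLittleO_iff]
    intro δ hδ
    -- choose ε
    obtain ⟨ε, hε, hεδ⟩ : ∃ ε : ℝ, 0 < ε ∧ (1 + ε) ^ N - 1 ≤ δ := by
      have hcont : Filter.Tendsto (fun ε : ℝ => (1 + ε) ^ N - 1) (nhdsWithin 0 (Set.Ioi 0))
          (nhds 0) := by
        have : Continuous (fun ε : ℝ => (1 + ε) ^ N - 1) := by fun_prop
        have h := this.tendsto 0
        simp only [add_zero, one_pow, sub_self] at h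
        exact h.mono_left nhdsWithin_le_nhds
      have h1 := hcont.eventually (gt_mem_nhds hδ)
      obtain ⟨ε, h2, h3⟩ := (h1.and self_mem_nhdsWithin).exists
      exact ⟨ε, h3, h2.le⟩
    obtain ⟨M, hM, hMw⟩ : ∃ M : ℝ, 1 ≤ M ∧ ‖w‖ ≤ ε * M := by
      refine ⟨max 1 (‖w‖ / ε), le_max_left _ _, ?_⟩
      have := le_max_right 1 (‖w‖ / ε)
      rw [div_le_iff₀ hε] at this
      linarith
    have e1 := (eventually_cofinite_not_isRoot hM1.ne_zero).filter_mono (Bornology.le_cofinite ℂ)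
    have e2 := (tendsto_norm_cobounded_atTop (E := ℂ)).eventually_ge_atTop 8
    have e3 := (tendsto_norm_cobounded_atTop (E := ℂ)).eventually_ge_atTop (2 * M ^ d)
    filter_upwards [e1, e2, e3] with lam h1 h2 h3
    rw [eval_sub, hqeval, ← hq0eval lam h1]
    have hclose := prod_close (Φ.map (evalRingHom lam)).roots
      (fun z => deriv ((fc d lam)^[n]) z) (fun z => deriv ((fc d lam)^[n]) z - w) ε hε.le (by
        intro z hz
        have := deriv_ge d hd lam z n hn h2 M hM h3 (hper lam z hz)
        rw [sub_sub_cancel_left, norm_neg]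
        exact hMw.trans (by gcongr))
    rw [hcard] at hclose
    exact hclose.trans (by gcongr)
  have hlt := degree_lt_of_isLittleO _ _ hq0ne hlit
  have hqq : q = q0 + (q - q0) := by ring
  refine ⟨q, hqeval, ?_, ?_⟩
  · rw [hqq, natDegree_add_eq_left_of_degree_lt hlt, hq0deg, ← hN, ← hcdeg]
    have hdz : (d : ℤ) ≠ 0 := by exact_mod_cast (by omega : d ≠ 0)
    push_cast [Nat.cast_sub hd.le]
    rw [show (n : ℤ) * ((d : ℤ) - 1) * (d * c.natDegree) = (n * ((d : ℤ) - 1) * c.natDegree) * d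
      by ring, Int.mul_ediv_cancel _ hdz]
  · rw [hqq, leadingCoeff_add_of_degree_lt' hlt, hq0lead, ← hN]
    exact_mod_cast rfl
end
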